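/- Assume n > 1. There exists a family 𝓕̄ of algebraic subgroups of GL_n(k), each having a triangular representation bounded by n·8^{5.5n³·16^{(2n³)^{149n⁸}}}, such that for every algebraic subgroup H' ⊆ GL_n(k) there exists H̄ ∈ 𝓕̄ with H' ⊆ H̄ and with every unipotent element of H̄ lying in (H')°. -/

import Mathlib

open MvPolynomial Matrix Pointwise

section TriSets

variable {k : Type*} [Field k] {σ : Type*} [LinearOrder σ]

noncomputable def leadCoeff (c : σ) (g : MvPolynomial σ k) : MvPolynomial σ k :=
  (g.support.filter fun m => m c = g.degreeOf c).sum
    fun m => monomial (Finsupp.erase c m) (g.coeff m)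

def IsTriangularSet (G : List (MvPolynomial σ k)) : Prop :=
  (∀ g ∈ G, g.vars.Nonempty) ∧
  G.Chain' fun g h => g.vars.max < h.vars.max

def IsPseudoRem (G : List (MvPolynomial σ k)) (f r : MvPolynomial σ k) : Prop :=
  ∃ (c : Fin G.length → σ) (α : Fin G.length → ℕ) (q : Fin G.length → MvPolynomial σ k),
    (∀ i, (G.get i).vars.max = (c i : WithBot σ)) ∧
    (∏ i, leadCoeff (c i) (G.get i) ^ α i) * f = (∑ i, q i * G.get i) + r ∧
    ∀ i, r.degreeOf (c i) < (G.get i).degreeOf (c i)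

def trep (G : List (MvPolynomial σ k)) : Set (MvPolynomial σ k) :=
  {f | IsPseudoRem G f 0}

def HasTriRepBoundedBy (I : Ideal (MvPolynomial σ k)) (D : ℝ) : Prop :=
  ∃ (N : ℕ) (G : Fin (N + 1) → List (MvPolynomial σ k)),
    (∀ i, IsTriangularSet (G i)) ∧
    (∀ i, ∀ g ∈ G i, (g.totalDegree : ℝ) ≤ D) ∧
    (∀ i, ∃ J : Ideal (MvPolynomial σ k), J.IsRadical ∧ (J : Set (MvPolynomial σ k)) = trep (G i)) ∧
    (I.radical : Set (MvPolynomial σ k)) = ⋂ i, trep (G i)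

end TriSets

section GLdefs

variable {k : Type*} [Field k]

noncomputable def evalMat {n : ℕ} (g : GL (Fin n) k) : (Fin n ×ₗ Fin n) → k :=
  fun p => (g : Matrix (Fin n) (Fin n) k) (ofLex p).1 (ofLex p).2

def IsZeroSetOf {n : ℕ} (S : Set (MvPolynomial (Fin n ×ₗ Fin n) k))
    (H : Subgroup (GL (Fin n) k)) : Prop :=
  ∀ g : GL (Fin n) k, g ∈ H ↔ ∀ p ∈ S, eval (evalMat g) p = 0

def IsAlgebraicSubgroup {n : ℕ} (H : Subgroup (GL (Fin n) k)) : Prop :=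
  ∃ S : Finset (MvPolynomial (Fin n ×ₗ Fin n) k), IsZeroSetOf (S : Set _) H

/-- `H` is an algebraic subgroup whose defining ideal has a triangular
representation bounded by `D`. -/
def SubgroupTriRepBoundedBy {n : ℕ} (H : Subgroup (GL (Fin n) k)) (D : ℝ) : Prop :=
  ∃ S : Finset (MvPolynomial (Fin n ×ₗ Fin n) k),
    IsZeroSetOf (S : Set (MvPolynomial (Fin n ×ₗ Fin n) k)) H ∧
    HasTriRepBoundedBy (Ideal.span (S : Set (MvPolynomial (Fin n ×ₗ Fin n) k))) D

def IsUnipotent {n : ℕ} (g : GL (Fin n) k) : Prop :=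
  ((g : Matrix (Fin n) (Fin n) k) - 1) ^ n = 0

/-- The Zariski topology on `GL_n(k)`: closed sets are zero sets of families of
polynomials in the matrix entries. -/
def zariskiGL (n : ℕ) (k : Type*) [Field k] : TopologicalSpace (GL (Fin n) k) :=
  TopologicalSpace.generateFrom
    {U | ∃ S : Set (MvPolynomial (Fin n ×ₗ Fin n) k),
      U = {g | ∃ p ∈ S, eval (evalMat g) p ≠ 0}}

/-- The identity component `H°` of a subgroup `H ⊆ GL_n(k)`: the connected component of
the identity in `H` for the (subspace) Zariski topology, viewed as a subset of `GL_n(k)`. -/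
noncomputable def idComponent {n : ℕ} (H : Subgroup (GL (Fin n) k)) : Set (GL (Fin n) k) :=
  letI := zariskiGL n k
  Subtype.val '' connectedComponent (⟨1, H.one_mem⟩ : H)

end GLdefs

/-- The bound `n·8^(5.5n³·16^((2n³)^(149n⁸)))` (real powers). -/
noncomputable def d3Bound (n : ℕ) : ℝ :=
  (n : ℝ) * (8 : ℝ) ^ (5.5 * (n : ℝ) ^ 3 *
    (16 : ℝ) ^ ((2 * (n : ℝ) ^ 3) ^ (149 * (n : ℝ) ^ 8)))

set_option linter.unusedSectionVars false
set_option linter.unusedVariables false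

namespace EF
section basics
variable {n : ℕ} {k : Type*} [Field k]

/-- polynomial ring in the matrix entries -/
abbrev Pn (n : ℕ) (k : Type*) [Field k] := MvPolynomial (Fin n ×ₗ Fin n) k

abbrev Mt (n : ℕ) (k : Type*) := Matrix (Fin n) (Fin n) k

/-- substitution of a matrix -/
noncomputable def ev {R : Type*} [CommRing R] [Algebra k R] (Φ : Mt n R) : Pn n k →ₐ[k] R :=
  aeval fun p => Φ (ofLex p).1 (ofLex p).2

/-- generic matrix -/
noncomputable def Xm (n : ℕ) (k : Type*) [Field k] : Mt n (Pn n k) :=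
  Matrix.of fun i j => X (toLex (i, j))

/-- constant matrix -/
def cm (R : Type*) [CommRing R] [Algebra k R] (x : Mt n k) : Mt n R := x.map (algebraMap k R)

section
variable {R : Type*} [CommRing R] [Algebra k R] {S : Type*} [CommRing S] [Algebra k S]

@[simp] lemma ev_X (Φ : Mt n R) (p : Fin n ×ₗ Fin n) :
    ev (k := k) Φ (X p) = Φ (ofLex p).1 (ofLex p).2 := by simp [ev]

@[simp] lemma ev_Xm (Φ : Mt n R) (i j) : ev (k := k) Φ (Xm n k i j) = Φ i j := by simp [ev, Xm]

lemma Xm_map (Φ : Mt n R) : (Xm n k).map (ev (k := k) Φ) = Φ := by ext i j; simp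

lemma hom_ext' {f g : Pn n k →ₐ[k] R} (h : (Xm n k).map f = (Xm n k).map g) : f = g := by
  apply MvPolynomial.algHom_ext
  intro p
  have := congrFun (congrFun h (ofLex p).1) (ofLex p).2
  simpa [Xm] using this

lemma map_ev (ψ : R →ₐ[k] S) (Φ : Mt n R) (f : Pn n k) : ψ (ev Φ f) = ev (Φ.map ψ) f := by
  have : ψ.comp (ev Φ) = ev (Φ.map ψ) := by
    apply hom_ext'; ext i j; simp
  exact DFunLike.congr_fun this f

lemma ev_id : ev (Xm n k) = AlgHom.id k (Pn n k) := by
  apply hom_ext'; ext i j; simp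

@[simp] lemma cm_map (ψ : R →ₐ[k] S) (x : Mt n k) : (cm R x).map ψ = cm S x := by
  ext i j; simp [cm]
@[simp] lemma cm_mul (x y : Mt n k) : cm R (x * y) = cm R x * cm R y := by
  simp [cm, Matrix.map_mul]
@[simp] lemma cm_add (x y : Mt n k) : cm R (x + y) = cm R x + cm R y := by
  ext; simp [cm]
@[simp] lemma cm_sub (x y : Mt n k) : cm R (x - y) = cm R x - cm R y := by
  ext; simp [cm]
@[simp] lemma cm_smul (c : k) (x : Mt n k) : cm R (c • x) = c • cm R x := by
  ext i j
  rw [cm, Matrix.map_apply, Matrix.smul_apply, Matrix.smul_apply, smul_eq_mul, map_mul,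
    Algebra.smul_def]; rfl
@[simp] lemma cm_one : cm R (1 : Mt n k) = 1 := by simp [cm]
@[simp] lemma cm_zero : cm R (0 : Mt n k) = 0 := by simp [cm]
@[simp] lemma cm_self (x : Mt n k) : cm k x = x := by ext; simp [cm]
@[simp] lemma map_mul' (ψ : R →ₐ[k] S) (x y : Mt n R) : (x * y).map ψ = x.map ψ * y.map ψ := by
  simp [Matrix.map_mul]
end

/-- left translation -/
noncomputable def Lt (p : Mt n k) : Pn n k →ₐ[k] Pn n k := ev (cm _ p * Xm n k)
/-- right translation -/
noncomputable def Rt (p : Mt n k) : Pn n k →ₐ[k] Pn n k := ev (Xm n k * cm _ p)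

section
variable {R : Type*} [CommRing R] [Algebra k R]
@[simp] lemma ev_Lt (Φ : Mt n R) (p : Mt n k) (f : Pn n k) : ev Φ (Lt p f) = ev (cm _ p * Φ) f := by
  rw [Lt, map_ev]; congr 2; simp [Xm_map]
@[simp] lemma ev_Rt (Φ : Mt n R) (p : Mt n k) (f : Pn n k) : ev Φ (Rt p f) = ev (Φ * cm _ p) f := by
  rw [Rt, map_ev]; congr 2; simp [Xm_map]
end

lemma poly_ext [Infinite k] {f g : Pn n k} (h : ∀ p : Mt n k, ev p f = ev p g) : f = g := by
  apply MvPolynomial.funext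
  intro x
  have := h (Matrix.of fun i j => x (toLex (i, j)))
  simpa [ev, coe_aeval_eq_eval] using this

/-- the left invariant derivation attached to `x` -/
noncomputable def D (x : Mt n k) : Derivation k (Pn n k) (Pn n k) :=
  mkDerivation k fun p => (Xm n k * cm (Pn n k) x) (ofLex p).1 (ofLex p).2

@[simp] lemma D_X (x : Mt n k) (p) : D x (X p) = (Xm n k * cm (Pn n k) x) (ofLex p).1 (ofLex p).2 := by
  simp [D]
@[simp] lemma D_Xm (x : Mt n k) (i j) : D x (Xm n k i j) = (Xm n k * cm (Pn n k) x) i j := by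
  simp [Xm]

lemma chain {R : Type*} [CommRing R] [Algebra k R] (δ : Derivation k R R) (Φ : Mt n R) (x : Mt n k)
    (h : ∀ i j, δ (Φ i j) = (Φ * cm R x) i j) (f : Pn n k) : δ (ev Φ f) = ev Φ (D x f) := by
  induction f using MvPolynomial.induction_on with
  | C a =>
    have h1 : (ev (k := k) Φ) (C a) = algebraMap k R a := (ev Φ).commutes a
    have h2 : (C a : Pn n k) = algebraMap k _ a := rfl
    rw [h1, h2]; simp
  | add p q hp hq => simp [hp, hq]
  | mul_X p q hp =>
    have h1 : (ev Φ) ((Xm n k * cm (Pn n k) x) (ofLex q).1 (ofLex q).2) =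
        (Φ * cm R x) (ofLex q).1 (ofLex q).2 := by
      have := congrFun (congrFun (map_mul' (ev (k := k) Φ) (Xm n k) (cm (Pn n k) x)) (ofLex q).1) (ofLex q).2
      rw [Xm_map, cm_map] at this
      exact this
    simp [hp, h, h1]

lemma der_ext {D1 D2 : Derivation k (Pn n k) (Pn n k)}
    (h : ∀ i j, D1 (Xm n k i j) = D2 (Xm n k i j)) : D1 = D2 := by
  apply MvPolynomial.derivation_ext
  intro p
  simpa [Xm] using h (ofLex p).1 (ofLex p).2

lemma der_mul_cm (δ : Derivation k (Pn n k) (Pn n k)) (A : Mt n (Pn n k)) (y : Mt n k) (i j) :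
    δ ((A * cm (Pn n k) y) i j) = (A.map δ * cm (Pn n k) y) i j := by
  simp [Matrix.mul_apply, cm, mul_comm]
lemma der_cm_mul (δ : Derivation k (Pn n k) (Pn n k)) (A : Mt n (Pn n k)) (y : Mt n k) (i j) :
    δ ((cm (Pn n k) y * A) i j) = (cm (Pn n k) y * A.map δ) i j := by
  simp [Matrix.mul_apply, cm]

@[simp] lemma Xm_map_D (x : Mt n k) : (Xm n k).map (D x) = Xm n k * cm (Pn n k) x := by
  ext i j : 2; simp

lemma D_add (x y : Mt n k) : D (x + y) = D x + D y := by
  apply der_ext; intro i j; simp [mul_add]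
lemma D_smul (c : k) (x : Mt n k) : D (c • x) = c • D x := by
  apply der_ext; intro i j; simp
lemma D_zero : D (0 : Mt n k) = 0 := by
  apply der_ext; intro i j; simp
lemma D_sub (x y : Mt n k) : D (x - y) = D x - D y := by
  apply der_ext; intro i j; simp [mul_sub]
lemma D_neg (x : Mt n k) : D (-x) = -D x := by
  have := D_sub 0 x; simpa [D_zero] using this

lemma D_sum {ι : Type*} (s : Finset ι) (x : ι → Mt n k) (f : Pn n k) :
    D (∑ i ∈ s, x i) f = ∑ i ∈ s, D (x i) f := by
  classical
  induction s using Finset.induction_on with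
  | empty => simp [D_zero]
  | insert a s ha ih => simp [Finset.sum_insert ha, D_add, ih]

lemma D_comm (x y : Mt n k) : ⁅D x, D y⁆ = D (x * y - y * x) := by
  apply der_ext; intro i j
  rw [Derivation.commutator_apply]
  simp only [D_Xm, der_mul_cm, Xm_map_D, cm_sub, cm_mul]
  rw [mul_sub, Matrix.mul_assoc, Matrix.mul_assoc]; rfl

lemma D_comm_apply (x y : Mt n k) (f : Pn n k) :
    D (x * y - y * x) f = D x (D y f) - D y (D x f) := by
  rw [← D_comm, Derivation.commutator_apply]

lemma D_Lt (x p : Mt n k) (f : Pn n k) : D x (Lt p f) = Lt p (D x f) := by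
  apply chain; intro i j; rw [der_cm_mul]; simp [Matrix.mul_assoc]

lemma D_Rt (x p q : Mt n k) (hqp : p * q = 1) (f : Pn n k) :
    D x (Rt p f) = Rt p (D (q * x * p) f) := by
  apply chain; intro i j; rw [der_mul_cm, Xm_map_D]
  have : cm (Pn n k) p * cm (Pn n k) q = 1 := by rw [← cm_mul, hqp, cm_one]
  rw [cm_mul, cm_mul]
  simp only [← Matrix.mul_assoc]
  rw [Matrix.mul_assoc (Xm n k) (cm (Pn n k) p), this, mul_one]

lemma Lt_Rt (p q : Mt n k) (f : Pn n k) : Lt p (Rt q f) = Rt q (Lt p f) := by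
  have : (Lt p).comp (Rt q) = (Rt q).comp (Lt (k := k) p) := by
    apply hom_ext'
    have h1 : (Xm n k).map ((Lt p).comp (Rt q)) = ((Xm n k).map (Rt q)).map (Lt p) := by
      ext; simp
    have h2 : (Xm n k).map ((Rt q).comp (Lt p)) = ((Xm n k).map (Lt p)).map (Rt q) := by
      ext; simp
    rw [h1, h2, Rt, Xm_map, Lt, Xm_map, map_mul', map_mul', Xm_map, Xm_map, cm_map, cm_map,
      Matrix.mul_assoc]
  exact DFunLike.congr_fun this f

lemma Rt_Rt (p q : Mt n k) (f : Pn n k) : Rt p (Rt q f) = Rt (p * q) f := by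
  have : (Rt p).comp (Rt q) = (Rt (k := k) (p * q)) := by
    apply hom_ext'
    have h1 : (Xm n k).map ((Rt p).comp (Rt q)) = ((Xm n k).map (Rt q)).map (Rt p) := by
      ext; simp
    rw [h1]; simp [Rt, Xm_map, Matrix.mul_assoc]
  exact DFunLike.congr_fun this f
lemma Lt_Lt (p q : Mt n k) (f : Pn n k) : Lt p (Lt q f) = Lt (q * p) f := by
  have : (Lt p).comp (Lt q) = (Lt (k := k) (q * p)) := by
    apply hom_ext'
    have h1 : (Xm n k).map ((Lt p).comp (Lt q)) = ((Xm n k).map (Lt q)).map (Lt p) := by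
      ext; simp
    rw [h1]; simp [Lt, Xm_map, Matrix.mul_assoc]
  exact DFunLike.congr_fun this f
@[simp] lemma Rt_one (f : Pn n k) : Rt 1 f = f := by
  simp [Rt, ev_id]
@[simp] lemma Lt_one (f : Pn n k) : Lt 1 f = f := by
  simp [Lt, ev_id]

lemma eval_evalMat (g : GL (Fin n) k) (f : Pn n k) : eval (evalMat g) f = ev (g : Mt n k) f := by
  have := DFunLike.congr_fun (coe_aeval_eq_eval (evalMat g)) f
  exact this.symm
end basics
end EF

namespace EF
section lie
variable {n : ℕ} {k : Type*} [Field k]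

/-- ideal of polynomials vanishing on `K` -/
def IK (K : Subgroup (GL (Fin n) k)) : Ideal (Pn n k) where
  carrier := {f | ∀ g ∈ K, ev (g : Mt n k) f = 0}
  add_mem' := by intro a b ha hb g hg; simp [ha g hg, hb g hg]
  zero_mem' := by intro g _; simp
  smul_mem' := by intro c a ha g hg; simp [ha g hg]

lemma mem_IK {K : Subgroup (GL (Fin n) k)} {f : Pn n k} :
    f ∈ IK K ↔ ∀ g ∈ K, ev (g : Mt n k) f = 0 := Iff.rfl

/-- elements `x` whose derivation preserves an ideal (or a subset) -/
noncomputable def stab (A : Submodule k (Pn n k)) : Submodule k (Mt n k) where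
  carrier := {x | ∀ f ∈ A, D x f ∈ A}
  add_mem' := by intro a b ha hb f hf; rw [D_add]; exact A.add_mem (ha f hf) (hb f hf)
  zero_mem' := by intro f _; simp [D_zero]
  smul_mem' := by intro c a ha f hf; rw [D_smul]; exact A.smul_mem _ (ha f hf)

noncomputable def ann (A : Submodule k (Pn n k)) : Submodule k (Mt n k) where
  carrier := {x | ∀ f ∈ A, D x f = 0}
  add_mem' := by intro a b ha hb f hf; rw [D_add]; simp [ha f hf, hb f hf]
  zero_mem' := by intro f _; simp [D_zero]
  smul_mem' := by intro c a ha f hf; rw [D_smul]; simp [ha f hf]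

lemma mem_stab {A : Submodule k (Pn n k)} {x : Mt n k} : x ∈ stab A ↔ ∀ f ∈ A, D x f ∈ A := Iff.rfl
lemma mem_ann {A : Submodule k (Pn n k)} {x : Mt n k} : x ∈ ann A ↔ ∀ f ∈ A, D x f = 0 := Iff.rfl

/-- the Lie algebra -/
noncomputable def Lie (K : Subgroup (GL (Fin n) k)) : Submodule k (Mt n k) :=
  stab ((IK K).restrictScalars k)

lemma mem_Lie {K : Subgroup (GL (Fin n) k)} {x : Mt n k} :
    x ∈ Lie K ↔ ∀ f ∈ IK K, D x f ∈ IK K := Iff.rfl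

lemma Lt_IK {K : Subgroup (GL (Fin n) k)} {h : GL (Fin n) k} (hh : h ∈ K) {f : Pn n k}
    (hf : f ∈ IK K) : Lt (h : Mt n k) f ∈ IK K := by
  intro g hg
  have := hf (h * g) (K.mul_mem hh hg)
  simpa using this
lemma Rt_IK {K : Subgroup (GL (Fin n) k)} {h : GL (Fin n) k} (hh : h ∈ K) {f : Pn n k}
    (hf : f ∈ IK K) : Rt (h : Mt n k) f ∈ IK K := by
  intro g hg
  have := hf (g * h) (K.mul_mem hg hh)
  simpa using this

lemma mem_Lie_iff {K : Subgroup (GL (Fin n) k)} {x : Mt n k} :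
    x ∈ Lie K ↔ ∀ f ∈ IK K, ev (1 : Mt n k) (D x f) = 0 := by
  constructor
  · intro h f hf
    simpa using h f hf 1 K.one_mem
  · intro h f hf g hg
    have := h _ (Lt_IK hg hf)
    rw [D_Lt] at this
    simpa using this

/-- maximal ideal at `1` -/
noncomputable def m1 (n : ℕ) (k : Type*) [Field k] : Ideal (Pn n k) :=
  RingHom.ker (ev (1 : Mt n k))

lemma mem_m1 {f : Pn n k} : f ∈ m1 n k ↔ ev (1 : Mt n k) f = 0 := Iff.rfl

/-- differential at `1` -/
noncomputable def d1 : Pn n k →ₗ[k] Module.Dual k (Mt n k) :=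
  LinearMap.mk₂ k (fun f x => ev (1 : Mt n k) (D x f))
    (by intros; simp) (by intros; simp) (by intros; simp [D_add]) (by intros; simp [D_smul])

@[simp] lemma d1_apply (f : Pn n k) (x : Mt n k) : d1 f x = ev (1 : Mt n k) (D x f) := rfl

lemma d1_mul_m1 {f g : Pn n k} (hf : f ∈ m1 n k) :
    d1 (f * g) = ev (1 : Mt n k) g • d1 f := by
  rw [mem_m1] at hf
  ext x; simp [hf]

/-- linear coordinate function with prescribed differential -/
noncomputable def lin : Module.Dual k (Mt n k) →ₗ[k] Pn n k where
  toFun φ := ∑ i, ∑ j, φ (Matrix.single i j 1) • (Xm n k i j - C ((1 : Mt n k) i j))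
  map_add' := by intro a b; simp [add_smul, Finset.sum_add_distrib]
  map_smul' := by intro a b; simp [mul_smul, Finset.smul_sum]

lemma lin_m1 (φ : Module.Dual k (Mt n k)) : lin φ ∈ m1 n k := by
  rw [mem_m1, lin]
  simp only [LinearMap.coe_mk, AddHom.coe_mk, map_sum, map_smul, map_sub, ev_Xm]
  apply Finset.sum_eq_zero; intro i _; apply Finset.sum_eq_zero; intro j _
  have : ev (1 : Mt n k) (C ((1 : Mt n k) i j)) = (1 : Mt n k) i j := (ev (k := k) (1 : Mt n k)).commutes _
  rw [this]; simp

lemma d1_lin (φ : Module.Dual k (Mt n k)) : d1 (lin φ) = φ := by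
  ext x
  have hx : x = ∑ i, ∑ j, x i j • Matrix.single i j (1 : k) := by
    conv_lhs => rw [Matrix.matrix_eq_sum_single x]
    simp [Matrix.smul_single]
  have h1 : ∀ i j, ev (1 : Mt n k) ((Xm n k * cm (Pn n k) x) i j) = x i j := by
    intro i j
    have := congrFun (congrFun (map_mul' (ev (k := k) (1 : Mt n k)) (Xm n k) (cm _ x)) i) j
    rw [Xm_map, cm_map] at this
    simpa using this
  have h2 : φ x = ∑ i, ∑ j, φ (Matrix.single i j 1) * x i j := by
    conv_lhs => rw [hx]
    simp only [map_sum, map_smul, smul_eq_mul, mul_comm]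
  have h3 : ∀ c : k, D x (C c) = 0 := fun c => (D x).map_algebraMap c
  rw [h2, d1_apply, lin]
  simp [map_sum, h1, h3]

lemma m1_taylor {f : Pn n k} (hf : f ∈ m1 n k) : f - lin (d1 f) ∈ m1 n k ^ 2 := by
  -- prove for all f: f - f(1) - lin (d1 f) ∈ m1^2
  have key : ∀ f : Pn n k, f - C (ev (1 : Mt n k) f) - lin (d1 f) ∈ m1 n k ^ 2 := by
    intro f
    induction f using MvPolynomial.induction_on with
    | C a =>
      have h1 : ev (1 : Mt n k) (C a) = a := (ev (k := k) (1 : Mt n k)).commutes a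
      have h2 : d1 (C a : Pn n k) = 0 := by
        ext x
        have h3 : D x (C a) = 0 := (D x).map_algebraMap a
        simp [h3]
      simp [h1, h2]
    | add p q hp hq =>
      have := Ideal.add_mem _ hp hq
      convert this using 1
      simp only [map_add]; ring
    | mul_X p q hp =>
      have hd : d1 (p * X q) = ev (1 : Mt n k) p • d1 (X q : Pn n k) + ev (1 : Mt n k) (X q : Pn n k) • d1 p := by
        ext x; simp
      have hX : lin (d1 (X q : Pn n k)) = X q - C (ev (1 : Mt n k) (X q : Pn n k)) := by
        rw [lin]
        have : ∀ i j, d1 (X q : Pn n k) (Matrix.single i j 1) = if q = toLex (i, j) then 1 else 0 := by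
          intro i j
          have h1 := congrFun (congrFun (map_mul' (ev (k := k) (1 : Mt n k)) (Xm n k) (cm _ (Matrix.single i j (1 : k)))) (ofLex q).1) (ofLex q).2
          rw [Xm_map, cm_map] at h1
          rw [d1_apply, D_X]
          refine Eq.trans h1 ?_
          rw [one_mul, cm_self, Matrix.single_apply]
          congr 1
          apply propext
          constructor
          · rintro ⟨h, h'⟩; rw [h, h']; rfl
          · rintro h; rw [h]; simp
        simp only [LinearMap.coe_mk, AddHom.coe_mk, this]
        rw [Finset.sum_eq_single (ofLex q).1, Finset.sum_eq_single (ofLex q).2]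
        · simp [Xm]
        · intro b _ hb
          rw [if_neg, zero_smul]
          rintro h; apply hb; rw [h]; rfl
        · simp
        · intro b _ hb
          apply Finset.sum_eq_zero; intro j _
          rw [if_neg, zero_smul]
          rintro h; apply hb; rw [h]; rfl
        · simp
      have e1 : p * X q - C (ev (1 : Mt n k) (p * X q)) - lin (d1 (p * X q)) =
          (p - C (ev (1 : Mt n k) p)) * (X q - C (ev (1 : Mt n k) (X q : Pn n k))) +
          C (ev (1 : Mt n k) (X q : Pn n k)) * (p - C (ev (1 : Mt n k) p) - lin (d1 p)) := by
        rw [hd, map_add, map_smul, map_smul, hX, map_mul, smul_eq_C_mul, smul_eq_C_mul, map_mul]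
        ring
      rw [e1]
      have hm : ∀ g : Pn n k, g - C (ev (1 : Mt n k) g) ∈ m1 n k := by
        intro g
        have h1 : ∀ a, ev (1 : Mt n k) (C a) = a := (ev (k := k) (1 : Mt n k)).commutes
        rw [mem_m1, map_sub, h1]; simp
      apply Ideal.add_mem
      · rw [pow_two]; exact Ideal.mul_mem_mul (hm p) (hm _)
      · exact Ideal.mul_mem_left _ _ hp
  have := key f
  rw [mem_m1.mp hf] at this
  simpa using this

lemma star [CharZero k] (K : Subgroup (GL (Fin n) k)) (𝔞 : Ideal (Pn n k)) (h1 : 𝔞 ≤ m1 n k)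
    (hD : ∀ x ∈ Lie K, ∀ f ∈ 𝔞, D x f ∈ 𝔞) :
    ∀ f ∈ 𝔞, ∃ q : Pn n k, ev (1 : Mt n k) q ≠ 0 ∧ q * f ∈ IK K := by
  classical
  set I := IK K with hI
  set 𝔪 := m1 n k with h𝔪
  have supmul : ∀ (a b c : Ideal (Pn n k)) x, x ∈ a ⊔ b * c → x ∈ a ⊔ c := by
    intro a b c x hx
    have h : a ⊔ b * c ≤ a ⊔ c := sup_le_sup_left (Ideal.mul_le_right : b * c ≤ c) a
    exact h hx
  -- basis of the Lie algebra
  let bs := Module.finBasis k (Lie K)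
  have hIm : I ≤ 𝔪 := by
    intro f hf; rw [h𝔪, mem_m1]; simpa using hf 1 K.one_mem
  -- dual functionals extended
  have hext : ∀ i, ∃ φ : Module.Dual k (Mt n k), ∀ y : Lie K, φ y = bs.coord i y := by
    intro i
    obtain ⟨φ, hφ⟩ := LinearMap.exists_extend (bs.coord i)
    exact ⟨φ, fun y => DFunLike.congr_fun hφ y⟩
  choose φ hφ using hext
  let E : Derivation k (Pn n k) (Pn n k) := ∑ i, lin (φ i) • D (bs i : Mt n k)
  have hE : ∀ f, E f = ∑ i, lin (φ i) * D (bs i : Mt n k) f := by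
    intro f
    have : ∀ s : Finset (Fin (Module.finrank k (Lie K))),
        (∑ i ∈ s, lin (φ i) • D (bs i : Mt n k)) f = ∑ i ∈ s, lin (φ i) * D (bs i : Mt n k) f := by
      intro s
      induction s using Finset.induction_on with
      | empty => simp
      | insert a s ha ih => simp [Finset.sum_insert ha, ih]
    exact this _
  -- d1 of I is the annihilator
  have hann : ∀ g ∈ 𝔪, (∀ x ∈ Lie K, d1 g x = 0) → g ∈ 𝔪 ^ 2 ⊔ I := by
    intro g hg hgx
    let W : Submodule k (Module.Dual k (Mt n k)) := (I.restrictScalars k).map d1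
    have hW : W.dualCoannihilator = Lie K := by
      ext x
      rw [Submodule.mem_dualCoannihilator, mem_Lie_iff]
      constructor
      · intro h f hf; exact h _ ⟨f, hf, rfl⟩
      · rintro h _ ⟨f, hf, rfl⟩; exact h f hf
    have hg2 : d1 g ∈ W := by
      rw [← Subspace.dualCoannihilator_dualAnnihilator_eq (W := W), hW,
        Submodule.mem_dualAnnihilator]
      exact hgx
    obtain ⟨f, hf, hfg⟩ := hg2
    have hd : d1 (g - f) = 0 := by rw [map_sub, hfg, sub_self]
    have := m1_taylor (Ideal.sub_mem _ hg (hIm hf))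
    rw [hd, map_zero, sub_zero] at this
    have h2 : g = (g - f) + f := by ring
    rw [h2]
    exact Ideal.add_mem _ (Ideal.mem_sup_left this) (Ideal.mem_sup_right hf)
  have hE1 : ∀ m ∈ 𝔪, E m - m ∈ 𝔪 ^ 2 ⊔ I := by
    intro m hm
    apply hann
    · apply Ideal.sub_mem _ _ hm
      rw [hE]
      apply Ideal.sum_mem
      intro i _; exact Ideal.mul_mem_right _ _ (lin_m1 _)
    · intro x hx
      rw [map_sub, hE, map_sum]
      simp_rw [d1_mul_m1 (lin_m1 _), d1_lin]
      have e : x = ∑ i, φ i x • (bs i : Mt n k) := by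
        have := congrArg Subtype.val (bs.sum_repr ⟨x, hx⟩)
        rw [AddSubmonoidClass.coe_finsetSum] at this
        refine this.symm.trans ?_
        apply Finset.sum_congr rfl
        intro i _
        have h2 := hφ i ⟨x, hx⟩
        simp only [Module.Basis.coord_apply] at h2
        rw [Submodule.coe_smul, h2]
      have : d1 m x = ∑ i, φ i x • d1 m (bs i) := by
        conv_lhs => rw [e]
        simp only [map_sum, map_smul]
      rw [LinearMap.sub_apply, this]
      simp [mul_comm]
  have hEI : ∀ f ∈ I, E f ∈ I := by
    intro f hf; rw [hE]; apply Ideal.sum_mem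
    intro i _; exact Ideal.mul_mem_left _ _ ((bs i).2 f hf)
  have hEj : ∀ j : ℕ, ∀ g ∈ 𝔪 ^ j, E g - (j : Pn n k) * g ∈ 𝔪 ^ (j + 1) ⊔ I := by
    intro j
    induction j with
    | zero =>
      intro g _
      simp only [Nat.cast_zero, zero_mul, sub_zero, zero_add, pow_one]
      apply Ideal.mem_sup_left
      rw [hE]
      apply Ideal.sum_mem
      intro i _; exact Ideal.mul_mem_right _ _ (lin_m1 _)
    | succ j ih =>
      intro g hg
      rw [pow_succ] at hg
      induction hg using Submodule.mul_induction_on' with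
      | mem_mul_mem h hh m hm =>
        have e : E (h * m) - ((j + 1 : ℕ) : Pn n k) * (h * m) =
            h * (E m - m) + m * (E h - (j : Pn n k) * h) := by
          rw [Derivation.leibniz]; simp; ring
        rw [e]
        apply Ideal.add_mem
        · have : h * (E m - m) ∈ 𝔪 ^ j * (𝔪 ^ 2 ⊔ I) := Ideal.mul_mem_mul hh (hE1 m hm)
          rw [Ideal.mul_sup, ← pow_add] at this
          exact supmul _ _ _ _ this
        · have : m * (E h - (j : Pn n k) * h) ∈ 𝔪 * (𝔪 ^ (j + 1) ⊔ I) :=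
            Ideal.mul_mem_mul hm (ih h hh)
          rw [Ideal.mul_sup, ← pow_succ'] at this
          exact supmul _ _ _ _ this
      | add x hx y hy h1 h2 =>
        have := Ideal.add_mem _ h1 h2
        convert this using 1
        rw [map_add]; ring
  have hind : ∀ j : ℕ, ∀ f ∈ 𝔞, f ∈ 𝔪 ^ (j + 1) ⊔ I := by
    intro j
    induction j with
    | zero => intro f hf; simpa using Ideal.mem_sup_left (h1 hf)
    | succ j ih =>
      intro f hf
      have hEf : E f ∈ 𝔪 ^ (j + 1 + 1) ⊔ I := by
        rw [hE]
        apply Ideal.sum_mem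
        intro i _
        have : lin (φ i) * D (bs i : Mt n k) f ∈ 𝔪 * (𝔪 ^ (j + 1) ⊔ I) :=
          Ideal.mul_mem_mul (lin_m1 _) (ih _ (hD _ (bs i).2 f hf))
        rw [Ideal.mul_sup, ← pow_succ'] at this
        exact supmul _ _ _ _ this
      obtain ⟨g, hg, i, hi, rfl⟩ := Submodule.mem_sup.mp (ih f hf)
      have h2 := hEj (j + 1) g hg
      rw [map_add] at hEf
      have h3 : E g ∈ 𝔪 ^ (j + 1 + 1) ⊔ I := by
        have := Ideal.sub_mem _ hEf (Ideal.mem_sup_right (hEI i hi) : E i ∈ 𝔪 ^ (j + 1 + 1) ⊔ I)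
        simpa using this
      have h4 : ((j + 1 : ℕ) : Pn n k) * g ∈ 𝔪 ^ (j + 1 + 1) ⊔ I := by
        have := Ideal.sub_mem _ h3 h2
        simpa using this
      have h5 : g ∈ 𝔪 ^ (j + 1 + 1) ⊔ I := by
        have := Ideal.mul_mem_left _ (C (((j + 1 : ℕ) : k)⁻¹)) h4
        have e : (C (((j + 1 : ℕ) : k)⁻¹) : Pn n k) * (((j + 1 : ℕ) : Pn n k) * g) = g := by
          have hh : ((j + 1 : ℕ) : Pn n k) = C ((j + 1 : ℕ) : k) := by simp
          rw [hh, ← mul_assoc, ← C_mul, inv_mul_cancel₀ (by exact_mod_cast Nat.succ_ne_zero j)]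
          simp
        rwa [e] at this
      exact Ideal.add_mem _ h5 (Ideal.mem_sup_right hi)
  intro f hf
  -- Krull
  let π := Ideal.Quotient.mk I
  have hkr : π f ∈ (⨅ i : ℕ, (𝔪.map π) ^ i • ⊤ : Submodule (Pn n k ⧸ I) (Pn n k ⧸ I)) := by
    rw [Submodule.mem_iInf]
    intro i
    have h2 : f ∈ 𝔪 ^ i ⊔ I := by
      refine (sup_le_sup_right (Ideal.pow_le_pow_right (Nat.le_succ i)) I) (hind i f hf)
    have : π f ∈ (𝔪 ^ i ⊔ I).map π := Ideal.mem_map_of_mem _ h2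
    rw [Ideal.map_sup, Ideal.map_pow] at this
    have h0 : I.map π = ⊥ := Ideal.map_quotient_self I
    rw [h0, sup_bot_eq] at this
    simpa using this
  rw [Ideal.mem_iInf_smul_pow_eq_bot_iff] at hkr
  obtain ⟨⟨r, hr⟩, hrf⟩ := hkr
  obtain ⟨m, hm, rfl⟩ := (Ideal.mem_map_iff_of_surjective π Ideal.Quotient.mk_surjective).mp hr
  refine ⟨1 - m, ?_, ?_⟩
  · rw [map_sub, map_one, mem_m1.mp hm]; simp
  · rw [← Ideal.Quotient.eq_zero_iff_mem, map_mul, map_sub, map_one, sub_mul, one_mul]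
    simp only [smul_eq_mul] at hrf
    exact sub_eq_zero.mpr hrf.symm

lemma finite_cosets (K : Subgroup (GL (Fin n) k)) (𝔭 : Ideal (Pn n k))
    (h : ∀ f ∈ 𝔭, ∃ q : Pn n k, ev (1 : Mt n k) q ≠ 0 ∧ q * f ∈ IK K) :
    ∃ C : Finset (GL (Fin n) k), (∀ c ∈ C, c ∈ K) ∧ ∀ g ∈ K, ∃ c ∈ C, ∀ f ∈ 𝔭,
      ev ((c⁻¹ * g : GL (Fin n) k) : Mt n k) f = 0 := by
  classical
  have hfin : (IK K).minimalPrimes.Finite := Ideal.finite_minimalPrimes_of_isNoetherianRing _ _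
  let Q : Ideal (Pn n k) → GL (Fin n) k := fun p =>
    if hp : ∃ c ∈ K, p ≤ RingHom.ker (ev (c : Mt n k) : Pn n k →ₐ[k] k) then hp.choose else 1
  refine ⟨hfin.toFinset.image Q, ?_, ?_⟩
  · intro c hc
    obtain ⟨p, _, rfl⟩ := Finset.mem_image.mp hc
    simp only [Q]
    split_ifs with hp
    · exact hp.choose_spec.1
    · exact K.one_mem
  · intro g hg
    have hle : IK K ≤ RingHom.ker (ev (g : Mt n k) : Pn n k →ₐ[k] k) := fun f hf => hf g hg
    have hpr : (RingHom.ker (ev (g : Mt n k) : Pn n k →ₐ[k] k)).IsPrime := RingHom.ker_isPrime _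
    obtain ⟨p, hp, hpg⟩ := Ideal.exists_minimalPrimes_le hle
    refine ⟨Q p, Finset.mem_image_of_mem _ (hfin.mem_toFinset.mpr hp), ?_⟩
    have hex : ∃ c ∈ K, p ≤ RingHom.ker (ev (c : Mt n k) : Pn n k →ₐ[k] k) := ⟨g, hg, hpg⟩
    have hQ : Q p = hex.choose := by simp only [Q]; rw [dif_pos hex]
    have hc1 : Q p ∈ K := by rw [hQ]; exact hex.choose_spec.1
    have hc2 : p ≤ RingHom.ker (ev (Q p : Mt n k) : Pn n k →ₐ[k] k) := by
      rw [hQ]; exact hex.choose_spec.2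
    intro f hf
    obtain ⟨q, hq, hqf⟩ := h f hf
    have h1 := hp.1.2 (Lt_IK (K.inv_mem hc1) hqf)
    rw [map_mul] at h1
    have hpp : p.IsPrime := hp.1.1
    rcases hpp.mem_or_mem h1 with h2 | h2
    · exfalso
      have := hc2 h2
      rw [RingHom.mem_ker] at this
      apply hq
      have e : ev (1 : Mt n k) q = ev ((Q p : GL (Fin n) k) : Mt n k) (Lt ((Q p)⁻¹ : GL (Fin n) k) q) := by
        rw [ev_Lt, cm_self, ← Units.val_mul]; simp
      rw [e]; exact this
    · have := hpg h2
      rw [RingHom.mem_ker] at this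
      rw [Units.val_mul]
      have e := ev_Lt (g : Mt n k) (((Q p)⁻¹ : GL (Fin n) k) : Mt n k) f
      rw [cm_self] at e
      rw [← e]; exact this
end lie
end EF

namespace EF
section linlem
variable {k : Type*} [Field k] {V : Type*} [AddCommGroup V] [Module k V]

lemma crt (T : Finset k) (m : ℕ) (β : k → k) :
    ∃ Q : Polynomial k, ∀ μ ∈ T, (Polynomial.X - Polynomial.C μ) ^ m ∣ Q - Polynomial.C (β μ) := by
  have hp : Pairwise (Function.onFun IsCoprime fun μ : T =>
      Ideal.span {(Polynomial.X - Polynomial.C (μ : k)) ^ m}) := by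
    intro a b hab
    have h := Polynomial.pairwise_coprime_X_sub_C (K := k) (s := fun μ : T => (μ : k))
      Subtype.val_injective hab
    have h2 : IsCoprime ((Polynomial.X - Polynomial.C (a : k)) ^ m)
      ((Polynomial.X - Polynomial.C (b : k)) ^ m) := IsCoprime.pow h
    exact (Ideal.isCoprime_span_singleton_iff _ _).mpr h2
  obtain ⟨Q, hQ⟩ := Ideal.exists_forall_sub_mem_ideal hp (fun μ => Polynomial.C (β μ))
  exact ⟨Q, fun μ hμ => Ideal.mem_span_singleton.mp (hQ ⟨μ, hμ⟩)⟩

lemma lin_lemma (a s' : Module.End k V) (β : k → k)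
    (hspan : ∀ v : V, v ∈ Submodule.span k {v | ∃ (μ : k) (m : ℕ),
      ((a - algebraMap k _ μ) ^ m) v = 0 ∧ s' v = β μ • v})
    (E F : Submodule k V) (hEF : E ≤ F) (ha : ∀ v ∈ F, a v ∈ E) (hβ : β 0 = 0) :
    ∀ v ∈ F, s' v ∈ E := by
  classical
  intro v hv
  have key : ∀ v : V, ∃ (T : Finset k) (m : ℕ), ∀ Q : Polynomial k,
      (∀ μ ∈ T, (Polynomial.X - Polynomial.C μ) ^ m ∣ Q - Polynomial.C (β μ)) →
      Polynomial.aeval a Q v = s' v := by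
    intro v
    induction hspan v using Submodule.span_induction with
    | mem v hv =>
      obtain ⟨μ, m, h1, h2⟩ := hv
      refine ⟨{μ}, m, fun Q hQ => ?_⟩
      obtain ⟨R, hR⟩ := hQ μ (by simp)
      have : Q = R * (Polynomial.X - Polynomial.C μ) ^ m + Polynomial.C (β μ) := by
        rw [mul_comm R, ← hR]; ring
      rw [this]
      simp only [map_add, map_mul, map_pow, map_sub, Polynomial.aeval_X, Polynomial.aeval_C,
        LinearMap.add_apply, Module.End.mul_apply]
      rw [h1, h2]; simp
    | zero => exact ⟨∅, 0, fun Q _ => by simp⟩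
    | add x y _ _ hx hy =>
      obtain ⟨T1, m1, h1⟩ := hx
      obtain ⟨T2, m2, h2⟩ := hy
      refine ⟨T1 ∪ T2, max m1 m2, fun Q hQ => ?_⟩
      rw [map_add, map_add, h1 Q, h2 Q]
      · intro μ hμ
        exact (pow_dvd_pow _ (le_max_right _ _)).trans (hQ μ (Finset.mem_union_right _ hμ))
      · intro μ hμ
        exact (pow_dvd_pow _ (le_max_left _ _)).trans (hQ μ (Finset.mem_union_left _ hμ))
    | smul c x _ hx =>
      obtain ⟨T1, m1, h1⟩ := hx
      exact ⟨T1, m1, fun Q hQ => by rw [map_smul, map_smul, h1 Q hQ]⟩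
  obtain ⟨T, m, h⟩ := key v
  obtain ⟨Q, hQ⟩ := crt (insert 0 T) (m + 1) β
  have h1 := h Q (fun μ hμ => (pow_dvd_pow _ (Nat.le_succ _)).trans (hQ μ (Finset.mem_insert_of_mem hμ)))
  have h2 := hQ 0 (Finset.mem_insert_self _ _)
  rw [hβ, Polynomial.C_0, sub_zero, sub_zero] at h2
  obtain ⟨R, hR⟩ := (dvd_pow_self _ (Nat.succ_ne_zero m)).trans h2
  rw [← h1, hR]
  simp only [map_mul, Polynomial.aeval_X, Module.End.mul_apply]
  apply ha
  have hst : ∀ w ∈ F, a w ∈ F := fun w hw => hEF (ha w hw)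
  clear * - hst hv
  induction R using Polynomial.induction_on' with
  | add p q hp hq => simp only [map_add, LinearMap.add_apply]; exact F.add_mem hp hq
  | monomial j c =>
    simp only [Polynomial.aeval_monomial, Module.End.mul_apply, Module.algebraMap_end_apply]
    apply F.smul_mem
    induction j with
    | zero => simpa
    | succ j ih => rw [pow_succ', Module.End.mul_apply]; exact hst _ ih

/-- abstract Jordan decomposition statement -/
lemma jordan_lemma (a s : Module.End k V)
    (hs : ∀ v : V, v ∈ Submodule.span k {v | ∃ μ : k, s v = μ • v})
    (hn : ∀ v : V, ∃ m : ℕ, ((a - s) ^ m) v = 0) (hc : Commute a s)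
    (E F : Submodule k V) (hEF : E ≤ F) (ha : ∀ v ∈ F, a v ∈ E) :
    ∀ v ∈ F, s v ∈ E := by
  refine lin_lemma a s id ?_ E F hEF ha rfl
  intro v
  refine Submodule.span_mono ?_ (hs v)
  rintro v ⟨μ, hμ⟩
  obtain ⟨m, hm⟩ := hn v
  refine ⟨μ, m, ?_, hμ⟩
  have key : ∀ j : ℕ, ((a - algebraMap k _ μ) ^ j) v = ((a - s) ^ j) v ∧
      s (((a - s) ^ j) v) = μ • (((a - s) ^ j) v) := by
    intro j
    induction j with
    | zero => exact ⟨rfl, hμ⟩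
    | succ j ih =>
      constructor
      · rw [pow_succ', pow_succ', Module.End.mul_apply, Module.End.mul_apply, ih.1,
          LinearMap.sub_apply, LinearMap.sub_apply, ih.2]; rfl
      · have hc2 : Commute s (a - s) := (hc.sub_left (Commute.refl s)).symm
        rw [pow_succ', Module.End.mul_apply, ← Module.End.mul_apply s, hc2.eq, Module.End.mul_apply,
          ih.2, map_smul]
  rw [(key m).1, hm]
end linlem

section diag
variable {n : ℕ} {k : Type*} [Field k]

def Dg (s : Mt n k) : Prop := ∃ (Q : GL (Fin n) k) (d : Fin n → k),
  s = (Q : Mt n k) * diagonal d * ((Q⁻¹ : GL (Fin n) k) : Mt n k)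

lemma Dg.conj {s : Mt n k} (hs : Dg s) (h : GL (Fin n) k) :
    Dg ((h : Mt n k) * s * ((h⁻¹ : GL (Fin n) k) : Mt n k)) := by
  obtain ⟨Q, d, rfl⟩ := hs
  refine ⟨h * Q, d, ?_⟩
  rw [_root_.mul_inv_rev, Units.val_mul, Units.val_mul]
  simp only [Matrix.mul_assoc]

lemma simdiag_of_span {s t : Mt n k}
    (h : ⊤ ≤ Submodule.span k {v : Fin n → k | ∃ μ ν : k, s *ᵥ v = μ • v ∧ t *ᵥ v = ν • v}) :
    ∃ (Q : GL (Fin n) k) (a b : Fin n → k),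
      s = (Q : Mt n k) * diagonal a * ((Q⁻¹ : GL (Fin n) k) : Mt n k) ∧
      t = (Q : Mt n k) * diagonal b * ((Q⁻¹ : GL (Fin n) k) : Mt n k) := by
  classical
  let b0 := Module.Basis.ofSpan h
  let b := b0.reindex (b0.indexEquiv (Pi.basisFun k (Fin n)))
  have hb : ∀ i, ∃ μ ν : k, s *ᵥ (b i) = μ • (b i) ∧ t *ᵥ (b i) = ν • (b i) := by
    intro i
    have : b i ∈ Set.range b0 := ⟨_, (Module.Basis.reindex_apply _ _ _).symm⟩
    exact Module.Basis.ofSpan_subset h this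
  choose μ ν hμ hν using hb
  let B : Mt n k := (Pi.basisFun k (Fin n)).toMatrix b
  have h1 : B * b.toMatrix (Pi.basisFun k (Fin n)) = 1 := Module.Basis.toMatrix_mul_toMatrix_flip _ _
  have h2 : b.toMatrix (Pi.basisFun k (Fin n)) * B = 1 := Module.Basis.toMatrix_mul_toMatrix_flip _ _
  let Q : GL (Fin n) k := ⟨B, _, h1, h2⟩
  have hB : ∀ i j, B i j = b j i := by intro i j; simp [B, Module.Basis.toMatrix_apply]
  have gen : ∀ (s : Mt n k) (μ : Fin n → k), (∀ i, s *ᵥ (b i) = μ i • (b i)) →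
      s = (Q : Mt n k) * diagonal μ * ((Q⁻¹ : GL (Fin n) k) : Mt n k) := by
    intro s μ hs
    have e : s * B = B * diagonal μ := by
      ext i j
      rw [Matrix.mul_diagonal, hB]
      have := congrFun (hs j) i
      rw [Pi.smul_apply, smul_eq_mul, mul_comm] at this
      rw [← this, Matrix.mul_apply, Matrix.mulVec, dotProduct]
      simp [hB]
    change s = B * diagonal μ * b.toMatrix (Pi.basisFun k (Fin n))
    rw [← e, Matrix.mul_assoc, h1, mul_one]
  exact ⟨Q, μ, ν, gen s μ hμ, gen t ν hν⟩

lemma Dg.maxGen {s : Mt n k} (hs : Dg s) (μ : k) (v : Fin n → k)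
    (hv : v ∈ Module.End.maxGenEigenspace (Matrix.toLin' s) μ) : s *ᵥ v = μ • v := by
  obtain ⟨Q, d, rfl⟩ := hs
  obtain ⟨m, hm⟩ := Module.End.mem_maxGenEigenspace _ _ _ |>.mp hv
  set P' : Mt n k := ((Q⁻¹ : GL (Fin n) k) : Mt n k) with hP
  have hPQ : P' * (Q : Mt n k) = 1 := by rw [hP, ← Units.val_mul]; simp
  have hQP : (Q : Mt n k) * P' = 1 := by rw [hP, ← Units.val_mul]; simp
  have key : ∀ w : Fin n → k, P' *ᵥ ((Matrix.toLin' ((Q : Mt n k) * diagonal d * P') - μ • 1) w) =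
      fun i => (d i - μ) * (P' *ᵥ w) i := by
    intro w
    have e1 : (Matrix.toLin' ((Q : Mt n k) * diagonal d * P') - μ • 1) w =
        ((Q : Mt n k) * diagonal d * P') *ᵥ w - μ • w := by simp [Matrix.mul_assoc]
    rw [e1, Matrix.mulVec_sub, Matrix.mulVec_mulVec, ← Matrix.mul_assoc, ← Matrix.mul_assoc, hPQ,
      one_mul, ← Matrix.mulVec_mulVec, Matrix.mulVec_smul]
    ext i
    rw [Pi.sub_apply, Matrix.mulVec_diagonal]
    simp; ring
  have key2 : ∀ (j : ℕ) (w : Fin n → k),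
      P' *ᵥ (((Matrix.toLin' ((Q : Mt n k) * diagonal d * P') - μ • 1) ^ j) w) =
      fun i => (d i - μ) ^ j * (P' *ᵥ w) i := by
    intro j
    induction j with
    | zero => intro w; simp
    | succ j ih =>
      intro w
      rw [pow_succ', Module.End.mul_apply, key, ih]
      ext i; ring
  have h3 := key2 m v
  rw [hm, Matrix.mulVec_zero] at h3
  have h4 : ∀ i, (d i - μ) * (P' *ᵥ v) i = 0 := by
    intro i
    have := congrFun h3 i
    simp only [Pi.zero_apply] at this
    rcases mul_eq_zero.mp this.symm with h | h
    · rw [eq_zero_of_pow_eq_zero h, zero_mul]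
    · rw [h, mul_zero]
  have h5 : P' *ᵥ ((Matrix.toLin' ((Q : Mt n k) * diagonal d * P') - μ • 1) v) = 0 := by
    rw [key]; ext i; exact h4 i
  have h6 : (Matrix.toLin' ((Q : Mt n k) * diagonal d * P') - μ • 1) v = 0 := by
    have := congrArg (fun w => (Q : Mt n k) *ᵥ w) h5
    simpa only [Matrix.mulVec_mulVec, hQP, Matrix.one_mulVec, Matrix.mulVec_zero] using this
  simpa [sub_eq_zero, Matrix.mul_assoc] using h6

variable [IsAlgClosed k]

lemma simdiag {s t : Mt n k} (hs : Dg s) (ht : Dg t) (hc : Commute s t) :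
    ∃ (Q : GL (Fin n) k) (a b : Fin n → k),
      s = (Q : Mt n k) * diagonal a * ((Q⁻¹ : GL (Fin n) k) : Mt n k) ∧
      t = (Q : Mt n k) * diagonal b * ((Q⁻¹ : GL (Fin n) k) : Mt n k) := by
  apply simdiag_of_span
  let f : Bool → Module.End k (Fin n → k) := fun b => Matrix.toLin' (if b then s else t)
  have hcf : ∀ i j, Commute (f i) (f j) := by
    have : ∀ x y : Mt n k, Commute x y → Commute (Matrix.toLin' x) (Matrix.toLin' y) := by
      intro x y h
      rw [commute_iff_eq, Module.End.mul_eq_comp, Module.End.mul_eq_comp, ← Matrix.toLin'_mul,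
        ← Matrix.toLin'_mul, h.eq]
    rintro (_ | _) (_ | _) <;> apply this <;> simp [hc, hc.symm]
  have h := Module.End.iSup_iInf_maxGenEigenspace_eq_top_of_iSup_maxGenEigenspace_eq_top_of_commute f
    (fun i j _ => hcf i j) (fun i => Module.End.iSup_maxGenEigenspace_eq_top _)
  rw [← h]
  apply iSup_le
  intro χ v hv
  rw [Submodule.mem_iInf] at hv
  exact Submodule.subset_span ⟨χ true, χ false, hs.maxGen _ _ (hv true), ht.maxGen _ _ (hv false)⟩

lemma jordan [CharZero k] (x : Mt n k) : ∃ s N : Mt n k, x = s + N ∧ Dg s ∧ IsNilpotent N ∧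
    ∀ y, Commute y x → Commute y s := by
  obtain ⟨N, hN, s, hs, hN0, hs0, e⟩ := Module.End.exists_isNilpotent_isSemisimple (f := Matrix.toLin' x)
  refine ⟨LinearMap.toMatrix' s, LinearMap.toMatrix' N, ?_, ?_, ?_, ?_⟩
  · rw [← map_add, add_comm, ← e]; simp
  · have h2 := hs0.iSup_eigenspace_eq_top
    obtain ⟨Q, a, b, h, _⟩ := simdiag_of_span (s := LinearMap.toMatrix' s) (t := LinearMap.toMatrix' s) (by
      rw [← h2]
      apply iSup_le
      intro μ v hv
      have : (LinearMap.toMatrix' s) *ᵥ v = μ • v := by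
        have := Module.End.mem_eigenspace_iff.mp hv
        rw [← this, LinearMap.toMatrix'_mulVec]
      exact Submodule.subset_span ⟨μ, μ, this, this⟩)
    exact ⟨Q, a, h⟩
  · obtain ⟨m, hm⟩ := hN0
    refine ⟨m, ?_⟩
    have := map_pow (LinearMap.toMatrixAlgEquiv' : _ ≃ₐ[k] Mt n k) N m
    rw [hm, map_zero] at this
    exact this.symm
  · intro y hy
    have h1 : Commute (Matrix.toLin' y) (Matrix.toLin' x) := by
      rw [commute_iff_eq, Module.End.mul_eq_comp, Module.End.mul_eq_comp, ← Matrix.toLin'_mul,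
        ← Matrix.toLin'_mul, hy.eq]
    have h2 : Commute (Matrix.toLin' y) s :=
      Algebra.commute_of_mem_adjoin_singleton_of_commute hs h1
    have h3 := congrArg LinearMap.toMatrix' h2.eq
    rw [Module.End.mul_eq_comp, Module.End.mul_eq_comp, LinearMap.toMatrix'_comp,
      LinearMap.toMatrix'_comp] at h3
    rw [commute_iff_eq]; simpa using h3
end diag

section app
variable {n : ℕ} {k : Type*} [Field k]

/-- `D x` as a linear endomorphism -/
noncomputable def Dl (x : Mt n k) : Module.End k (Pn n k) := (D x).toLinearMap
@[simp] lemma Dl_apply (x : Mt n k) (f) : Dl x f = D x f := rfl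

lemma D_diagonal_monomial (d : Fin n → k) (m : (Fin n ×ₗ Fin n) →₀ ℕ) (c : k) :
    ∃ μ : k, D (diagonal d) (monomial m c) = μ • monomial m c := by
  induction m using Finsupp.induction_linear generalizing c with
  | zero => exact ⟨0, by simpa using (D (diagonal d)).map_algebraMap c⟩
  | add f g hf hg =>
    obtain ⟨μ, h1⟩ := hf c
    obtain ⟨ν, h2⟩ := hg 1
    refine ⟨μ + ν, ?_⟩
    have : (monomial (f + g) c : Pn n k) = monomial f c * monomial g 1 := by
      rw [monomial_mul, mul_one]
    rw [this, Derivation.leibniz, h1, h2]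
    simp only [smul_eq_mul, mul_smul_comm, add_smul]
    rw [mul_comm (monomial g 1)]; ring
  | single a b =>
    induction b generalizing c with
    | zero => exact ⟨0, by simpa using (D (diagonal d)).map_algebraMap c⟩
    | succ b ih =>
      obtain ⟨μ, h1⟩ := ih c
      refine ⟨μ + d (ofLex a).2, ?_⟩
      have : (monomial (Finsupp.single a (b + 1)) c : Pn n k) =
          monomial (Finsupp.single a b) c * X a := by
        rw [X, monomial_mul, mul_one, Finsupp.single_add]
      have h2 : (Xm n k * cm (Pn n k) (diagonal d)) (ofLex a).1 (ofLex a).2 = d (ofLex a).2 • X a := by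
        have : cm (Pn n k) (diagonal d) = diagonal (fun i => C (d i)) := by
          ext i j : 2
          by_cases h : i = j
          · subst h; simp [cm]
          · simp [cm, h]
        rw [this, Matrix.mul_diagonal, Xm, smul_eq_C_mul, mul_comm]; rfl
      rw [this, Derivation.leibniz, h1, D_X, h2]
      simp only [smul_eq_mul, mul_smul_comm, add_smul]
      rw [mul_comm (X a)]; ring

lemma D_diag {s : Mt n k} (hs : Dg s) (f : Pn n k) :
    f ∈ Submodule.span k {v | ∃ μ : k, Dl s v = μ • v} := by
  obtain ⟨Q, d, rfl⟩ := hs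
  have h1 : f = Rt (Q : Mt n k) (Rt ((Q⁻¹ : GL (Fin n) k) : Mt n k) f) := by
    rw [Rt_Rt, ← Units.val_mul]; simp
  rw [h1]
  generalize Rt ((Q⁻¹ : GL (Fin n) k) : Mt n k) f = g
  induction g using MvPolynomial.induction_on' with
  | add p q hp hq => rw [map_add]; exact Submodule.add_mem _ hp hq
  | monomial m c =>
    apply Submodule.subset_span
    obtain ⟨μ, hμ⟩ := D_diagonal_monomial d m c
    refine ⟨μ, ?_⟩
    rw [Dl_apply, D_Rt _ (Q : Mt n k) ((Q⁻¹ : GL (Fin n) k) : Mt n k) (by rw [← Units.val_mul]; simp)]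
    have : ((Q⁻¹ : GL (Fin n) k) : Mt n k) * ((Q : Mt n k) * diagonal d * ((Q⁻¹ : GL (Fin n) k) : Mt n k)) *
        (Q : Mt n k) = diagonal d := by
      have hPQ : ((Q⁻¹ : GL (Fin n) k) : Mt n k) * (Q : Mt n k) = 1 := by rw [← Units.val_mul]; simp
      rw [Matrix.mul_assoc, Matrix.mul_assoc, hPQ, mul_one, ← Matrix.mul_assoc, hPQ, one_mul]
    rw [this, hμ, map_smul]

lemma der_pow_mul {R : Type*} [CommRing R] [Algebra k R] (δ : Derivation k R R) :
    ∀ (N a b : ℕ) (f g : R), a + b ≤ N → (δ.toLinearMap ^ a) f = 0 → (δ.toLinearMap ^ b) g = 0 →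
      (δ.toLinearMap ^ N) (f * g) = 0 := by
  intro N
  induction N with
  | zero =>
    intro a b f g h hf _
    have : a = 0 := by omega
    subst this
    have : f = 0 := by simpa using hf
    simp [this]
  | succ N ih =>
    intro a b f g h hf hg
    rcases a with _ | a
    · have : f = 0 := by simpa using hf
      simp [this]
    rcases b with _ | b
    · have : g = 0 := by simpa using hg
      simp [this]
    rw [pow_succ, Module.End.mul_apply]
    have : δ.toLinearMap (f * g) = f * δ.toLinearMap g + δ.toLinearMap f * g := by
      change δ (f * g) = f * δ g + δ f * g
      rw [Derivation.leibniz]; simp; ring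
    rw [this, map_add, ih (a + 1) b f _ (by omega) hf (by rw [pow_succ] at hg; exact hg),
      ih a (b + 1) _ g (by omega) (by rw [pow_succ] at hf; exact hf) hg, add_zero]

lemma D_nil {N : Mt n k} (hN : IsNilpotent N) (f : Pn n k) : ∃ m : ℕ, (Dl N ^ m) f = 0 := by
  obtain ⟨r, hr⟩ := hN
  have hpow : ∀ j : ℕ, ∀ i l, (Dl N ^ j) (Xm n k i l) = (Xm n k * cm (Pn n k) (N ^ j)) i l := by
    intro j
    induction j with
    | zero => intro i l; simp
    | succ j ih =>
      intro i l
      rw [pow_succ', Module.End.mul_apply, ih, Dl_apply, der_mul_cm, Xm_map_D, Matrix.mul_assoc,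
        ← cm_mul, pow_succ']
  induction f using MvPolynomial.induction_on with
  | C a => exact ⟨1, by simpa using (D N).map_algebraMap a⟩
  | add p q hp hq =>
    obtain ⟨a, ha⟩ := hp
    obtain ⟨b, hb⟩ := hq
    refine ⟨a + b, ?_⟩
    rw [map_add]
    have e1 : (Dl N ^ (a + b)) p = 0 := by rw [add_comm, pow_add, Module.End.mul_apply, ha, map_zero]
    have e2 : (Dl N ^ (a + b)) q = 0 := by rw [pow_add, Module.End.mul_apply, hb, map_zero]
    rw [e1, e2, add_zero]
  | mul_X p q hp =>
    obtain ⟨a, ha⟩ := hp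
    refine ⟨a + r, der_pow_mul _ _ a r _ _ le_rfl ha ?_⟩
    have := hpow r (ofLex q).1 (ofLex q).2
    rw [hr, cm_zero, Matrix.mul_zero] at this
    simp only [Xm, Matrix.of_apply] at this
    exact this

lemma Dl_comm {x y : Mt n k} (h : Commute x y) : Commute (Dl x) (Dl y) := by
  rw [commute_iff_eq]
  apply LinearMap.ext; intro f
  have := D_comm_apply x y f
  rw [h.eq, sub_self, D_zero] at this
  exact (sub_eq_zero.mp this.symm)

lemma Dl_sub (x y : Mt n k) : Dl (x - y) = Dl x - Dl y := by
  apply LinearMap.ext; intro f; simp [D_sub]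

lemma D_jordan {x s N : Mt n k} (hx : x = s + N) (hs : Dg s) (hN : IsNilpotent N)
    (hc : Commute x s) (E F : Submodule k (Pn n k)) (hEF : E ≤ F) (h : ∀ f ∈ F, D x f ∈ E) :
    (∀ f ∈ F, D s f ∈ E) ∧ ∀ f ∈ F, D N f ∈ E := by
  have h1 : ∀ f ∈ F, D s f ∈ E := by
    apply jordan_lemma (Dl x) (Dl s) (D_diag hs) _ (Dl_comm hc) E F hEF h
    intro v
    rw [← Dl_sub, hx, add_sub_cancel_left]
    exact D_nil hN v
  refine ⟨h1, fun f hf => ?_⟩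
  have : N = x - s := by rw [hx, add_sub_cancel_left]
  rw [this, D_sub]
  exact E.sub_mem (h f hf) (h1 f hf)

/-- adjoint action -/
noncomputable def adl (x : Mt n k) : Module.End k (Mt n k) :=
  LinearMap.mulLeft k x - LinearMap.mulRight k x
lemma adl_apply (x y : Mt n k) : adl x y = x * y - y * x := rfl

/-- conjugated matrix unit -/
noncomputable def Ec (Q : GL (Fin n) k) (i j : Fin n) : Mt n k :=
  (Q : Mt n k) * Matrix.single i j 1 * ((Q⁻¹ : GL (Fin n) k) : Mt n k)

lemma conj_mul_conj (Q : GL (Fin n) k) (x y : Mt n k) :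
    ((Q : Mt n k) * x * ((Q⁻¹ : GL (Fin n) k) : Mt n k)) *
    ((Q : Mt n k) * y * ((Q⁻¹ : GL (Fin n) k) : Mt n k)) =
    (Q : Mt n k) * (x * y) * ((Q⁻¹ : GL (Fin n) k) : Mt n k) := by
  have hPQ : ((Q⁻¹ : GL (Fin n) k) : Mt n k) * (Q : Mt n k) = 1 := by rw [← Units.val_mul]; simp
  simp only [Matrix.mul_assoc]
  rw [← Matrix.mul_assoc ((Q⁻¹ : GL (Fin n) k) : Mt n k) (Q : Mt n k), hPQ, one_mul]

lemma adl_Ec (Q : GL (Fin n) k) (d : Fin n → k) (i j : Fin n) :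
    adl ((Q : Mt n k) * diagonal d * ((Q⁻¹ : GL (Fin n) k) : Mt n k)) (Ec Q i j) =
      (d i - d j) • Ec Q i j := by
  rw [adl_apply, Ec, conj_mul_conj, conj_mul_conj, ← sub_mul, ← mul_sub]
  have : diagonal d * Matrix.single i j 1 - Matrix.single i j 1 * diagonal d =
      (d i - d j) • Matrix.single i j (1 : k) := by
    ext a b
    rw [Matrix.sub_apply, Matrix.diagonal_mul, Matrix.mul_diagonal, Matrix.smul_apply,
      Matrix.single_apply]
    split_ifs with h
    · obtain ⟨rfl, rfl⟩ := h; simp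
    · simp
  rw [this, Matrix.mul_smul, Matrix.smul_mul]

lemma Ec_span (Q : GL (Fin n) k) (v : Mt n k) :
    v ∈ Submodule.span k (Set.range fun p : Fin n × Fin n => Ec Q p.1 p.2) := by
  have hPQ : (Q : Mt n k) * ((Q⁻¹ : GL (Fin n) k) : Mt n k) = 1 := by rw [← Units.val_mul]; simp
  have : v = (Q : Mt n k) * (((Q⁻¹ : GL (Fin n) k) : Mt n k) * v * (Q : Mt n k)) *
      ((Q⁻¹ : GL (Fin n) k) : Mt n k) := by
    simp only [Matrix.mul_assoc]
    rw [hPQ, mul_one, ← Matrix.mul_assoc, hPQ, one_mul]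
  rw [this]
  generalize ((Q⁻¹ : GL (Fin n) k) : Mt n k) * v * (Q : Mt n k) = w
  rw [Matrix.matrix_eq_sum_single w, Matrix.mul_sum, Matrix.sum_mul]
  apply Submodule.sum_mem
  intro i _
  rw [Matrix.mul_sum, Matrix.sum_mul]
  apply Submodule.sum_mem
  intro j _
  have : Matrix.single i j (w i j) = w i j • Matrix.single i j (1 : k) := by
    rw [Matrix.smul_single]; simp
  rw [this]
  simp only [Matrix.mul_smul, Matrix.smul_mul]
  exact Submodule.smul_mem _ _ (Submodule.subset_span ⟨(i, j), rfl⟩)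

lemma ad_jordan {x s N : Mt n k} (hx : x = s + N) (hs : Dg s) (hN : IsNilpotent N)
    (hc : Commute x s) (E F : Submodule k (Mt n k)) (hEF : E ≤ F)
    (h : ∀ f ∈ F, x * f - f * x ∈ E) : ∀ f ∈ F, s * f - f * s ∈ E := by
  refine jordan_lemma (adl x) (adl s) ?_ ?_ ?_ E F hEF h
  · obtain ⟨Q, d, rfl⟩ := hs
    intro v
    refine Submodule.span_mono ?_ (Ec_span Q v)
    rintro _ ⟨p, rfl⟩
    exact ⟨_, adl_Ec Q d _ _⟩
  · intro v
    have : adl x - adl s = adl N := by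
      apply LinearMap.ext; intro f
      rw [LinearMap.sub_apply, adl_apply, adl_apply, adl_apply, hx]; noncomm_ring
    rw [this]
    have hnil : IsNilpotent (adl N) :=
      (LinearMap.commute_mulLeft_right (R := k) N N).isNilpotent_sub
        ((LinearMap.isNilpotent_mulLeft_iff k N).mpr hN)
        ((LinearMap.isNilpotent_mulRight_iff k N).mpr hN)
    obtain ⟨m, hm⟩ := hnil
    exact ⟨m, by rw [hm]; rfl⟩
  · rw [commute_iff_eq]
    apply LinearMap.ext; intro f
    simp only [Module.End.mul_apply, adl_apply]
    have := hc.eq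
    noncomm_ring
    simp only [← Matrix.mul_assoc, this]
    simp only [Matrix.mul_assoc, this]
    abel

lemma ad_beta (Q : GL (Fin n) k) (a b : Fin n → k)
    (hab : ∀ i j l m, a i - a j = a l - a m → b i - b j = b l - b m)
    (E F : Submodule k (Mt n k)) (hEF : E ≤ F)
    (h : ∀ f ∈ F, adl ((Q : Mt n k) * diagonal a * ((Q⁻¹ : GL (Fin n) k) : Mt n k)) f ∈ E) :
    ∀ f ∈ F, adl ((Q : Mt n k) * diagonal b * ((Q⁻¹ : GL (Fin n) k) : Mt n k)) f ∈ E := by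
  classical
  let β : k → k := fun μ => if h : ∃ p : Fin n × Fin n, a p.1 - a p.2 = μ then
    b h.choose.1 - b h.choose.2 else 0
  have hβ : ∀ i j, β (a i - a j) = b i - b j := by
    intro i j
    have hex : ∃ p : Fin n × Fin n, a p.1 - a p.2 = a i - a j := ⟨(i, j), rfl⟩
    simp only [β]
    rw [dif_pos hex]
    exact hab _ _ _ _ hex.choose_spec
  refine lin_lemma _ _ β ?_ E F hEF h ?_
  · intro v
    refine Submodule.span_mono ?_ (Ec_span Q v)
    rintro _ ⟨p, rfl⟩
    refine ⟨a p.1 - a p.2, 1, ?_, ?_⟩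
    · simp only [pow_one, LinearMap.sub_apply, adl_Ec, Module.algebraMap_end_apply, sub_self]
    · simp only [adl_Ec, hβ]
  · simp only [β]
    split_ifs with h0
    · have := hab _ _ h0.choose.1 h0.choose.1 (h0.choose_spec.trans (sub_self _).symm)
      rw [this, sub_self]
    · rfl
end app
end EF

namespace EF
section expo
variable {n : ℕ} {k : Type*} [Field k]

lemma nil_pow {N : Mt n k} (hN : IsNilpotent N) : N ^ n = 0 := by
  have h := Matrix.isNilpotent_charpoly_sub_pow_of_isNilpotent hN
  have h2 : N.charpoly = Polynomial.X ^ n := by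
    have := h.eq_zero
    rw [sub_eq_zero] at this
    simpa using this
  have h3 := Matrix.aeval_self_charpoly N
  rw [h2] at h3
  simpa using h3

/-- truncated exponential of `r N` -/
noncomputable def expM {R : Type*} [CommRing R] [Algebra k R] (r : R) (N : Mt n k) : Mt n R :=
  ∑ j ∈ Finset.range n, (r ^ j * algebraMap k R ((j.factorial : k)⁻¹)) • cm R (N ^ j)

section
variable {R : Type*} [CommRing R] [Algebra k R] {S : Type*} [CommRing S] [Algebra k S]

@[simp] lemma expM_map (ψ : R →ₐ[k] S) (r : R) (N : Mt n k) : (expM r N).map ψ = expM (ψ r) N := by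
  ext i j
  simp [expM, Matrix.sum_apply, cm]

lemma expM_comm (r : R) (N : Mt n k) : Commute (expM r N) (cm R N) := by
  unfold expM
  apply Commute.sum_left
  intro j _
  apply Commute.smul_left
  change _ * _ = _ * _
  rw [← cm_mul, ← cm_mul, ← pow_succ, ← pow_succ']

lemma der_expM [CharZero k] (δ : Derivation k R R) (r : R) {N : Mt n k} (hN : IsNilpotent N) (i j) :
    δ (expM r N i j) = (δ r) * (expM r N * cm R N) i j := by
  have hn := nil_pow hN
  have h1 : ∀ l : ℕ, cm R (N ^ l) * cm R N = cm R (N ^ (l + 1)) := fun l => by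
    rw [← cm_mul, pow_succ]
  rcases Nat.eq_zero_or_pos n with h0 | h0
  · subst h0; exact i.elim0
  obtain ⟨m, rfl⟩ : ∃ m, n = m + 1 := ⟨n - 1, by omega⟩
  have e1 : (expM r N * cm R N) = ∑ l ∈ Finset.range m,
      (r ^ l * algebraMap k R ((l.factorial : k)⁻¹)) • cm R (N ^ (l + 1)) := by
    unfold expM
    rw [Finset.sum_range_succ, add_mul, Finset.sum_mul]
    simp only [Matrix.smul_mul, h1]
    rw [hn]; simp
  rw [e1]
  unfold expM
  rw [Finset.sum_range_succ', Matrix.add_apply, Matrix.sum_apply, Matrix.sum_apply, map_add, map_sum,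
    Finset.mul_sum]
  have e2 : δ (((r ^ 0 * algebraMap k R (((Nat.factorial 0 : ℕ) : k)⁻¹)) • cm R (N ^ 0)) i j) = 0 := by
    simp [cm, Matrix.one_apply]; split_ifs <;> simp
  rw [e2, add_zero]
  apply Finset.sum_congr rfl
  intro l _
  have hl : ((l + 1 : ℕ) : k) ≠ 0 := by exact_mod_cast Nat.succ_ne_zero l
  have e3 : algebraMap k R ((l.factorial : k)⁻¹) =
      ((l + 1 : ℕ) : R) * algebraMap k R (((l + 1).factorial : k)⁻¹) := by
    rw [← map_natCast (algebraMap k R), ← map_mul, Nat.factorial_succ]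
    congr 1
    push_cast
    push_cast at hl
    field_simp
  rw [e3]
  simp only [Matrix.smul_apply, smul_eq_mul, Derivation.leibniz, Derivation.leibniz_pow,
    Derivation.map_algebraMap, cm, Matrix.map_apply]
  simp
  ring

end

section
variable [CharZero k]
lemma expM_eq (r : k) {N : Mt n k} (hN : IsNilpotent N) : expM r N = IsNilpotent.exp (r • N) := by
  have h : (r • N) ^ n = 0 := by rw [smul_pow, nil_pow hN, smul_zero]
  rw [IsNilpotent.exp_eq_sum h, expM]
  apply Finset.sum_congr rfl
  intro j _
  ext a b
  simp [smul_pow, cm, Rat.smul_def]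
  ring

lemma expM_add (r s : k) {N : Mt n k} (hN : IsNilpotent N) :
    expM (r + s) N = expM r N * expM s N := by
  have hr : ∀ r : k, IsNilpotent (r • N) := fun r => hN.smul r
  rw [expM_eq _ hN, expM_eq _ hN, expM_eq _ hN, add_smul,
    IsNilpotent.exp_add_of_commute ?_ (hr r) (hr s)]
  exact (Commute.refl N).smul_left _ |>.smul_right _

lemma expM_zero [NeZero n] {R : Type*} [CommRing R] [Algebra k R] (N : Mt n k) : expM (0 : R) N = 1 := by
  unfold expM
  rw [Finset.sum_eq_single 0]
  · simp
  · intro j _ hj; simp [hj]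
  · intro h; simp at h; exact absurd h (NeZero.ne n)

lemma expM_zero_k (N : Mt n k) : expM (0 : k) N = 1 := by
  rcases Nat.eq_zero_or_pos n with h0 | h0
  · subst h0; ext i; exact i.elim0
  · have : NeZero n := ⟨h0.ne'⟩
    exact expM_zero N

/-- the one parameter group as element of `GL` -/
noncomputable def expG (r : k) (N : Mt n k) (hN : IsNilpotent N) : GL (Fin n) k where
  val := expM r N
  inv := expM (-r) N
  val_inv := by rw [← expM_add _ _ hN, add_neg_cancel, expM_zero_k]
  inv_val := by rw [← expM_add _ _ hN, neg_add_cancel, expM_zero_k]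

@[simp] lemma expG_val (r : k) (N : Mt n k) (hN : IsNilpotent N) :
  ((expG r N hN : GL (Fin n) k) : Mt n k) = expM r N := rfl

lemma expG_add (r s : k) (N : Mt n k) (hN : IsNilpotent N) :
    expG (r + s) N hN = expG r N hN * expG s N hN := by
  ext1; simp [expM_add _ _ hN]

lemma expG_nat (m : ℕ) (N : Mt n k) (hN : IsNilpotent N) :
    expG (m : k) N hN = expG 1 N hN ^ m := by
  induction m with
  | zero => ext1; simp [expM_zero_k]
  | succ m ih => rw [pow_succ, ← ih, Nat.cast_succ, expG_add]


lemma poly_eq_of_nat {p q : Polynomial k} (h : ∀ m : ℕ, p.eval (m : k) = q.eval (m : k)) : p = q := by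
  apply Polynomial.eq_of_infinite_eval_eq
  apply Set.Infinite.mono (s := Set.range (fun m : ℕ => (m : k)))
  · rintro _ ⟨m, rfl⟩; exact h m
  · exact Set.infinite_range_of_injective Nat.cast_injective

lemma exists_log (g : GL (Fin n) k) (hg : IsUnipotent g) :
    ∃ (N : Mt n k) (hN : IsNilpotent N), g = expG 1 N hN := by
  classical
  set u : Mt n k := (g : Mt n k) - 1 with hu
  have hun : u ^ n = 0 := hg
  let G : Mt n (Polynomial k) := Matrix.of fun a b => ∑ j ∈ Finset.range n,
    Polynomial.C ((u ^ j) a b * (j.factorial : k)⁻¹) * descPochhammer k j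
  have hdeg : ∀ a b, (G a b).degree < n := by
    intro a b
    simp only [G, Matrix.of_apply]
    apply lt_of_le_of_lt (Polynomial.degree_sum_le _ _)
    rw [Finset.sup_lt_iff (by exact WithBot.bot_lt_coe n)]
    intro j hj
    apply lt_of_le_of_lt Polynomial.degree_le_natDegree
    have h1 := Polynomial.natDegree_C_mul_le ((u ^ j) a b * (j.factorial : k)⁻¹) (descPochhammer k j)
    rw [descPochhammer_natDegree] at h1
    exact_mod_cast lt_of_le_of_lt h1 (Finset.mem_range.1 hj)
  have hval : ∀ m : ℕ, G.map (Polynomial.eval (m : k)) = (g : Mt n k) ^ m := by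
    intro m
    have h1 : (g : Mt n k) = u + 1 := by simp [hu]
    rw [h1, (Commute.one_right u).add_pow]
    have h2 : ∀ j, j ∉ Finset.range (m+1) ∩ Finset.range n →
        u ^ j * 1 ^ (m - j) * ((m.choose j : ℕ) : Mt n k) = 0 := by
      intro j hj
      simp only [Finset.mem_inter, Finset.mem_range, not_and_or, not_lt] at hj
      rcases hj with hj | hj
      · rw [Nat.choose_eq_zero_of_lt (by omega)]; simp
      · rw [pow_eq_zero_of_le hj hun]; simp
    have h3 : ∑ j ∈ Finset.range (m+1), u ^ j * 1 ^ (m - j) * ((m.choose j : ℕ) : Mt n k) =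
        ∑ j ∈ Finset.range n, u ^ j * 1 ^ (m - j) * ((m.choose j : ℕ) : Mt n k) := by
      refine (Finset.sum_subset (Finset.inter_subset_left (s₂ := Finset.range n)) ?_).symm.trans
        (Finset.sum_subset (Finset.inter_subset_right (s₁ := Finset.range (m+1))) ?_)
      · intro j _ hj; exact h2 j hj
      · intro j _ hj; exact h2 j hj
    rw [h3]
    ext a b
    rw [Matrix.sum_apply]
    simp only [G, Matrix.map_apply, Matrix.of_apply, Polynomial.eval_finsetSum, Polynomial.eval_mul,
      Polynomial.eval_C]
    apply Finset.sum_congr rfl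
    intro j _
    have h4 : (u ^ j * 1 ^ (m - j) * ((m.choose j : ℕ) : Mt n k)) a b = (m.choose j : k) * (u ^ j) a b := by
      rw [one_pow, mul_one, (Nat.cast_commute (m.choose j) (u^j)).symm.eq, ← nsmul_eq_mul,
        Matrix.smul_apply, nsmul_eq_mul]
    rw [h4, descPochhammer_eval_eq_descFactorial, Nat.descFactorial_eq_factorial_mul_choose]
    have : (j.factorial : k) ≠ 0 := by exact_mod_cast Nat.factorial_ne_zero j
    push_cast
    field_simp
  have hval' : ∀ (m : ℕ) a b, (G a b).eval (m : k) = ((g : Mt n k) ^ m) a b := fun m a b => by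
    rw [← hval m]; rfl
  have hshift : ∀ (m : ℕ) a b, (G a b).comp (Polynomial.X + Polynomial.C (m : k)) =
      ∑ l, Polynomial.C (((g : Mt n k) ^ m) l b) * G a l := by
    intro m a b
    apply poly_eq_of_nat
    intro m'
    rw [Polynomial.eval_comp, Polynomial.eval_finsetSum]
    simp only [Polynomial.eval_add, Polynomial.eval_X, Polynomial.eval_C, Polynomial.eval_mul, hval']
    rw [← Nat.cast_add, hval', pow_add, Matrix.mul_apply]
    exact Finset.sum_congr rfl fun l _ => mul_comm _ _
  let N : Mt n k := Matrix.of fun a b => (Polynomial.derivative (G a b)).eval 0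
  have hder : ∀ a b, Polynomial.derivative (G a b) = ∑ l, Polynomial.C (N a l) * G l b := by
    intro a b
    apply poly_eq_of_nat
    intro m
    have h1 := congrArg (fun p => (Polynomial.derivative p).eval 0) (hshift m a b)
    simp only [Polynomial.derivative_comp, Polynomial.derivative_sum, Polynomial.eval_finsetSum,
      Polynomial.derivative_mul, Polynomial.eval_mul, Polynomial.eval_add, Polynomial.derivative_C,
      Polynomial.eval_C, Polynomial.eval_zero, zero_mul, zero_add, Polynomial.eval_comp,
      Polynomial.eval_X, Polynomial.derivative_add, Polynomial.derivative_X, Polynomial.eval_one,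
      add_zero, one_mul] at h1
    rw [h1, Polynomial.eval_finsetSum]
    simp only [Polynomial.eval_mul, Polynomial.eval_C, hval']
    exact Finset.sum_congr rfl fun l _ => mul_comm _ _
  have hiter : ∀ (q : ℕ) a b, Polynomial.derivative^[q] (G a b) = ∑ l, Polynomial.C ((N ^ q) a l) * G l b := by
    intro q
    induction q with
    | zero => intro a b; simp [Matrix.one_apply]
    | succ q ih =>
      intro a b
      rw [Function.iterate_succ_apply', ih, Polynomial.derivative_sum]
      simp only [Polynomial.derivative_mul, Polynomial.derivative_C, zero_mul, zero_add, hder]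
      simp only [Finset.mul_sum]
      rw [Finset.sum_comm]
      apply Finset.sum_congr rfl
      intro l _
      rw [pow_succ, Matrix.mul_apply, map_sum, Finset.sum_mul]
      apply Finset.sum_congr rfl
      intro l' _
      rw [map_mul]; ring
  have hG0 : ∀ a b, (G a b).eval 0 = (1 : Mt n k) a b := by
    intro a b; have := hval' 0 a b; simpa using this
  have hNq : ∀ (q : ℕ) a b, (Polynomial.derivative^[q] (G a b)).eval 0 = (N ^ q) a b := by
    intro q a b
    rw [hiter, Polynomial.eval_finsetSum]
    simp [hG0, Matrix.one_apply]
  have hcoef : ∀ (q : ℕ) a b, (q.factorial : k) * (G a b).coeff q = (N ^ q) a b := by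
    intro q a b
    rw [← hNq, ← Polynomial.coeff_zero_eq_eval_zero, Polynomial.coeff_iterate_derivative]
    simp [Nat.descFactorial_self]
  have hN : N ^ n = 0 := by
    ext a b
    rw [← hcoef, Polynomial.coeff_eq_zero_of_degree_lt (hdeg a b)]; simp
  refine ⟨N, ⟨n, hN⟩, ?_⟩
  ext a b
  have h1 := hval' 1 a b
  rw [pow_one] at h1
  change (g : Mt n k) a b = (expM 1 N) a b
  rw [← h1, Nat.cast_one, expM, Matrix.sum_apply]
  rcases Nat.eq_zero_or_pos n with h0 | h0
  · subst h0; exact a.elim0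
  rw [Polynomial.eval_eq_sum_range' (n := n)]
  · apply Finset.sum_congr rfl
    intro j _
    rw [Matrix.smul_apply, cm_self, ← hcoef]
    have : (j.factorial : k) ≠ 0 := by exact_mod_cast Nat.factorial_ne_zero j
    simp
    field_simp
  · by_cases hz : G a b = 0
    · rw [hz]; simpa using h0
    · rw [Polynomial.natDegree_lt_iff_degree_lt hz]; exact hdeg a b

end
end expo
end EF

namespace EF
section curves
variable {n : ℕ} {k : Type*} [Field k] [CharZero k]

/-- restriction of a polynomial to the curve `s ↦ p exp(s N)` -/
noncomputable def cv (p N : Mt n k) : Pn n k →ₐ[k] Polynomial k :=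
  ev (cm (Polynomial k) p * expM Polynomial.X N)

lemma cv_eval (p N : Mt n k) (f : Pn n k) (r : k) :
    (cv p N f).eval r = ev (p * expM r N) f := by
  have h := map_ev (Polynomial.aeval (R := k) r) (cm (Polynomial k) p * expM Polynomial.X N) f
  rw [map_mul', cm_map, expM_map, cm_self] at h
  simpa [cv, Polynomial.coe_aeval_eq_eval] using h

lemma cv_der (p : Mt n k) {N : Mt n k} (hN : IsNilpotent N) (f : Pn n k) :
    Polynomial.derivative (cv p N f) = cv p N (D N f) := by
  refine chain (Polynomial.derivative' (R := k)) _ N ?_ f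
  intro i j
  rw [Matrix.mul_assoc, Matrix.mul_apply, Matrix.mul_apply, map_sum]
  apply Finset.sum_congr rfl
  intro l _
  rw [Derivation.leibniz, der_expM _ _ hN]
  have h1 : Polynomial.derivative' (R := k) (Polynomial.X : Polynomial k) = 1 := by
    simp [Polynomial.derivative'_apply]
  have h2 : Polynomial.derivative' (R := k) (cm (Polynomial k) p i l) = 0 := by
    simp [cm]
  rw [h1, h2]; simp

lemma cv_zero_of_stable (p : Mt n k) {N : Mt n k} (hN : IsNilpotent N) (J : Submodule k (Pn n k))
    (hJ : ∀ f ∈ J, D N f ∈ J) (h0 : ∀ f ∈ J, ev p f = 0) : ∀ f ∈ J, cv p N f = 0 := by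
  have h1 : ∀ (q : ℕ), ∀ f ∈ J, (Polynomial.derivative^[q] (cv p N f)).eval 0 = 0 := by
    intro q
    induction q with
    | zero => intro f hf; simp [cv_eval, expM_zero_k, h0 f hf]
    | succ q ih => intro f hf; rw [Function.iterate_succ_apply, cv_der _ hN]; exact ih _ (hJ f hf)
  intro f hf
  ext q
  have h2 := h1 q f hf
  rw [← Polynomial.coeff_zero_eq_eval_zero, Polynomial.coeff_iterate_derivative] at h2
  simp only [zero_add, Nat.descFactorial_self, nsmul_eq_mul, mul_eq_zero, Nat.cast_eq_zero] at h2
  simpa [Nat.factorial_ne_zero] using h2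

lemma ev_exp_of_stable (p : Mt n k) {N : Mt n k} (hN : IsNilpotent N) (J : Submodule k (Pn n k))
    (hJ : ∀ f ∈ J, D N f ∈ J) (h0 : ∀ f ∈ J, ev p f = 0) (r : k) : ∀ f ∈ J, ev (p * expM r N) f = 0 := by
  intro f hf
  rw [← cv_eval, cv_zero_of_stable p hN J hJ h0 f hf]; simp

lemma ev_exp_of_D_zero (p : Mt n k) {N : Mt n k} (hN : IsNilpotent N) (f : Pn n k)
    (hf : D N f = 0) (r : k) : ev (p * expM r N) f = ev p f := by
  have h1 : Polynomial.derivative (cv p N f) = 0 := by rw [cv_der _ hN, hf, map_zero]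
  have h2 := Polynomial.eq_C_of_derivative_eq_zero h1
  have h3 : ev p f = (cv p N f).eval 0 := by rw [cv_eval, expM_zero_k, mul_one]
  rw [h3, ← cv_eval, h2]; simp

lemma D_zero_of_const {N : Mt n k} (hN : IsNilpotent N) (f : Pn n k)
    (h : ∀ p : Mt n k, Polynomial.derivative (cv p N f) = 0) : D N f = 0 := by
  apply poly_ext
  intro p
  have := congrArg (Polynomial.eval 0) (h p)
  rw [cv_der _ hN, cv_eval, expM_zero_k, mul_one] at this
  simpa using this

lemma Lie_of_exp {K : Subgroup (GL (Fin n) k)} {N : Mt n k} (hN : IsNilpotent N)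
    (h : expG 1 N hN ∈ K) : N ∈ Lie K := by
  rw [mem_Lie_iff]
  intro f hf
  have h1 : cv 1 N f = 0 := by
    apply poly_eq_of_nat
    intro m
    rw [cv_eval, one_mul]
    have := (mem_IK.1 hf) _ (K.pow_mem h m)
    rw [← expG_nat] at this
    simpa using this
  have h2 : (cv 1 N (D N f)).eval 0 = 0 := by rw [← cv_der _ hN, h1]; simp
  rwa [cv_eval, expM_zero_k, mul_one] at h2

/-- closed subgroup -/
def Clo (K : Subgroup (GL (Fin n) k)) : Prop :=
  ∀ g : GL (Fin n) k, (∀ f ∈ IK K, ev (g : Mt n k) f = 0) → g ∈ K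

lemma clo_of_alg {K : Subgroup (GL (Fin n) k)} (h : IsAlgebraicSubgroup K) : Clo K := by
  obtain ⟨S, hS⟩ := h
  intro g hg
  rw [hS g]
  intro p hp
  rw [eval_evalMat]
  apply hg
  rw [mem_IK]
  intro g' hg'
  have := (hS g').1 hg' p hp
  rwa [eval_evalMat] at this

lemma exp_mem {K : Subgroup (GL (Fin n) k)} (hK : Clo K) {N : Mt n k} (hN : IsNilpotent N)
    (h : N ∈ Lie K) (r : k) : expG r N hN ∈ K := by
  apply hK
  have := ev_exp_of_stable 1 hN ((IK K).restrictScalars k) (fun f hf => mem_Lie.1 h f hf)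
    (fun f hf => by simpa using mem_IK.1 hf 1 K.one_mem) r
  intro f hf
  simpa using this f hf

lemma basic_open (U : Set (GL (Fin n) k)) (hU : (zariskiGL n k).IsOpen U) :
    ∀ x ∈ U, ∃ p : Pn n k, ev (x : Mt n k) p ≠ 0 ∧ ∀ y : GL (Fin n) k, ev (y : Mt n k) p ≠ 0 → y ∈ U := by
  change TopologicalSpace.GenerateOpen _ U at hU
  induction hU with
  | basic s hs =>
    obtain ⟨S, rfl⟩ := hs
    rintro x ⟨p, hp, hx⟩
    refine ⟨p, by rwa [eval_evalMat] at hx, fun y hy => ⟨p, hp, by rwa [eval_evalMat]⟩⟩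
  | univ => intro x _; exact ⟨1, by simp, fun y _ => trivial⟩
  | inter s t _ _ hs ht =>
    rintro x ⟨h1, h2⟩
    obtain ⟨p, hp, hp'⟩ := hs x h1
    obtain ⟨q, hq, hq'⟩ := ht x h2
    refine ⟨p * q, by rw [map_mul]; exact mul_ne_zero hp hq, fun y hy => ?_⟩
    rw [map_mul] at hy
    exact ⟨hp' y (left_ne_zero_of_mul hy), hq' y (right_ne_zero_of_mul hy)⟩
  | sUnion S _ ih =>
    rintro x ⟨s, hs, hx⟩
    obtain ⟨p, hp, hp'⟩ := ih s hs x hx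
    exact ⟨p, hp, fun y hy => ⟨s, hs, hp' y hy⟩⟩

lemma exp_idComponent {K : Subgroup (GL (Fin n) k)} {N : Mt n k} (hN : IsNilpotent N)
    (h : ∀ r, expG r N hN ∈ K) : expG 1 N hN ∈ idComponent K := by
  letI := zariskiGL n k
  let γ : k → K := fun r => ⟨expG r N hN, h r⟩
  have h1 : IsPreirreducible (Set.range γ) := by
    rintro U V ⟨U', hU', rfl⟩ ⟨V', hV', rfl⟩ ⟨_, ⟨a, rfl⟩, ha⟩ ⟨_, ⟨b, rfl⟩, hb⟩
    obtain ⟨p, hp, hp'⟩ := basic_open U' hU' _ ha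
    obtain ⟨q, hq, hq'⟩ := basic_open V' hV' _ hb
    have e : ∀ (r : k) (f : Pn n k), ev ((γ r : GL (Fin n) k) : Mt n k) f = (cv 1 N f).eval r := by
      intro r f; rw [cv_eval, one_mul]; rfl
    have hne : cv 1 N p * cv 1 N q ≠ 0 := by
      apply mul_ne_zero
      · intro h0; rw [e, h0] at hp; simp at hp
      · intro h0; rw [e, h0] at hq; simp at hq
    have : ∃ r : k, (cv 1 N p * cv 1 N q).eval r ≠ 0 := by
      by_contra hc
      push Not at hc
      exact hne (Polynomial.funext (by simpa using hc))
    obtain ⟨r, hr⟩ := this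
    rw [Polynomial.eval_mul] at hr
    exact ⟨γ r, ⟨r, rfl⟩, hp' _ (by rw [e]; exact left_ne_zero_of_mul hr),
      hq' _ (by rw [e]; exact right_ne_zero_of_mul hr)⟩
  have h2 : (⟨1, K.one_mem⟩ : K) ∈ Set.range γ := ⟨0, by
    apply Subtype.ext; ext1; simp [γ, expM_zero_k]⟩
  exact ⟨γ 1, h1.isPreconnected.subset_connectedComponent h2 ⟨1, rfl⟩, rfl⟩

end curves
end EF

namespace EF
section upr
variable {n : ℕ} {k : Type*} [Field k]

/-- product of one parameter subgroups -/
noncomputable def upr {R : Type*} [CommRing R] [Algebra k R] (s : ℕ → R) (ν : ℕ → Mt n k) : ℕ → Mt n R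
  | 0 => 1
  | r + 1 => upr s ν r * expM (s r) (ν r)

lemma upr_map {R S : Type*} [CommRing R] [Algebra k R] [CommRing S] [Algebra k S] (ψ : R →ₐ[k] S)
    (s : ℕ → R) (ν : ℕ → Mt n k) (r : ℕ) : (upr s ν r).map ψ = upr (fun i => ψ (s i)) ν r := by
  induction r with
  | zero => simp [upr]
  | succ r ih => simp [upr, ih]

lemma upr_congr {R : Type*} [CommRing R] [Algebra k R] {s s' : ℕ → R} {ν ν' : ℕ → Mt n k} {r : ℕ}
    (h : ∀ i < r, s i = s' i) (h' : ∀ i < r, ν i = ν' i) : upr s ν r = upr s' ν' r := by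
  induction r with
  | zero => rfl
  | succ r ih =>
    simp only [upr]
    rw [ih (fun i hi => h i (by omega)) (fun i hi => h' i (by omega)), h r (by omega), h' r (by omega)]

/-- ideal of the image of `upr` -/
noncomputable def Ju (ν : ℕ → Mt n k) (r : ℕ) : Ideal (Pn n k) :=
  RingHom.ker (ev (k := k) (upr (X : ℕ → MvPolynomial ℕ k) ν r))

instance (ν : ℕ → Mt n k) (r : ℕ) : (Ju ν r).IsPrime := RingHom.ker_isPrime _

variable [CharZero k]

lemma mem_Ju {ν : ℕ → Mt n k} {r : ℕ} {f : Pn n k} :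
    f ∈ Ju ν r ↔ ∀ s : ℕ → k, ev (upr s ν r) f = 0 := by
  have key : ∀ s : ℕ → k, eval s (ev (k := k) (upr (X : ℕ → MvPolynomial ℕ k) ν r) f) = ev (upr s ν r) f := by
    intro s
    have := map_ev (aeval (R := k) s) (upr (X : ℕ → MvPolynomial ℕ k) ν r) f
    rw [upr_map] at this
    simpa [coe_aeval_eq_eval] using this
  rw [Ju, RingHom.mem_ker]
  constructor
  · intro h s
    rw [← key]; erw [h]; simp
  · intro h
    apply MvPolynomial.funext
    intro s
    erw [key, h]; simp

lemma upr_zero (ν : ℕ → Mt n k) (r : ℕ) : upr (fun _ => (0 : k)) ν r = 1 := by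
  induction r with
  | zero => rfl
  | succ r ih => simp [upr, ih, expM_zero_k]

lemma Ju_le_m1 (ν : ℕ → Mt n k) (r : ℕ) : Ju ν r ≤ m1 n k := by
  intro f hf
  rw [mem_m1]
  have h := mem_Ju.1 hf (fun _ => 0)
  rwa [upr_zero] at h

lemma Ju_congr {ν ν' : ℕ → Mt n k} {r : ℕ} (h : ∀ i < r, ν i = ν' i) : Ju ν r = Ju ν' r := by
  ext f; rw [mem_Ju, mem_Ju]
  refine forall_congr' fun s => ?_
  rw [upr_congr (fun _ _ => rfl) h]

lemma Ju_succ_le (ν : ℕ → Mt n k) (r : ℕ) : Ju ν (r + 1) ≤ Ju ν r := by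
  intro f hf
  rw [mem_Ju] at hf ⊢
  intro s
  have := hf (Function.update s r 0)
  rw [upr, Function.update_self, expM_zero_k, mul_one] at this
  rwa [upr_congr (s' := s) (ν' := ν) (fun i hi => by rw [Function.update_of_ne (by omega)])
    (fun _ _ => rfl)] at this

lemma Ju_succ_lt {ν : ℕ → Mt n k} {r : ℕ} (hN : IsNilpotent (ν r)) {f : Pn n k} (hf : f ∈ Ju ν r)
    (hf' : D (ν r) f ∉ Ju ν r) : Ju ν (r + 1) < Ju ν r := by
  refine lt_of_le_of_ne (Ju_succ_le ν r) fun he => hf' ?_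
  rw [← he, mem_Ju] at hf
  rw [mem_Ju]
  intro s
  have h1 : cv (upr s ν r) (ν r) f = 0 := by
    apply Polynomial.funext
    intro t
    rw [cv_eval]
    have := hf (Function.update s r t)
    rw [upr, Function.update_self,
      upr_congr (s' := s) (ν' := ν) (fun i hi => by rw [Function.update_of_ne (by omega)])
      (fun _ _ => rfl)] at this
    simpa using this
  have h2 : (cv (upr s ν r) (ν r) (D (ν r) f)).eval 0 = 0 := by rw [← cv_der _ hN, h1]; simp
  rwa [cv_eval, expM_zero_k, mul_one] at h2

lemma exists_J (S : Set (Mt n k)) (hS : ∀ N ∈ S, IsNilpotent N) (h0 : (0 : Mt n k) ∈ S) :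
    ∃ r ≤ n ^ 2, ∃ ν : ℕ → Mt n k, (∀ i, ν i ∈ S) ∧ ∀ N ∈ S, ∀ f ∈ Ju ν r, D N f ∈ Ju ν r := by
  by_contra hc
  push Not at hc
  have key : ∀ r ≤ n ^ 2 + 1, ∃ ν : ℕ → Mt n k, (∀ i, ν i ∈ S) ∧ (Ju ν r).height + r ≤ (n ^ 2 : ℕ) := by
    intro r
    induction r with
    | zero =>
      intro _
      refine ⟨fun _ => 0, fun _ => h0, ?_⟩
      have h1 : ((Ju (fun _ => (0 : Mt n k)) 0).height : WithBot ℕ∞) ≤ ringKrullDim (Pn n k) :=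
        Ideal.height_le_ringKrullDim_of_ne_top Ideal.IsPrime.ne_top'
      rw [MvPolynomial.ringKrullDim_of_isNoetherianRing, ringKrullDim_eq_zero_of_field] at h1
      have h2 : Nat.card (Fin n ×ₗ Fin n) = n ^ 2 := by
        rw [Nat.card_congr (ofLex : (Fin n ×ₗ Fin n) ≃ Fin n × Fin n)]; simp [pow_two]
      rw [h2, zero_add] at h1
      have h3 : (Ju (fun _ => (0 : Mt n k)) 0).height ≤ ((n ^ 2 : ℕ) : ℕ∞) := WithBot.coe_le_coe.1 h1
      simpa using h3
    | succ r ih =>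
      intro hr
      obtain ⟨ν, hν, hh⟩ := ih (by omega)
      obtain ⟨N, hN, f, hf, hf'⟩ := hc r (by omega) ν hν
      let ν' := Function.update ν r N
      have e : Ju ν' r = Ju ν r := Ju_congr fun i hi => by
        simp only [ν']; rw [Function.update_of_ne (by omega)]
      have e2 : ν' r = N := by simp [ν']
      refine ⟨ν', fun i => ?_, ?_⟩
      · by_cases hi : i = r
        · subst hi; rw [e2]; exact hN
        · simp only [ν']; rw [Function.update_of_ne hi]; exact hν i
      · have hlt : Ju ν' (r + 1) < Ju ν' r := by
          apply Ju_succ_lt (f := f)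
          · rw [e2]; exact hS N hN
          · rwa [e]
          · rw [e, e2]; exact hf'
        have := Ideal.height_add_one_le_of_lt_of_isPrime hlt
        rw [e] at this
        calc (Ju ν' (r+1)).height + ((r + 1 : ℕ) : ℕ∞) = ((Ju ν' (r+1)).height + 1) + r := by
              push_cast; ring
          _ ≤ (Ju ν r).height + r := by gcongr
          _ ≤ _ := hh
  obtain ⟨ν, -, h⟩ := key (n ^ 2 + 1) le_rfl
  have : ((n ^ 2 + 1 : ℕ) : ℕ∞) ≤ ((n ^ 2 : ℕ) : ℕ∞) := le_trans le_add_self h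
  have := Nat.cast_le.1 this
  omega

end upr
end EF

namespace EF
section sep
variable {n : ℕ} {k : Type*} [Field k]

lemma der_prod {R ι : Type*} [CommRing R] [Algebra k R] [DecidableEq ι] (δ : Derivation k R R)
    (s : Finset ι) (f : ι → R) : δ (∏ i ∈ s, f i) = ∑ i ∈ s, ∏ j ∈ s, (if j = i then δ (f i) else f j) := by
  induction s using Finset.induction_on with
  | empty => simp
  | insert a s ha ih =>
    rw [Finset.prod_insert ha, Derivation.leibniz, ih, Finset.sum_insert ha, Finset.prod_insert ha]
    rw [if_pos rfl, add_comm]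
    congr 1
    · rw [smul_eq_mul, mul_comm]
      congr 1
      apply Finset.prod_congr rfl
      intro j hj
      rw [if_neg]; rintro rfl; exact ha hj
    · rw [smul_eq_mul, Finset.mul_sum]
      apply Finset.sum_congr rfl
      intro i hi
      rw [Finset.prod_insert ha, if_neg]; rintro rfl; exact ha hi

lemma jacobi {R ι : Type*} [CommRing R] [Algebra k R] [Fintype ι] [DecidableEq ι] (δ : Derivation k R R)
    (F : Matrix ι ι R) : δ F.det = trace (adjugate F * F.map δ) := by
  have h1 : ∀ i, (adjugate F * F.map δ) i i = (F.updateCol i (fun l => δ (F l i))).det := by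
    intro i
    have := congrFun (cramer_eq_adjugate_mulVec F (fun l => δ (F l i))) i
    rw [cramer_apply] at this
    rw [this]; rfl
  rw [trace]
  simp only [diag_apply, h1]
  simp only [det_apply, map_sum]
  rw [Finset.sum_comm]
  apply Finset.sum_congr rfl
  intro σ _
  rw [← Finset.smul_sum]
  have : ∀ (u : ℤˣ) (x : R), δ (u • x) = u • δ x := by
    intro u x; rw [Units.smul_def, Units.smul_def, map_zsmul]
  rw [this, der_prod]
  congr 1
  apply Finset.sum_congr rfl
  intro i _
  apply Finset.prod_congr rfl
  intro j _
  rw [updateCol_apply]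
  split_ifs with h
  · rw [h]
  · rfl

lemma D_deg (x : Mt n k) (f : Pn n k) : (D x f).totalDegree ≤ f.totalDegree := by
  conv_lhs => rw [f.as_sum]
  rw [map_sum]
  apply totalDegree_finsetSum_le
  intro m hm
  rw [D, mkDerivation_monomial]
  apply (totalDegree_smul_le _ _).trans
  apply totalDegree_finsetSum_le
  intro p hp
  change ((monomial (m - Finsupp.single p 1) ((m p : ℕ) : k)) *
    ((Xm n k * cm (Pn n k) x) (ofLex p).1 (ofLex p).2)).totalDegree ≤ _
  apply (totalDegree_mul _ _).trans
  have h1 : ((Xm n k * cm (Pn n k) x) (ofLex p).1 (ofLex p).2).totalDegree ≤ 1 := by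
    rw [Matrix.mul_apply]
    apply totalDegree_finsetSum_le
    intro l _
    apply (totalDegree_mul _ _).trans
    have e1 : (cm (Pn n k) x l (ofLex p).2).totalDegree = 0 := by
      simp only [cm, Matrix.map_apply]; exact totalDegree_C _
    rw [e1]; simp [Xm]
  have h2 : (monomial (m - Finsupp.single p 1) ((m p : ℕ) : k)).totalDegree + 1 ≤ f.totalDegree := by
    have h3 : (m.sum fun _ e => e) ≤ f.totalDegree := le_totalDegree hm
    have h4 : m = (m - Finsupp.single p 1) + Finsupp.single p 1 := by
      ext q
      have : m p ≠ 0 := by simpa using hp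
      by_cases hq : q = p
      · subst hq; simp; omega
      · simp [Finsupp.single_apply, Ne.symm hq]
    rw [h4, Finsupp.sum_add_index' (by simp) (by simp), Finsupp.sum_single_index rfl] at h3
    exact le_trans (Nat.add_le_add_right (totalDegree_monomial_le _ _) 1) h3
  omega

lemma map_trace_adj {R S ι : Type*} [CommRing R] [Algebra k R] [CommRing S] [Algebra k S] [Fintype ι]
    [DecidableEq ι] (ψ : R →ₐ[k] S) (F G : Matrix ι ι R) :
    ψ (trace (adjugate F * G)) = trace (adjugate (F.map ψ) * G.map ψ) := by
  have h1 := AlgHom.map_adjugate ψ F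
  rw [AlgHom.mapMatrix_apply, AlgHom.mapMatrix_apply] at h1
  rw [← h1, trace, trace, map_sum]
  apply Finset.sum_congr rfl
  intro i _
  simp [Matrix.mul_apply]

variable [CharZero k]

lemma exists_points {d : ℕ} (f : Fin d → Pn n k) (hf : LinearIndependent k f) :
    ∃ p : Fin d → Mt n k, (Matrix.of fun i j => ev (p j) (f i)).det ≠ 0 := by
  let s : Set (Fin d → k) := Set.range fun q : Mt n k => fun i => ev q (f i)
  have hs : Submodule.span k s = ⊤ := by
    by_contra hne
    obtain ⟨φ, hφ, hφ'⟩ := Submodule.exists_le_ker_of_lt_top _ (lt_top_iff_ne_top.2 hne)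
    apply hφ
    have h1 : ∀ i, φ (Pi.single i 1) = 0 := by
      apply Fintype.linearIndependent_iff.1 hf (fun i => φ (Pi.single i 1))
      apply poly_ext
      intro q
      have h2 : φ (fun i => ev q (f i)) = 0 := hφ' (Submodule.subset_span ⟨q, rfl⟩)
      rw [LinearMap.pi_apply_eq_sum_univ φ] at h2
      simp only [map_sum, map_smul, map_zero, smul_eq_mul] at h2 ⊢
      rw [← h2]
      exact Finset.sum_congr rfl fun i _ => by
        rw [mul_comm]; congr 2; ext j; simp [Pi.single_apply, eq_comm]
    apply LinearMap.pi_ext'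
    intro i
    ext
    simpa using h1 i
  have h1 := Submodule.exists_fun_fin_finrank_span_eq k s
  have h2 : Module.finrank k (Submodule.span k s) = d := by rw [hs]; simp
  rw [h2] at h1
  obtain ⟨v, hv, -, hli⟩ := h1
  choose p hp using hv
  refine ⟨p, ?_⟩
  have h3 : (Matrix.of fun i j => ev (p j) (f i)) = Matrix.of fun i j => v j i := by
    ext i j; simp only [of_apply]; rw [← hp j]
  rw [h3, ← isUnit_iff_ne_zero, ← Matrix.isUnit_iff_isUnit_det, ← linearIndependent_cols_iff_isUnit]
  exact hli

/-- invariants of the nilpotents -/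
noncomputable def Ainv (S : Set (Mt n k)) : Submodule k (Pn n k) where
  carrier := {f | ∀ N ∈ S, D N f = 0}
  add_mem' := by intro a b ha hb N hN; rw [map_add, ha N hN, hb N hN, add_zero]
  zero_mem' := by intro N _; simp
  smul_mem' := by intro c a ha N hN; rw [Derivation.map_smul, ha N hN, smul_zero]

lemma mem_Ainv {S : Set (Mt n k)} {f : Pn n k} : f ∈ Ainv S ↔ ∀ N ∈ S, D N f = 0 := Iff.rfl

lemma sep_fin (S : Set (Mt n k)) (hS : ∀ N ∈ S, IsNilpotent N) (V : Submodule k (Pn n k))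
    [FiniteDimensional k V] (hV : ∀ N ∈ S, ∀ f ∈ V, D N f ∈ V) (y : Mt n k) (hy : y ∈ ann (Ainv S)) :
    ∀ f ∈ V, D y f ∈ V := by
  classical
  let d := Module.finrank k V
  let b : Module.Basis (Fin d) k V := Module.finBasis k V
  let f : Fin d → Pn n k := fun i => (b i : Pn n k)
  have hf : LinearIndependent k f := b.linearIndependent.map' V.subtype (by simp)
  -- the determinants
  let F : (Fin d → Mt n k) → Matrix (Fin d) (Fin d) (Pn n k) := fun p =>
    Matrix.of fun i j => Lt (p j) (f i)
  have hF : ∀ p, (F p).det ∈ Ainv S := by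
    intro p N hN
    let T : Module.End k V := (Dl N).restrict (p := V) (q := V) (hV N hN)
    have hT : IsNilpotent T := by
      rw [Module.End.isNilpotent_iff_of_finite]
      intro v
      obtain ⟨m, hm⟩ := D_nil (hS N hN) (v : Pn n k)
      refine ⟨m, ?_⟩
      have : T ^ m = ((Dl N) ^ m).restrict (p := V) (q := V) (fun x hx => Module.End.pow_apply_mem_of_forall_mem m (hV N hN) x hx) :=
        Module.End.pow_restrict m _ _
      rw [this]
      exact Subtype.ext hm
    let a := LinearMap.toMatrix b b T
    have ha : trace a = 0 :=
      (Matrix.isNilpotent_trace_of_isNilpotent ((LinearMap.isNilpotent_toMatrix_iff b T).2 hT)).eq_zero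
    have hDf : ∀ i, D N (f i) = ∑ l, a l i • f l := by
      intro i
      have h1 : T (b i) = ∑ l, a l i • b l := by
        conv_lhs => rw [← b.sum_repr (T (b i))]
        simp only [a, LinearMap.toMatrix_apply]
      have h2 := congrArg (Subtype.val) h1
      have h3 : ((T (b i) : V) : Pn n k) = D N (f i) := rfl
      rw [← h3, h2]
      simp [f]
    have hDF : (F p).map (D N) = (aᵀ).map C * F p := by
      ext1 i j
      simp only [F, Matrix.map_apply, of_apply, Matrix.mul_apply, transpose_apply]
      rw [D_Lt, hDf, map_sum]
      apply Finset.sum_congr rfl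
      intro l _
      rw [map_smul, smul_eq_C_mul]
    rw [jacobi, hDF, trace_mul_comm, Matrix.mul_assoc, mul_adjugate]
    rw [Matrix.mul_smul, Matrix.mul_one, trace_smul]
    have : trace ((aᵀ).map (C : k → Pn n k)) = 0 := by
      have h5 := AddMonoidHom.map_trace (C : k →+* Pn n k) (aᵀ)
      rw [trace_transpose, ha, map_zero] at h5
      exact h5.symm
    erw [this, smul_zero]
  -- values
  let M : (Fin d → Mt n k) → Matrix (Fin d) (Fin d) k := fun p => Matrix.of fun i j => ev (p j) (f i)
  let M' : (Fin d → Mt n k) → Matrix (Fin d) (Fin d) k := fun p => Matrix.of fun i j => ev (p j) (D y (f i))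
  have hM : ∀ p, trace (adjugate (M p) * M' p) = 0 := by
    intro p
    have h1 := hy _ (hF p)
    rw [jacobi] at h1
    have h2 := congrArg (ev (1 : Mt n k)) h1
    rw [map_zero] at h2
    have h3 : (F p).map (ev (1 : Mt n k)) = M p := by
      ext i j; simp [F, M]
    have h4 : ((F p).map (D y)).map (ev (1 : Mt n k)) = M' p := by
      ext i j; simp [F, M', D_Lt]
    rw [← h2, ← h3, ← h4]
    exact (map_trace_adj (ev (1 : Mt n k)) _ _).symm
  obtain ⟨p, hp⟩ := exists_points f hf
  change (M p).det ≠ 0 at hp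
  have hu : IsUnit (M p).det := isUnit_iff_ne_zero.2 hp
  let c := M' p * (M p)⁻¹
  have hc : c * M p = M' p := by
    simp only [c]; rw [Matrix.mul_assoc, nonsing_inv_mul _ hu, mul_one]
  let h : Fin d → Pn n k := fun i => D y (f i) - ∑ l, c i l • f l
  let Hh : (Fin d → Mt n k) → Matrix (Fin d) (Fin d) k := fun p => Matrix.of fun i j => ev (p j) (h i)
  have hM' : ∀ p, M' p = c * M p + Hh p := by
    intro q
    ext i j
    simp [M', M, Hh, h, Matrix.mul_apply]
  have hh0 : Hh p = 0 := by
    have := hM' p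
    rw [hc] at this
    simpa using this.symm
  have htr : ∀ q, trace (adjugate (M q) * M' q) = (M q).det * trace c + trace (adjugate (M q) * Hh q) := by
    intro q
    rw [hM', mul_add, trace_add, trace_mul_comm, Matrix.mul_assoc, mul_adjugate, Matrix.mul_smul,
      mul_one, trace_smul, smul_eq_mul]
  have htc : trace c = 0 := by
    have := htr p
    rw [hM, hh0, mul_zero, trace_zero, add_zero] at this
    exact (mul_eq_zero.1 this.symm).resolve_left hp
  have hzero : ∀ i, h i = 0 := by
    intro i
    apply poly_ext
    intro q
    rw [map_zero]
    let v : Fin d → k := fun i => ev q (h i)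
    have hcr : cramer (M p) v = 0 := by
      ext j
      rw [cramer_apply, Pi.zero_apply]
      have h1 := htr (Function.update p j q)
      rw [hM, htc, mul_zero, zero_add] at h1
      have h2 : Hh (Function.update p j q) = updateCol 0 j v := by
        ext i l
        rw [updateCol_apply]
        by_cases hl : l = j
        · subst hl; simp [Hh, v]
        · have := congrFun (congrFun hh0 i) l
          simp only [Hh, of_apply] at this
          simp [Hh, hl, this]
      have h3 : M (Function.update p j q) = updateCol (M p) j (fun i => ev q (f i)) := by
        ext i l
        rw [updateCol_apply]
        by_cases hl : l = j
        · subst hl; simp [M]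
        · simp [M, hl]
      have h4 : trace (adjugate (M (Function.update p j q)) * updateCol 0 j v) =
          cramer (M (Function.update p j q)) v j := by
        rw [cramer_eq_adjugate_mulVec, trace]
        rw [Finset.sum_eq_single j]
        · simp [Matrix.mul_apply, Matrix.mulVec, dotProduct]
        · intro l _ hl
          simp [Matrix.mul_apply, updateCol_apply, hl]
        · simp
      rw [h2, h4, cramer_apply, h3, updateCol_idem] at h1
      exact h1.symm
    have h5 := mulVec_cramer (M p) v
    rw [hcr, mulVec_zero] at h5
    have h6 := congrFun h5 i
    simp only [Pi.zero_apply, Pi.smul_apply, smul_eq_mul] at h6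
    exact (mul_eq_zero.1 h6.symm).resolve_left hp
  intro g hg
  have hfV : ∀ i, f i ∈ V := fun i => (b i).2
  have h7 : ∀ i, D y (f i) ∈ V := by
    intro i
    have : D y (f i) = ∑ l, c i l • f l := by
      have := hzero i
      simp only [h] at this
      exact sub_eq_zero.1 this
    rw [this]
    exact Submodule.sum_mem _ fun l _ => V.smul_mem _ (hfV l)
  have h8 : g = ∑ i, b.repr ⟨g, hg⟩ i • f i := by
    have := congrArg Subtype.val (b.sum_repr ⟨g, hg⟩)
    rw [Submodule.coe_sum] at this
    exact this.symm
  rw [h8, map_sum]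
  exact Submodule.sum_mem _ fun l _ => by rw [Derivation.map_smul]; exact V.smul_mem _ (h7 l)

lemma separation (S : Set (Mt n k)) (hS : ∀ N ∈ S, IsNilpotent N) (J : Submodule k (Pn n k))
    (hJ : ∀ N ∈ S, ∀ f ∈ J, D N f ∈ J) (y : Mt n k) (hy : y ∈ ann (Ainv S)) :
    ∀ f ∈ J, D y f ∈ J := by
  intro f hf
  let W := restrictTotalDegree (Fin n ×ₗ Fin n) k f.totalDegree
  have : FiniteDimensional k (J ⊓ W : Submodule k (Pn n k)) :=
    Submodule.finiteDimensional_of_le (inf_le_right (a := J) (b := W))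
  have hfW : f ∈ W := (mem_restrictTotalDegree _ _ _).2 le_rfl
  refine (sep_fin S hS (J ⊓ W) ?_ y hy f ⟨hf, hfW⟩).1
  rintro N hN g ⟨hg, hg'⟩
  refine ⟨hJ N hN g hg, ?_⟩
  have := (mem_restrictTotalDegree _ _ _).1 hg'
  exact (mem_restrictTotalDegree _ _ _).2 ((D_deg N g).trans this)
end sep
end EF

namespace EF
section eig
variable {k : Type*} [Field k] {V : Type*} [AddCommGroup V] [Module k V]

lemma eig_aeval (f : Module.End k V) {v : V} {μ : k} (h : f v = μ • v) (p : Polynomial k) :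
    Polynomial.aeval f p v = p.eval μ • v := by
  induction p using Polynomial.induction_on' with
  | add p q hp hq => simp [hp, hq, add_smul]
  | monomial m a =>
    rw [Polynomial.aeval_monomial, Polynomial.eval_monomial]
    have : (f ^ m) v = μ ^ m • v := by
      induction m with
      | zero => simp
      | succ m ih => rw [pow_succ', Module.End.mul_apply, ih, map_smul, h, smul_smul, pow_succ]
    rw [Module.End.mul_apply, this, Module.algebraMap_end_apply, smul_smul]

/-- a stable subspace is spanned by its eigenvectors -/
lemma eig_span (f : Module.End k V) (P : Submodule k V) (hP : ∀ v ∈ P, f v ∈ P)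
    (hs : ∀ v ∈ P, v ∈ Submodule.span k {v | ∃ μ : k, f v = μ • v}) :
    ∀ v ∈ P, v ∈ Submodule.span k {v | v ∈ P ∧ ∃ μ : k, f v = μ • v} := by
  classical
  intro v hv
  have h1 : v ∈ ⨆ μ : k, f.eigenspace μ := by
    have := hs v hv
    refine (Submodule.span_le.2 ?_) this
    rintro w ⟨μ, hw⟩
    exact Submodule.mem_iSup_of_mem μ (Module.End.mem_eigenspace_iff.2 hw)
  rw [Submodule.mem_iSup_iff_exists_finsupp] at h1
  obtain ⟨g, hg, rfl⟩ := h1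
  have hpow : ∀ p : Polynomial k, ∀ v ∈ P, Polynomial.aeval f p v ∈ P := by
    intro p
    induction p using Polynomial.induction_on' with
    | add p q hp hq => intro v hv; simpa using P.add_mem (hp v hv) (hq v hv)
    | monomial m a =>
      intro v hv
      rw [Polynomial.aeval_monomial, Module.End.mul_apply, Module.algebraMap_end_apply]
      apply P.smul_mem
      induction m with
      | zero => simpa
      | succ m ih => rw [pow_succ', Module.End.mul_apply]; exact hP _ ih
  have hmem : ∀ μ, g μ ∈ P := by
    intro μ
    have hm := hpow (∏ ν ∈ g.support.erase μ, (Polynomial.C (μ - ν)⁻¹ * (Polynomial.X - Polynomial.C ν))) _ hv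
    rw [Finsupp.sum, map_sum] at hm
    have : ∀ ν ∈ g.support, Polynomial.aeval f (∏ ν ∈ g.support.erase μ, (Polynomial.C (μ - ν)⁻¹ * (Polynomial.X - Polynomial.C ν))) (g ν) = if ν = μ then g ν else 0 := by
      intro ν hν
      rw [eig_aeval f (Module.End.mem_eigenspace_iff.1 (hg ν)), Polynomial.eval_prod]
      split_ifs with h
      · subst h
        rw [Finset.prod_eq_one, one_smul]
        intro x hx
        have : ν - x ≠ 0 := sub_ne_zero.2 (Finset.ne_of_mem_erase hx).symm
        simp [this]
      · rw [Finset.prod_eq_zero (Finset.mem_erase.2 ⟨h, hν⟩), zero_smul]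
        simp
    rw [Finset.sum_congr rfl this, Finset.sum_ite_eq'] at hm
    split_ifs at hm with h
    · exact hm
    · rw [Finsupp.notMem_support_iff.1 h]; exact P.zero_mem
  refine Submodule.sum_mem _ fun μ _ => Submodule.subset_span ⟨hmem μ, μ, Module.End.mem_eigenspace_iff.1 (hg μ)⟩
end eig

section alg
variable {n : ℕ} {k : Type*} [Field k]

lemma adl_self_span {s : Mt n k} (hs : Dg s) (v : Mt n k) :
    v ∈ Submodule.span k {v | ∃ μ : k, adl s v = μ • v} := by
  obtain ⟨Q, d, rfl⟩ := hs
  refine Submodule.span_mono ?_ (Ec_span Q v)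
  rintro _ ⟨⟨i, j⟩, rfl⟩
  exact ⟨_, adl_Ec Q d i j⟩

lemma ad_eig_span {s : Mt n k} (hs : Dg s) (P : Submodule k (Mt n k))
    (hP : ∀ v ∈ P, s * v - v * s ∈ P) :
    ∀ v ∈ P, v ∈ Submodule.span k {v | v ∈ P ∧ ∃ μ : k, s * v - v * s = μ • v} :=
  eig_span (adl s) P hP fun v _ => adl_self_span hs v

lemma D_eig_span {s : Mt n k} (hs : Dg s) (P : Submodule k (Pn n k))
    (hP : ∀ v ∈ P, D s v ∈ P) :
    ∀ v ∈ P, v ∈ Submodule.span k {v | v ∈ P ∧ ∃ μ : k, D s v = μ • v} :=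
  eig_span (Dl s) P hP fun v _ => D_diag hs v

/-- nonzero-weight vectors are nilpotent -/
lemma eig_nilp [CharZero k] {s z : Mt n k} {μ : k} (hμ : μ ≠ 0) (h : s * z - z * s = μ • z) :
    IsNilpotent z := by
  by_contra hn
  have hp : ∀ m : ℕ, adl s (z ^ m) = (m * μ) • z ^ m := by
    intro m
    induction m with
    | zero => simp [adl_apply]
    | succ m ih =>
      rw [adl_apply] at ih ⊢
      have : s * z ^ (m+1) - z ^ (m+1) * s = (s * z ^ m - z ^ m * s) * z + z ^ m * (s * z - z * s) := by
        rw [pow_succ]; noncomm_ring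
      rw [this, ih, h]
      push_cast
      rw [smul_mul_assoc, mul_smul_comm, ← pow_succ, ← add_smul]; ring_nf
  have hinf : Set.Infinite {ν : k | (adl s).HasEigenvalue ν} := by
    apply Set.infinite_of_injective_forall_mem (f := fun m : ℕ => (m * μ : k))
    · intro a b hab
      simpa [hμ] using hab
    · intro m
      exact Module.End.hasEigenvalue_of_hasEigenvector (x := z ^ m)
        ⟨Module.End.mem_eigenspace_iff.2 (hp m), fun h0 => hn ⟨m, h0⟩⟩
  exact hinf (Module.End.finite_hasEigenvalue (adl s))

variable [IsAlgClosed k] [CharZero k] {K : Subgroup (GL (Fin n) k)}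

/-- nilpotent elements of the Lie algebra -/
def Sn (K : Subgroup (GL (Fin n) k)) : Set (Mt n k) := {N | N ∈ Lie K ∧ IsNilpotent N}
noncomputable def Ak (K : Subgroup (GL (Fin n) k)) : Submodule k (Pn n k) := Ainv (Sn K)
noncomputable def uu (K : Subgroup (GL (Fin n) k)) : Submodule k (Mt n k) := ann (Ak K)
noncomputable def nn (K : Subgroup (GL (Fin n) k)) : Submodule k (Mt n k) := stab (Ak K)

lemma mem_Ak {f : Pn n k} : f ∈ Ak K ↔ ∀ N ∈ Sn K, D N f = 0 := mem_Ainv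
lemma mem_uu {x : Mt n k} : x ∈ uu K ↔ ∀ f ∈ Ak K, D x f = 0 := Iff.rfl
lemma mem_nn {x : Mt n k} : x ∈ nn K ↔ ∀ f ∈ Ak K, D x f ∈ Ak K := Iff.rfl

lemma Sn_uu {N : Mt n k} (h : N ∈ Sn K) : N ∈ uu K := fun f hf => mem_Ak.1 hf N h

lemma Lie_jordan {x s N : Mt n k} (hx : x = s + N) (hs : Dg s) (hN : IsNilpotent N)
    (hc : Commute x s) (h : x ∈ Lie K) : s ∈ Lie K ∧ N ∈ Lie K :=
  D_jordan hx hs hN hc _ _ le_rfl h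

/-- the derivation of a conjugate -/
lemma D_conj (h : GL (Fin n) k) (x : Mt n k) (f : Pn n k) :
    D ((h : Mt n k) * x * ((h⁻¹ : GL (Fin n) k) : Mt n k)) f
      = Rt (h : Mt n k) (D x (Rt ((h⁻¹ : GL (Fin n) k) : Mt n k) f)) := by
  have e1 : ((h⁻¹ : GL (Fin n) k) : Mt n k) * (h : Mt n k) = 1 := by
    rw [← Units.val_mul]; simp
  have e2 : (h : Mt n k) * ((h⁻¹ : GL (Fin n) k) : Mt n k) = 1 := by
    rw [← Units.val_mul]; simp
  rw [D_Rt x _ (h : Mt n k) e1, Rt_Rt, e2, Rt_one]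

lemma Lie_Ad {h : GL (Fin n) k} (hh : h ∈ K) {x : Mt n k} (hx : x ∈ Lie K) :
    (h : Mt n k) * x * ((h⁻¹ : GL (Fin n) k) : Mt n k) ∈ Lie K := by
  intro f hf
  rw [D_conj]
  exact Rt_IK hh (hx _ (Rt_IK (K.inv_mem hh) hf))

lemma nilp_Ad (h : GL (Fin n) k) {x : Mt n k} (hx : IsNilpotent x) :
    IsNilpotent ((h : Mt n k) * x * ((h⁻¹ : GL (Fin n) k) : Mt n k)) := by
  obtain ⟨m, hm⟩ := hx
  refine ⟨m, ?_⟩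
  have := Units.conj_pow h x m
  rw [this, hm]; simp

lemma Sn_Ad {h : GL (Fin n) k} (hh : h ∈ K) {x : Mt n k} (hx : x ∈ Sn K) :
    (h : Mt n k) * x * ((h⁻¹ : GL (Fin n) k) : Mt n k) ∈ Sn K :=
  ⟨Lie_Ad hh hx.1, nilp_Ad h hx.2⟩

lemma Ak_Rt {h : GL (Fin n) k} (hh : h ∈ K) {f : Pn n k} (hf : f ∈ Ak K) :
    Rt (h : Mt n k) f ∈ Ak K := by
  rw [mem_Ak] at *
  intro N hN
  have e1 : (h : Mt n k) * ((h⁻¹ : GL (Fin n) k) : Mt n k) = 1 := by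
    rw [← Units.val_mul]; simp
  have := Sn_Ad (K.inv_mem hh) hN
  have h2 := hf _ (Sn_Ad (K.inv_mem hh) hN)
  rw [inv_inv] at h2
  have := Sn_Ad (K.inv_mem hh) hN
  rw [D_Rt N (h : Mt n k) _ e1, h2]
  simp

/-- stability under conjugation by `K` -/
def AdSt (K : Subgroup (GL (Fin n) k)) (P : Submodule k (Mt n k)) : Prop :=
  ∀ h ∈ K, ∀ x ∈ P, (h : Mt n k) * x * ((h⁻¹ : GL (Fin n) k) : Mt n k) ∈ P

lemma AdSt_uu : AdSt K (uu K) := by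
  intro h hh x hx f hf
  rw [D_conj, hx _ (Ak_Rt (K.inv_mem hh) hf)]; simp
lemma AdSt_nn : AdSt K (nn K) := by
  intro h hh x hx f hf
  rw [D_conj]; exact Ak_Rt hh (hx _ (Ak_Rt (K.inv_mem hh) hf))

lemma Lie_nn (hK : Clo K) : Lie K ≤ nn K := by
  intro x hx f hf
  rw [mem_Ak]
  intro N hN
  apply D_zero_of_const hN.2
  intro p
  have key : ∀ r : k, (cv p N (D x f)).eval r = ev p (D x f) := by
    intro r
    rw [cv_eval]
    have hmem : Lt (p * expM r N) f - Lt p f ∈ IK K := by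
      intro h hh
      rw [map_sub, ev_Lt, ev_Lt, cm_self, cm_self]
      have h1 : p * expM r N * (h : Mt n k) = p * (h : Mt n k) *
          expM r (((h⁻¹ : GL (Fin n) k) : Mt n k) * N * (h : Mt n k)) := by
        have e1 : (h : Mt n k) * ((h⁻¹ : GL (Fin n) k) : Mt n k) = 1 := by
          rw [← Units.val_mul]; simp
        have : expM r (((h⁻¹ : GL (Fin n) k) : Mt n k) * N * (h : Mt n k)) =
            ((h⁻¹ : GL (Fin n) k) : Mt n k) * expM r N * (h : Mt n k) := by
          have e2 : ((h⁻¹ : GL (Fin n) k) : Mt n k) * (h : Mt n k) = 1 := by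
            rw [← Units.val_mul]; simp
          unfold expM
          rw [Finset.mul_sum, Finset.sum_mul]
          refine Finset.sum_congr rfl fun i _ => ?_
          have := Units.conj_pow' h N i
          rw [cm_self, cm_self, this]
          simp only [smul_mul_assoc, mul_smul_comm]
        rw [this]
        calc _ = p * 1 * expM r N * (h : Mt n k) := by simp
          _ = _ := by rw [← e1]; noncomm_ring
      have h3 := Sn_Ad (K.inv_mem hh) hN
      rw [inv_inv] at h3
      rw [h1, ev_exp_of_D_zero _ h3.2 f (mem_Ak.1 hf _ h3), sub_self]
    have := mem_Lie_iff.1 hx _ hmem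
    rw [map_sub, map_sub, D_Lt, D_Lt, ev_Lt, ev_Lt, cm_self, cm_self, mul_one, mul_one] at this
    exact sub_eq_zero.1 this
  have : cv p N (D x f) = Polynomial.C (ev p (D x f)) := by
    apply Polynomial.funext; intro r; rw [key]; simp
  rw [this]; simp

lemma nn_brk {x y : Mt n k} (hx : x ∈ nn K) (hy : y ∈ nn K) : x * y - y * x ∈ nn K := by
  intro f hf
  rw [D_comm_apply]
  exact (Ak K).sub_mem (hx _ (hy _ hf)) (hy _ (hx _ hf))
lemma uu_nn : uu K ≤ nn K := by
  intro x hx f hf; rw [hx f hf]; exact (Ak K).zero_mem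
lemma nn_uu {x y : Mt n k} (hx : x ∈ nn K) (hy : y ∈ uu K) : x * y - y * x ∈ uu K := by
  intro f hf
  rw [D_comm_apply, hy f hf, hy _ (hx f hf)]; simp
lemma uu_nn' {x y : Mt n k} (hx : x ∈ uu K) (hy : y ∈ nn K) : x * y - y * x ∈ uu K := by
  rw [← neg_sub]; exact (uu K).neg_mem (nn_uu hy hx)

lemma Lie_brk {x y : Mt n k} (hx : x ∈ Lie K) (hy : y ∈ Lie K) : x * y - y * x ∈ Lie K := by
  intro f hf
  rw [D_comm_apply]
  exact (IK K).sub_mem (hx _ (hy _ hf)) (hy _ (hx _ hf))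

lemma Lie_Lie_uu (hK : Clo K) {x y : Mt n k} (hx : x ∈ Lie K) (hy : y ∈ Lie K) :
    x * y - y * x ∈ uu K := by
  obtain ⟨s, N, hxs, hs, hN, hc⟩ := jordan x
  have hJ := Lie_jordan hxs hs hN (hc x rfl) hx
  have h2 : N * y - y * N ∈ uu K := uu_nn' (Sn_uu ⟨hJ.2, hN⟩) (Lie_nn hK hy)
  have h1 : s * y - y * s ∈ uu K := by
    have hspan := ad_eig_span hs (Lie K) (fun v hv => Lie_brk hJ.1 hv) y hy
    clear h2 hy
    induction hspan using Submodule.span_induction with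
    | mem z hz =>
      obtain ⟨hz, μ, hμ⟩ := hz
      rw [hμ]
      by_cases h : μ = 0
      · simp [h]
      · exact (uu K).smul_mem _ (Sn_uu ⟨hz, eig_nilp h hμ⟩)
    | zero => simp
    | add a b _ _ ha hb => 
      have : s * (a + b) - (a+b) * s = (s * a - a * s) + (s * b - b * s) := by noncomm_ring
      rw [this]; exact (uu K).add_mem ha hb
    | smul c a _ ha => 
      have : s * (c • a) - (c • a) * s = c • (s * a - a * s) := by simp [smul_sub]
      rw [this]; exact (uu K).smul_mem _ ha
  have : x * y - y * x = (s * y - y * s) + (N * y - y * N) := by rw [hxs]; noncomm_ring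
  rw [this]; exact (uu K).add_mem h1 h2

/-- elements of `nn` which centralize `P` modulo `uu` -/
noncomputable def cz (K : Subgroup (GL (Fin n) k)) (P : Submodule k (Mt n k)) : Submodule k (Mt n k) where
  carrier := {y | y ∈ nn K ∧ ∀ x ∈ P, y * x - x * y ∈ uu K}
  add_mem' := by
    rintro a b ⟨ha, ha'⟩ ⟨hb, hb'⟩
    refine ⟨(nn K).add_mem ha hb, fun x hx => ?_⟩
    have : (a + b) * x - x * (a + b) = (a * x - x * a) + (b * x - x * b) := by noncomm_ring
    rw [this]; exact (uu K).add_mem (ha' x hx) (hb' x hx)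
  zero_mem' := ⟨(nn K).zero_mem, fun x _ => by simp⟩
  smul_mem' := by
    rintro c a ⟨ha, ha'⟩
    refine ⟨(nn K).smul_mem c ha, fun x hx => ?_⟩
    have : (c • a) * x - x * (c • a) = c • (a * x - x * a) := by simp [smul_sub]
    rw [this]; exact (uu K).smul_mem _ (ha' x hx)

lemma mem_cz {P : Submodule k (Mt n k)} {y : Mt n k} :
    y ∈ cz K P ↔ y ∈ nn K ∧ ∀ x ∈ P, y * x - x * y ∈ uu K := Iff.rfl

noncomputable def zz1 (K : Subgroup (GL (Fin n) k)) := cz K (Lie K)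
noncomputable def zz2 (K : Subgroup (GL (Fin n) k)) := cz K (zz1 K)

lemma Lie_zz1 (hK : Clo K) : Lie K ≤ zz1 K := fun x hx => ⟨Lie_nn hK hx, fun y hy => Lie_Lie_uu hK hx hy⟩
lemma Lie_zz2 (hK : Clo K) : Lie K ≤ zz2 K := fun x hx => ⟨Lie_nn hK hx, fun y hy => by
  rw [← neg_sub]; exact (uu K).neg_mem (hy.2 x hx)⟩
lemma zz2_zz1 (hK : Clo K) : zz2 K ≤ zz1 K := fun _ hx => ⟨hx.1, fun y hy => hx.2 y (Lie_zz1 hK hy)⟩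
lemma uu_zz2 : uu K ≤ zz2 K := fun _ hx => ⟨uu_nn hx, fun _ hy => uu_nn' hx hy.1⟩

lemma zz2_brk (hK : Clo K) {x y : Mt n k} (hx : x ∈ zz2 K) (hy : y ∈ zz2 K) : x * y - y * x ∈ uu K :=
  hx.2 _ (zz2_zz1 hK hy)

lemma AdSt_cz {P : Submodule k (Mt n k)} (hP : AdSt K P) : AdSt K (cz K P) := by
  intro h hh x hx
  refine ⟨AdSt_nn h hh x hx.1, fun y hy => ?_⟩
  have h1 := AdSt_uu h hh _ (hx.2 _ (hP _ (K.inv_mem hh) _ hy))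
  rw [inv_inv] at h1
  convert h1 using 1
  have e1 : (h : Mt n k) * ((h⁻¹ : GL (Fin n) k) : Mt n k) = 1 := by
    rw [← Units.val_mul]; simp
  generalize ((h⁻¹ : GL (Fin n) k) : Mt n k) = h' at *
  generalize (h : Mt n k) = h at *
  calc _ = h * x * h' * y * 1 - 1 * y * (h * x * h') := by simp
    _ = _ := by rw [← e1]; noncomm_ring

lemma AdSt_Lie : AdSt K (Lie K) := fun _ hh _ hx => Lie_Ad hh hx
lemma AdSt_zz2 : AdSt K (zz2 K) := AdSt_cz (AdSt_cz AdSt_Lie)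

lemma zz2_jordan (hK : Clo K) {x s N : Mt n k} (hx : x = s + N) (hs : Dg s) (hN : IsNilpotent N)
    (hc : Commute x s) (h : x ∈ zz2 K) : s ∈ zz2 K ∧ N ∈ zz2 K := by
  have h1 : s ∈ zz2 K := ⟨(D_jordan hx hs hN hc _ _ le_rfl h.1).1,
    ad_jordan hx hs hN hc _ _ (fun y hy => uu_zz2 hy |> zz2_zz1 hK) h.2⟩
  refine ⟨h1, ?_⟩
  have : N = x - s := by rw [hx]; simp
  rw [this]; exact (zz2 K).sub_mem h h1
end alg
end EF

namespace EF
section tor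
variable {n : ℕ} {k : Type*} [Field k]

/-- conjugated diagonal matrix -/
noncomputable def qd (Q : GL (Fin n) k) (b : Fin n → k) : Mt n k :=
  (Q : Mt n k) * diagonal b * ((Q⁻¹ : GL (Fin n) k) : Mt n k)

/-- the space of `b` whose differences follow the coincidences of differences of `a` -/
def Bs (a : Fin n → k) : Submodule k (Fin n → k) where
  carrier := {b | ∀ i j l m, a i - a j = a l - a m → b i - b j = b l - b m}
  add_mem' := by
    intro x y hx hy i j l m h
    have h1 := hx i j l m h
    have h2 := hy i j l m h
    simp only [Pi.add_apply]; linear_combination h1 + h2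
  zero_mem' := by intro i j l m _; simp
  smul_mem' := by
    intro c x hx i j l m h
    have h1 := hx i j l m h
    simp only [Pi.smul_apply, smul_eq_mul]; linear_combination c * h1

lemma mem_Bs {a b : Fin n → k} :
    b ∈ Bs a ↔ ∀ i j l m, a i - a j = a l - a m → b i - b j = b l - b m := Iff.rfl

lemma qd_add (Q : GL (Fin n) k) (a b : Fin n → k) (c : k) : qd Q (a + c • b) = qd Q a + c • qd Q b := by
  have : diagonal (a + c • b) = diagonal a + c • diagonal b := by
    ext i j; by_cases h : i = j
    · subst h; simp
    · simp [h]
  rw [qd, this, mul_add, add_mul]; simp [qd]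

lemma qd_Dg (Q : GL (Fin n) k) (b : Fin n → k) : Dg (qd Q b) := ⟨Q, b, rfl⟩

lemma cj_inv (Q : GL (Fin n) k) (v : Mt n k) :
    (Q : Mt n k) * (((Q⁻¹ : GL (Fin n) k) : Mt n k) * v * (Q : Mt n k)) *
      ((Q⁻¹ : GL (Fin n) k) : Mt n k) = v := by
  have hPQ : (Q : Mt n k) * ((Q⁻¹ : GL (Fin n) k) : Mt n k) = 1 := by rw [← Units.val_mul]; simp
  simp only [Matrix.mul_assoc]
  rw [hPQ, mul_one, ← Matrix.mul_assoc, hPQ, one_mul]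

lemma cj_inj (Q : GL (Fin n) k) {v w : Mt n k} (h : (Q : Mt n k) * v * ((Q⁻¹ : GL (Fin n) k) : Mt n k)
    = (Q : Mt n k) * w * ((Q⁻¹ : GL (Fin n) k) : Mt n k)) : v = w := by
  rw [Units.mul_left_inj, Units.mul_right_inj] at h
  exact h

/-- eigenvalues of `ad (qd Q a)` -/
lemma hasEig_qd (Q : GL (Fin n) k) (a : Fin n → k) (μ : k) :
    (adl (qd Q a)).HasEigenvalue μ ↔ ∃ p : Fin n × Fin n, a p.1 - a p.2 = μ := by
  constructor
  · intro h
    obtain ⟨v, hv⟩ := h.exists_hasEigenvector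
    have h1 := hv.apply_eq_smul
    have h0 := hv.2
    rw [adl_apply, ← cj_inv Q v, qd, conj_mul_conj, conj_mul_conj, ← sub_mul, ← mul_sub,
      ← smul_mul_assoc, ← mul_smul_comm] at h1
    have h2 := cj_inj Q h1
    set w := ((Q⁻¹ : GL (Fin n) k) : Mt n k) * v * (Q : Mt n k) with hw
    by_contra hne
    push Not at hne
    have : w = 0 := by
      ext i j
      have := congrFun (congrFun h2 i) j
      rw [Matrix.sub_apply, Matrix.diagonal_mul, Matrix.mul_diagonal, Matrix.smul_apply, smul_eq_mul] at this
      have h3 : (a i - a j - μ) * w i j = 0 := by linear_combination this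
      rcases mul_eq_zero.1 h3 with h | h
      · exact absurd (sub_eq_zero.1 h) (hne (i, j))
      · simpa using h
    apply h0
    rw [← cj_inv Q v, ← hw, this]; simp
  · rintro ⟨⟨i, j⟩, rfl⟩
    refine Module.End.hasEigenvalue_of_hasEigenvector (x := Ec Q i j)
      ⟨Module.End.mem_eigenspace_iff.2 (adl_Ec Q a i j), ?_⟩
    intro h
    have : Ec Q i j = (Q : Mt n k) * 0 * ((Q⁻¹ : GL (Fin n) k) : Mt n k) := by simp [h]
    have := cj_inj Q this
    have := congrFun (congrFun this i) j
    simp at this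

/-- the number of ad-eigenvalues -/
noncomputable def cnt (t : Mt n k) : ℕ := Set.ncard {μ | (adl t).HasEigenvalue μ}

lemma cnt_qd [DecidableEq k] (Q : GL (Fin n) k) (a : Fin n → k) :
    cnt (qd Q a) = (Finset.univ.image fun p : Fin n × Fin n => a p.1 - a p.2).card := by
  rw [cnt, ← Set.ncard_coe_finset]
  congr 1
  ext μ
  simp only [Set.mem_setOf_eq, hasEig_qd, Finset.coe_image, Finset.coe_univ, Set.image_univ, Set.mem_range]

/-- generic combination argument -/
lemma generic_Bs [Infinite k] [DecidableEq k] (a b : Fin n → k)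
    (hmax : ∀ c : k, (Finset.univ.image fun p : Fin n × Fin n => (a + c • b) p.1 - (a + c • b) p.2).card
      ≤ (Finset.univ.image fun p : Fin n × Fin n => a p.1 - a p.2).card) : b ∈ Bs a := by
  let G : Fin n × Fin n → k := fun p => a p.1 - a p.2
  let H : Fin n × Fin n → k := fun p => b p.1 - b p.2
  let bad : Finset k := insert 0 (Finset.univ.image fun pq : (Fin n × Fin n) × (Fin n × Fin n) =>
    -(G pq.1 - G pq.2) / (H pq.1 - H pq.2))
  obtain ⟨c, hc⟩ := Infinite.exists_notMem_finset bad
  have hc0 : c ≠ 0 := by rintro rfl; exact hc (Finset.mem_insert_self _ _)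
  let F : Fin n × Fin n → k := fun p => (a + c • b) p.1 - (a + c • b) p.2
  have hF : ∀ p, F p = G p + c * H p := by
    intro p; simp only [F, G, H, Pi.add_apply, Pi.smul_apply, smul_eq_mul]; ring
  have hFG : ∀ p q, F p = F q → G p = G q := by
    intro p q h
    rw [hF, hF] at h
    by_contra hne
    have hH : H p - H q ≠ 0 := by
      intro h0
      apply hne
      linear_combination h - c * h0
    apply hc
    refine Finset.mem_insert_of_mem (Finset.mem_image.2 ⟨(p, q), Finset.mem_univ _, ?_⟩)
    rw [div_eq_iff hH]
    linear_combination - h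
  have hφ : ∃ φ : k → k, ∀ p, φ (F p) = G p := by
    refine ⟨fun x => if h : ∃ p, F p = x then G h.choose else 0, fun p => ?_⟩
    have h : ∃ q, F q = F p := ⟨p, rfl⟩
    simp only [h, dite_true]
    exact hFG _ _ h.choose_spec
  obtain ⟨φ, hφ⟩ := hφ
  have him : (Finset.univ.image F).image φ = Finset.univ.image G := by
    rw [Finset.image_image]; congr 1; funext p; exact hφ p
  have hinj : Set.InjOn φ (Finset.univ.image F : Finset k) := by
    apply Finset.injOn_of_card_image_eq
    apply le_antisymm Finset.card_image_le
    rw [him]; exact hmax c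
  intro i j l m h
  have h1 : F (i, j) = F (l, m) := by
    apply hinj (by simp) (by simp)
    rw [hφ, hφ]; exact h
  rw [hF, hF] at h1
  have h2 : c * (H (i, j) - H (l, m)) = 0 := by
    have : G (i, j) = G (l, m) := h
    linear_combination h1 - this
  exact sub_eq_zero.1 ((mul_eq_zero.1 h2).resolve_left hc0)

/-- transfer to another frame -/
lemma frame_transfer (Q : GL (Fin n) k) (a : Fin n → k) (t : Mt n k)
    (h : ∀ P : Submodule k (Mt n k), (∀ v ∈ P, adl (qd Q a) v ∈ P) → ∀ v ∈ P, adl t v ∈ P) :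
    ∃ b ∈ Bs a, t = qd Q b := by
  have hline : ∀ v : Mt n k, (∃ c : k, adl (qd Q a) v = c • v) → ∃ c : k, adl t v = c • v := by
    rintro v ⟨c, hc⟩
    have := h (Submodule.span k {v}) ?_ v (Submodule.mem_span_singleton_self v)
    · obtain ⟨c, hc⟩ := Submodule.mem_span_singleton.1 this
      exact ⟨c, hc.symm⟩
    · intro w hw
      obtain ⟨d, rfl⟩ := Submodule.mem_span_singleton.1 hw
      rw [map_smul, hc]
      exact Submodule.smul_mem _ _ (Submodule.smul_mem _ _ (Submodule.mem_span_singleton_self v))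
  set T := ((Q⁻¹ : GL (Fin n) k) : Mt n k) * t * (Q : Mt n k) with hT
  have hdiag : ∀ i l, l ≠ i → T l i = 0 := by
    intro i l hli
    obtain ⟨c, hc⟩ := hline (Ec Q i i) ⟨_, adl_Ec Q a i i⟩
    rw [adl_apply, ← cj_inv Q t, Ec, conj_mul_conj, conj_mul_conj, ← sub_mul, ← mul_sub,
      ← smul_mul_assoc, ← mul_smul_comm] at hc
    have := congrFun (congrFun (cj_inj Q hc) l) i
    rw [← hT] at this
    simpa [Matrix.single_apply, hli, hli.symm] using this
  let b : Fin n → k := fun i => T i i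
  have ht : t = qd Q b := by
    rw [qd, ← cj_inv Q t, ← hT]
    congr 2
    ext i j
    by_cases hij : i = j
    · subst hij; simp [b]
    · rw [hdiag j i hij]; simp [hij]
  refine ⟨b, ?_, ht⟩
  intro i j l m hd
  by_cases hp : (i, j) = (l, m)
  · simp only [Prod.mk.injEq] at hp
    obtain ⟨rfl, rfl⟩ := hp; rfl
  obtain ⟨c, hc⟩ := hline (Ec Q i j + Ec Q l m) ⟨a i - a j, by
    rw [map_add, qd, adl_Ec, adl_Ec, ← hd, smul_add]⟩
  rw [map_add, ht, qd, adl_Ec, adl_Ec, Ec, Ec, ← smul_mul_assoc, ← mul_smul_comm, ← smul_mul_assoc,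
    ← mul_smul_comm, ← add_mul, ← mul_add, ← add_mul, ← mul_add, ← smul_mul_assoc, ← mul_smul_comm] at hc
  have hc := cj_inj Q hc
  have h1 := congrFun (congrFun hc i) j
  have h2 := congrFun (congrFun hc l) m
  have hne : ¬ (l = i ∧ m = j) := by rintro ⟨rfl, rfl⟩; exact hp rfl
  have hne' : ¬ (i = l ∧ j = m) := by rintro ⟨rfl, rfl⟩; exact hp rfl
  simp [Matrix.single_apply, hne, hne'] at h1 h2
  rw [h1, h2]

variable [IsAlgClosed k] [CharZero k] {K : Subgroup (GL (Fin n) k)}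

lemma exists_torus (hK : Clo K) : ∃ (Q : GL (Fin n) k) (a : Fin n → k),
    (∀ b ∈ Bs a, qd Q b ∈ zz2 K) ∧
    (∀ y ∈ zz2 K, Dg y → ∃ b ∈ Bs a, ∃ u ∈ uu K, y = qd Q b + u) := by
  classical
  have hinf : Infinite k := inferInstance
  let P : ℕ → Prop := fun m => ∃ (Q : GL (Fin n) k) (a : Fin n → k), qd Q a ∈ zz2 K ∧
    cnt (qd Q a) = m
  have hbd : ∀ m, P m → m ≤ n * n := by
    rintro m ⟨Q, a, -, rfl⟩
    rw [cnt_qd]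
    refine Finset.card_image_le.trans ?_
    simp
  have hex : ∃ m, P m := ⟨_, 1, 0, by simp [qd], rfl⟩
  obtain ⟨m0, hm0⟩ := hex
  have hP := Nat.findGreatest_spec (hbd m0 hm0) hm0
  have hmaxP : ∀ m, P m → m ≤ Nat.findGreatest P (n * n) := fun m hm => Nat.le_findGreatest (hbd m hm) hm
  obtain ⟨Q, a, ha, hcnt⟩ := hP
  rw [← hcnt] at hmaxP
  have claimM : ∀ t ∈ zz2 K, Dg t → Commute (qd Q a) t → ∃ b ∈ Bs a, t = qd Q b := by
    intro t ht htd hct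
    obtain ⟨Q', a', b', h1, h2⟩ := simdiag (qd_Dg Q a) htd hct
    have hb : b' ∈ Bs a' := by
      apply generic_Bs
      intro c
      rw [← cnt_qd Q', ← cnt_qd Q']
      have e : qd Q' a' = qd Q a := h1.symm
      rw [e]
      apply hmaxP
      refine ⟨Q', _, ?_, rfl⟩
      rw [qd_add, e]
      have : qd Q' b' = t := h2.symm
      rw [this]
      exact (zz2 K).add_mem ha ((zz2 K).smul_mem _ ht)
    apply frame_transfer
    intro E hE v hv
    rw [h1] at hE
    rw [h2]
    exact ad_beta Q' a' b' hb E E le_rfl hE v hv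
  refine ⟨Q, a, ?_, ?_⟩
  · intro b hb
    have h1 : ∀ f ∈ zz1 K, adl (qd Q b) f ∈ uu K :=
      ad_beta Q a b hb _ _ (fun y hy => zz2_zz1 hK (uu_zz2 hy)) ha.2
    refine ⟨?_, h1⟩
    intro f hf
    rw [mem_Ak]
    intro N hN
    have hNu := Sn_uu hN
    have h2 := h1 N (zz2_zz1 hK (uu_zz2 hNu)) f hf
    rw [adl_apply, D_comm_apply, mem_Ak.1 hf N hN, map_zero, zero_sub, neg_eq_zero] at h2
    exact h2
  · intro y hy hyd
    have hdec : ∃ z0 ∈ zz2 K, Commute (qd Q a) z0 ∧ ∃ u ∈ uu K, y = z0 + u := by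
      have hsp := ad_eig_span (qd_Dg Q a) (zz2 K) (fun v hv => uu_zz2 (zz2_brk hK ha hv)) y hy
      clear hyd hy
      induction hsp using Submodule.span_induction with
      | mem z hz =>
        obtain ⟨hz, μ, hμ⟩ := hz
        by_cases h : μ = 0
        · exact ⟨z, hz, by rw [h, zero_smul, sub_eq_zero] at hμ; exact hμ, 0, (uu K).zero_mem, by simp⟩
        · refine ⟨0, (zz2 K).zero_mem, Commute.zero_right _, z, ?_, by simp⟩
          have := (uu K).smul_mem μ⁻¹ (zz2_brk hK ha hz)
          rwa [hμ, smul_smul, inv_mul_cancel₀ h, one_smul] at this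
      | zero => exact ⟨0, (zz2 K).zero_mem, Commute.zero_right _, 0, (uu K).zero_mem, by simp⟩
      | add p q _ _ hp hq =>
        obtain ⟨z, hz, hc, u, hu, rfl⟩ := hp
        obtain ⟨z', hz', hc', u', hu', rfl⟩ := hq
        exact ⟨z + z', (zz2 K).add_mem hz hz', hc.add_right hc', u + u', (uu K).add_mem hu hu', by abel⟩
      | smul c p _ hp =>
        obtain ⟨z, hz, hc, u, hu, rfl⟩ := hp
        exact ⟨c • z, (zz2 K).smul_mem c hz, hc.smul_right c, c • u, (uu K).smul_mem c hu, by simp⟩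
    obtain ⟨z0, hz0, hc0, u, hu, hyz⟩ := hdec
    obtain ⟨s, N, hxs, hs, hN, hc⟩ := jordan z0
    have hsz := zz2_jordan hK hxs hs hN (hc z0 rfl) hz0
    obtain ⟨b, hb, hsb⟩ := claimM s hsz.1 hs (hc _ hc0)
    have hNu : N ∈ uu K := by
      intro f hf
      have hsp := D_eig_span hyd (Ak K) (fun v hv => hy.1 v hv) f hf
      clear hf
      induction hsp using Submodule.span_induction with
      | mem f hf =>
        obtain ⟨hf, μ, hμ⟩ := hf
        have hz : D z0 f = μ • f := by
          rw [← hμ, hyz, D_add, Derivation.add_apply, hu f hf, add_zero]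
        have := (D_jordan hxs hs hN (hc z0 rfl) (Submodule.span k {f}) (Submodule.span k {f}) le_rfl ?_).2 f
          (Submodule.mem_span_singleton_self f)
        · obtain ⟨ν, hν⟩ := Submodule.mem_span_singleton.1 this
          obtain ⟨m, hm⟩ := D_nil hN f
          have hp : ∀ m : ℕ, (Dl N ^ m) f = ν ^ m • f := by
            intro m
            induction m with
            | zero => simp
            | succ m ih => rw [pow_succ', Module.End.mul_apply, ih, map_smul, Dl_apply, ← hν, smul_smul, pow_succ]
          rw [hp] at hm
          rcases smul_eq_zero.1 hm with h | h
          · rw [← hν, eq_zero_of_pow_eq_zero h, zero_smul]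
          · rw [h, map_zero]
        · intro w hw
          obtain ⟨d, rfl⟩ := Submodule.mem_span_singleton.1 hw
          rw [Derivation.map_smul, hz]
          exact Submodule.smul_mem _ _ (Submodule.smul_mem _ _ (Submodule.mem_span_singleton_self f))
      | zero => simp
      | add p q _ _ hp hq => rw [map_add, hp, hq, add_zero]
      | smul c p _ hp => rw [Derivation.map_smul, hp, smul_zero]
    exact ⟨b, hb, N + u, (uu K).add_mem hNu hu, by rw [hyz, hxs, hsb]; abel⟩
end tor
end EF

namespace EF
section param
variable {n : ℕ} {k : Type*} [Field k] [CharZero k]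

/-- cast of an integer vector -/
def zc (v : Fin n → ℤ) : Fin n → k := fun i => (v i : k)

lemma elim_step (C : Set (Fin n → ℤ)) (hC : ∀ c ∈ C, ∀ i, |c i| ≤ 4) (W : Submodule k (Fin n → k))
    (hW : ∀ b, b ∈ W ↔ ∀ c ∈ C, ∑ i, (c i : k) * b i = 0) (r : ℕ) :
    ∀ (B : Fin n → Fin n → ℤ) (β : ℕ), (∀ i j, |B i j| ≤ β) → 1 ≤ β →
      (W ≤ Submodule.span k (Set.range fun j => (zc (B j) : Fin n → k))) →
      Module.finrank k (Submodule.span k (Set.range fun j => (zc (B j) : Fin n → k))) ≤ r →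
      ∃ B' : Fin n → Fin n → ℤ, (∀ i j, 8 * n * |B' i j| ≤ (8 * n * β) ^ (2 ^ r)) ∧
        W = Submodule.span k (Set.range fun j => (zc (B' j) : Fin n → k)) := by
  induction r with
  | zero =>
    intro B β hB hβ hWB hr
    refine ⟨B, ?_, ?_⟩
    · intro i j
      have := hB i j
      simp only [pow_zero, pow_one]
      gcongr
    · have : Submodule.span k (Set.range fun j => (zc (B j) : Fin n → k)) = ⊥ :=
        Submodule.finrank_eq_zero.1 (by omega)
      rw [this] at hWB ⊢
      exact le_bot_iff.1 hWB
  | succ r ih =>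
    intro B β hB hβ hWB hr
    by_cases hdone : ∀ j, (zc (B j) : Fin n → k) ∈ W
    · refine ⟨B, ?_, le_antisymm hWB (Submodule.span_le.2 ?_)⟩
      · intro i j
        have hn : 1 ≤ n := by have := i.2; omega
        calc (8 * n * |B i j| : ℤ) ≤ 8 * n * β := by have := hB i j; gcongr
          _ ≤ (8 * n * β) ^ (2 ^ (r+1)) := by
            apply le_self_pow₀
            · have : 1 ≤ n * β := Nat.one_le_iff_ne_zero.2 (by positivity)
              have : (1:ℤ) ≤ n * β := by exact_mod_cast this
              nlinarith
            · positivity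
      · rintro _ ⟨j, rfl⟩; exact hdone j
    · push Not at hdone
      obtain ⟨j, hj⟩ := hdone
      rw [hW] at hj
      push Not at hj
      obtain ⟨c, hc, hcj⟩ := hj
      let v : Fin n → ℤ := fun l => ∑ i, c i * B l i
      have hvk : ∀ l, ((v l : ℤ) : k) = ∑ i, (c i : k) * (zc (B l) : Fin n → k) i := by
        intro l; simp [v, zc]
      have hvj : v j ≠ 0 := by
        intro h; apply hcj; rw [← hvk, h]; simp
      have hn : 1 ≤ n := by have := j.2; omega
      let B1 : Fin n → Fin n → ℤ := fun l i => v j * B l i - v l * B j i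
      have hB1k : ∀ l, (zc (B1 l) : Fin n → k) = (v j : k) • zc (B l) - (v l : k) • zc (B j) := by
        intro l; funext i; simp [B1, zc]
      have hv : ∀ l, |v l| ≤ 4 * n * β := by
        intro l
        calc |v l| ≤ ∑ i, |c i * B l i| := Finset.abs_sum_le_sum_abs _ _
          _ ≤ ∑ i : Fin n, (4 * β : ℤ) := by
            apply Finset.sum_le_sum; intro i _
            rw [abs_mul]
            have := hC c hc i; have := hB l i
            gcongr
          _ = _ := by simp; ring
      have hB1 : ∀ i l, |B1 i l| ≤ ((8 * n * β * β : ℕ) : ℤ) := by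
        intro i l
        calc |B1 i l| ≤ |v j * B i l| + |v i * B j l| := abs_sub _ _
          _ ≤ 4 * n * β * β + 4 * n * β * β := by
            rw [abs_mul, abs_mul]
            have := hv j; have := hv i; have := hB i l; have := hB j l
            gcongr
          _ = _ := by push_cast; ring
      have hkill : ∀ l, ∑ i, (c i : k) * (zc (B1 l) : Fin n → k) i = 0 := by
        intro l
        rw [hB1k]
        simp only [Pi.sub_apply, Pi.smul_apply, smul_eq_mul, mul_sub, Finset.sum_sub_distrib]
        have e : ∀ (x : k) l, ∑ i, (c i : k) * (x * (zc (B l) : Fin n → k) i) = x * v l := by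
          intro x l; rw [hvk, Finset.mul_sum]; exact Finset.sum_congr rfl fun i _ => by ring
        rw [e, e]; ring
      let cl : (Fin n → k) →ₗ[k] k := ∑ i, (c i : k) • LinearMap.proj i
      have hcl : ∀ w, cl w = ∑ i, (c i : k) * w i := by intro w; simp [cl]
      have hsub : W ≤ Submodule.span k (Set.range fun j => (zc (B1 j) : Fin n → k)) := by
        intro w hw
        have hw' := hWB hw
        have hcw := (hW w).1 hw c hc
        rw [Submodule.mem_span_range_iff_exists_fun] at hw' ⊢
        obtain ⟨x, rfl⟩ := hw'
        have hvx : ∑ l, x l * (v l : k) = 0 := by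
          rw [← hcl, map_sum] at hcw
          rw [← hcw]
          refine Finset.sum_congr rfl fun l _ => ?_
          rw [map_smul, hcl, ← hvk, smul_eq_mul]
        have hvjk : (v j : k) ≠ 0 := by exact_mod_cast hvj
        refine ⟨fun l => (v j : k)⁻¹ * x l, ?_⟩
        have : ∀ l, ((v j : k)⁻¹ * x l) • (zc (B1 l) : Fin n → k) = x l • zc (B l) -
            (x l * v l) • ((v j : k)⁻¹ • zc (B j)) := by
          intro l
          rw [hB1k, smul_sub, smul_smul, smul_smul, smul_smul]
          congr 2
          · field_simp
          · ring
        rw [Finset.sum_congr rfl fun l _ => this l, Finset.sum_sub_distrib, ← Finset.sum_smul, hvx]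
        simp
      have hrk : Module.finrank k (Submodule.span k (Set.range fun j => (zc (B1 j) : Fin n → k))) ≤ r := by
        have hlt : Submodule.span k (Set.range fun j => (zc (B1 j) : Fin n → k)) <
            Submodule.span k (Set.range fun j => (zc (B j) : Fin n → k)) := by
          apply lt_of_le_of_ne
          · rw [Submodule.span_le]
            rintro _ ⟨l, rfl⟩
            simp only [hB1k]
            exact Submodule.sub_mem _ (Submodule.smul_mem _ _ (Submodule.subset_span ⟨l, rfl⟩))
              (Submodule.smul_mem _ _ (Submodule.subset_span ⟨j, rfl⟩))
          · intro heq
            have hle : Submodule.span k (Set.range fun j => (zc (B1 j) : Fin n → k)) ≤ LinearMap.ker cl := by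
              rw [Submodule.span_le]
              rintro _ ⟨l, rfl⟩
              simp only [SetLike.mem_coe, LinearMap.mem_ker, hcl]
              exact hkill l
            rw [heq] at hle
            have := hle (Submodule.subset_span ⟨j, rfl⟩)
            rw [LinearMap.mem_ker, hcl] at this
            exact hcj this
        have := Submodule.finrank_lt_finrank_of_lt hlt
        omega
      obtain ⟨B', h1, h2⟩ := ih B1 (8 * n * β * β) hB1 (by
          have : 1 ≤ n * β * β := Nat.one_le_iff_ne_zero.2 (by positivity)
          nlinarith) hsub hrk
      refine ⟨B', fun i l => ?_, h2⟩
      refine (h1 i l).trans (le_of_eq ?_)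
      push_cast
      rw [pow_succ' 2 r, pow_mul]
      congr 1; ring

/-- bound for integer parametrizations -/
def pbd (n : ℕ) : ℕ := 2 * (8 * n) ^ (2 ^ n)

lemma int_param (a : Fin n → k) : ∃ Λ : Fin n → Fin (n+1) → ℕ,
    (∀ i j, Λ i j ≤ pbd n) ∧ (∀ j, (fun i => (Λ i j : k)) ∈ Bs a) ∧
    ∀ b ∈ Bs a, ∃ x : Fin (n+1) → k, ∀ i, b i = ∑ j, Λ i j * x j := by
  classical
  rcases Nat.eq_zero_or_pos n with rfl | hn
  · exact ⟨fun i => i.elim0, fun i => i.elim0, fun j i => i.elim0, fun b _ => ⟨0, fun i => i.elim0⟩⟩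
  let cc : Fin n → Fin n → Fin n → Fin n → Fin n → ℤ := fun i j l m =>
    Pi.single i 1 - Pi.single j 1 - Pi.single l 1 + Pi.single m 1
  let C : Set (Fin n → ℤ) := {c | ∃ i j l m, a i - a j = a l - a m ∧ c = cc i j l m}
  have hs : ∀ i t : Fin n, |(Pi.single i 1 : Fin n → ℤ) t| ≤ 1 := by
    intro i t; rw [Pi.single_apply]; split_ifs <;> simp
  obtain ⟨B, h1, h2⟩ := elim_step C (by
    rintro c ⟨i, j, l, m, -, rfl⟩ t
    simp only [cc, Pi.add_apply, Pi.sub_apply]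
    have h1 := abs_le.1 (hs i t); have h2 := abs_le.1 (hs j t); have h3 := abs_le.1 (hs l t); have h4 := abs_le.1 (hs m t)
    rw [abs_le]; omega) (Bs a) (by
    have e : ∀ (b : Fin n → k) i j l m, ∑ t, ((cc i j l m t : ℤ) : k) * b t = b i - b j - b l + b m := by
      intro b i j l m
      simp only [cc, Pi.add_apply, Pi.sub_apply, Pi.single_apply]
      push_cast
      simp [add_mul, sub_mul, Finset.sum_add_distrib, Finset.sum_sub_distrib]
    intro b
    constructor
    · rintro hb _ ⟨i, j, l, m, h, rfl⟩
      rw [e]; have := hb i j l m h; linear_combination this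
    · intro hb i j l m h
      have := hb _ ⟨i, j, l, m, h, rfl⟩
      rw [e] at this; linear_combination this) n (fun j => Pi.single j 1) 1 (by
      intro i j; simpa using hs i j) le_rfl (by
      intro b _
      rw [Submodule.mem_span_range_iff_exists_fun]
      refine ⟨b, ?_⟩
      funext t
      simp [zc, Pi.single_apply]) (by
      refine (Submodule.finrank_le _).trans ?_
      simp)
  have hβ : ∀ i j, |B i j| ≤ (((8 * n) ^ (2 ^ n) : ℕ) : ℤ) := by
    intro i j
    have := h1 i j
    have h0 : 0 ≤ |B i j| := abs_nonneg _
    have hn' : (1:ℤ) ≤ n := by exact_mod_cast hn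
    calc |B i j| ≤ 8 * n * |B i j| := by nlinarith
      _ ≤ _ := by push_cast; simpa using this
  set β : ℕ := (8 * n) ^ (2 ^ n) with hβd
  have hone : (fun _ => (1:k)) ∈ Bs a := by intro i j l m _; simp
  have hcast : ∀ i j, (((B j i + β).toNat : ℕ) : k) = (B j i : k) + β := by
    intro i j
    have h0 : 0 ≤ B j i + β := by have := (abs_le.1 (hβ j i)).1; omega
    have : (((B j i + β).toNat : ℕ) : ℤ) = B j i + β := Int.toNat_of_nonneg h0
    have := congrArg (Int.cast : ℤ → k) this
    push_cast at this
    exact this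
  refine ⟨fun i => Fin.snoc (fun j => (B j i + β).toNat) 1, ?_, ?_, ?_⟩
  · intro i j
    have hβ1 : 1 ≤ β := Nat.one_le_pow _ _ (by omega)
    refine Fin.lastCases ?_ (fun j => ?_) j
    · simp only [Fin.snoc_last, pbd]; omega
    · simp only [Fin.snoc_castSucc, pbd]
      have := (abs_le.1 (hβ j i)).2; omega
  · intro j
    refine Fin.lastCases ?_ (fun j => ?_) j
    · simpa using hone
    · simp only [Fin.snoc_castSucc, hcast]
      have hB : (zc (B j) : Fin n → k) ∈ Bs a := by rw [h2]; exact Submodule.subset_span ⟨j, rfl⟩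
      have := (Bs a).add_mem hB ((Bs a).smul_mem (β : k) hone)
      convert this using 1
      funext i; simp [zc]
  · intro b hb
    rw [h2, Submodule.mem_span_range_iff_exists_fun] at hb
    obtain ⟨x, rfl⟩ := hb
    refine ⟨Fin.snoc x (-(β : k) * ∑ j, x j), fun i => ?_⟩
    rw [Fin.sum_univ_castSucc]
    simp only [Fin.snoc_castSucc, Fin.snoc_last, hcast, Finset.sum_apply, Pi.smul_apply, zc, smul_eq_mul]
    simp only [add_mul, Finset.sum_add_distrib, ← Finset.mul_sum]
    push_cast
    rw [Finset.sum_congr rfl fun j _ => mul_comm (x j) _]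
    ring
end param
end EF

namespace EF
section m1
variable {n : ℕ} {k : Type*} [Field k] [IsAlgClosed k] [CharZero k] {K : Subgroup (GL (Fin n) k)}

/-- semisimple part of `zz2` -/
def mm (K : Subgroup (GL (Fin n) k)) : Set (Mt n k) := {y | y ∈ zz2 K ∧ Dg y}

/-- weight spaces of `Ak` -/
noncomputable def Aw (K : Subgroup (GL (Fin n) k)) (χ : Mt n k → k) : Submodule k (Pn n k) where
  carrier := {f | f ∈ Ak K ∧ ∀ y ∈ mm K, D y f = χ y • f}
  add_mem' := by
    rintro f g ⟨hf, hf'⟩ ⟨hg, hg'⟩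
    refine ⟨(Ak K).add_mem hf hg, fun y hy => ?_⟩
    rw [map_add, hf' y hy, hg' y hy, smul_add]
  zero_mem' := ⟨(Ak K).zero_mem, fun y hy => by simp⟩
  smul_mem' := by
    rintro c f ⟨hf, hf'⟩
    refine ⟨(Ak K).smul_mem c hf, fun y hy => ?_⟩
    rw [Derivation.map_smul, hf' y hy, smul_comm]

lemma mem_Aw {χ : Mt n k → k} {f : Pn n k} : f ∈ Aw K χ ↔ f ∈ Ak K ∧ ∀ y ∈ mm K, D y f = χ y • f := Iff.rfl

/-- line argument -/
lemma line_nil {x s N : Mt n k} (hx : x = s + N) (hs : Dg s) (hN : IsNilpotent N)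
    (hc : Commute x s) {f : Pn n k} {μ : k} (hf : D x f = μ • f) : D N f = 0 := by
  have := (D_jordan hx hs hN hc (Submodule.span k {f}) (Submodule.span k {f}) le_rfl ?_).2 f
    (Submodule.mem_span_singleton_self f)
  · obtain ⟨ν, hν⟩ := Submodule.mem_span_singleton.1 this
    obtain ⟨m, hm⟩ := D_nil hN f
    have hp : ∀ m : ℕ, (Dl N ^ m) f = ν ^ m • f := by
      intro m
      induction m with
      | zero => simp
      | succ m ih => rw [pow_succ', Module.End.mul_apply, ih, map_smul, Dl_apply, ← hν, smul_smul, pow_succ]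
    rw [hp] at hm
    rcases smul_eq_zero.1 hm with h | h
    · rw [← hν, eq_zero_of_pow_eq_zero h, zero_smul]
    · rw [h, map_zero]
  · intro w hw
    obtain ⟨d, rfl⟩ := Submodule.mem_span_singleton.1 hw
    rw [Derivation.map_smul, hf]
    exact Submodule.smul_mem _ _ (Submodule.smul_mem _ _ (Submodule.mem_span_singleton_self f))

lemma qd_comm (Q : GL (Fin n) k) (a b : Fin n → k) : Commute (qd Q a) (qd Q b) := by
  rw [commute_iff_eq, qd, qd, conj_mul_conj, conj_mul_conj]
  congr 2
  rw [diagonal_mul_diagonal, diagonal_mul_diagonal]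
  simp only [mul_comm]

lemma D_swap {x y : Mt n k} (h : Commute x y) (f : Pn n k) : D x (D y f) = D y (D x f) := by
  have := D_comm_apply x y f
  rw [h.eq, sub_self, D_zero] at this
  exact (sub_eq_zero.mp this.symm)

lemma qd_sum {m : ℕ} (Q : GL (Fin n) k) (b : Fin n → k) (x : Fin m → k) (l : Fin m → Fin n → k)
    (h : ∀ i, b i = ∑ j, l j i * x j) : qd Q b = ∑ j, x j • qd Q (l j) := by
  have : diagonal b = ∑ j, x j • diagonal (l j) := by
    ext i i'
    rw [Matrix.sum_apply]
    by_cases hi : i = i'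
    · subst hi; simp [h, mul_comm]
    · simp [hi]
  rw [qd, this, Matrix.mul_sum, Matrix.sum_mul]
  simp [qd]

/-- the data of a maximal torus and its integral parametrization -/
structure Tor (K : Subgroup (GL (Fin n) k)) where
  Q : GL (Fin n) k
  Λ : Fin n → Fin (n+1) → ℕ
  bd : ∀ i j, Λ i j ≤ pbd n
  mem : ∀ j, qd Q (fun i => (Λ i j : k)) ∈ zz2 K
  dec : ∀ y ∈ mm K, ∃ x : Fin (n+1) → k, ∃ u ∈ uu K, y = ∑ j, x j • qd Q (fun i => (Λ i j : k)) + u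

lemma exists_Tor (hK : Clo K) : Nonempty (Tor K) := by
  obtain ⟨Q, a, h1, h2⟩ := exists_torus hK
  obtain ⟨Λ, hb, hm, hs⟩ := int_param a
  refine ⟨⟨Q, Λ, hb, fun j => h1 _ (hm j), ?_⟩⟩
  rintro y ⟨hy, hyd⟩
  obtain ⟨b, hb, u, hu, rfl⟩ := h2 y hy hyd
  obtain ⟨x, hx⟩ := hs b hb
  exact ⟨x, u, hu, by rw [qd_sum Q b x (fun j i => (Λ i j : k)) hx]⟩



/-- generators of the torus -/
noncomputable def Tor.y (T : Tor K) (j : Fin (n+1)) : Mt n k := qd T.Q (fun i => (T.Λ i j : k))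

lemma Tor.y_mm (T : Tor K) (j) : T.y j ∈ mm K := ⟨T.mem j, qd_Dg _ _⟩

lemma Tor.dec' (T : Tor K) {y : Mt n k} (hy : y ∈ mm K) : ∃ x : Fin (n+1) → k, ∃ u ∈ uu K, y = ∑ j, x j • T.y j + u :=
  T.dec y hy

lemma Ak_span (T : Tor K) (f : Pn n k) (hf : f ∈ Ak K) :
    f ∈ Submodule.span k {g | ∃ χ, g ∈ Aw K χ} := by
  classical
  have key : ∀ S : Finset (Fin (n+1)), f ∈ Submodule.span k
      {g | g ∈ Ak K ∧ ∃ χ : Fin (n+1) → k, ∀ j ∈ S, D (T.y j) g = χ j • g} := by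
    intro S
    induction S using Finset.induction_on with
    | empty => exact Submodule.subset_span ⟨hf, 0, by simp⟩
    | insert j S hj ih =>
      refine Submodule.span_le.2 ?_ ih
      rintro g ⟨hg, χ, hχ⟩
      let P : Submodule k (Pn n k) :=
        { carrier := {g | g ∈ Ak K ∧ ∀ j ∈ S, D (T.y j) g = χ j • g}
          add_mem' := by
            rintro f g ⟨hf, hf'⟩ ⟨hg, hg'⟩
            refine ⟨(Ak K).add_mem hf hg, fun y hy => ?_⟩
            rw [map_add, hf' y hy, hg' y hy, smul_add]
          zero_mem' := ⟨(Ak K).zero_mem, fun y hy => by simp⟩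
          smul_mem' := by
            rintro c f ⟨hf, hf'⟩
            refine ⟨(Ak K).smul_mem c hf, fun y hy => ?_⟩
            rw [Derivation.map_smul, hf' y hy, smul_comm] }
      have hP : ∀ v ∈ P, D (T.y j) v ∈ P := by
        rintro v ⟨hv, hv'⟩
        refine ⟨(T.mem j).1 v hv, fun i hi => ?_⟩
        rw [D_swap (x := T.y i) (y := T.y j) (qd_comm _ _ _), hv' i hi, Derivation.map_smul]
      have hgP : g ∈ P := ⟨hg, hχ⟩
      refine Submodule.span_mono ?_ (D_eig_span (T.y_mm j).2 P hP g hgP)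
      rintro v ⟨hv, μ, hμ⟩
      refine ⟨hv.1, Function.update χ j μ, fun i hi => ?_⟩
      rcases Finset.mem_insert.1 hi with rfl | hi'
      · simpa using hμ
      · have : i ≠ j := fun h => hj (h ▸ hi')
        rw [Function.update_of_ne this]; exact hv.2 i hi'
  refine Submodule.span_mono ?_ (key Finset.univ)
  rintro g ⟨hg, χ, hχ⟩
  have hex : ∀ y ∈ mm K, ∃ c : k, D y g = c • g := by
    intro y hy
    obtain ⟨x, u, hu, rfl⟩ := T.dec' hy
    refine ⟨∑ j, x j * χ j, ?_⟩
    rw [D_add, Derivation.add_apply, hu g hg, add_zero, D_sum]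
    have : ∀ j, D (x j • T.y j) g = (x j * χ j) • g := by
      intro j; rw [D_smul, Derivation.smul_apply, hχ j (Finset.mem_univ j), smul_smul]
    rw [Finset.sum_smul]
    rw [← Finset.sum_congr rfl fun j _ => this j]
  refine ⟨fun y => if h : ∃ c : k, D y g = c • g then h.choose else 0, hg, fun y hy => ?_⟩
  simp only [hex y hy, dite_true]
  exact (hex y hy).choose_spec

/-- a linear statement about `Ak` can be checked on weight vectors -/
lemma Ak_ind (T : Tor K) (P : Submodule k (Pn n k)) (h : ∀ χ, ∀ f ∈ Aw K χ, f ∈ P) : Ak K ≤ P := by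
  intro f hf
  refine Submodule.span_le.2 ?_ (Ak_span T f hf)
  rintro g ⟨χ, hg⟩; exact h χ g hg

lemma mem_uu_of_Aw (T : Tor K) {y : Mt n k} (h : ∀ χ, ∀ f ∈ Aw K χ, D y f = 0) : y ∈ uu K :=
  fun f hf => Ak_ind T (LinearMap.ker (Dl y)) (fun χ f hf => h χ f hf) hf

lemma mem_nn_of_Aw (T : Tor K) {y : Mt n k} (h : ∀ χ, ∀ f ∈ Aw K χ, D y f ∈ Ak K) : y ∈ nn K :=
  fun f hf => Ak_ind T ((Ak K).comap (Dl y)) (fun χ f hf => h χ f hf) hf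

lemma Rt_inj (g : GL (Fin n) k) {f : Pn n k} (h : Rt (g : Mt n k) f = 0) : f = 0 := by
  have e : ((g⁻¹ : GL (Fin n) k) : Mt n k) * (g : Mt n k) = 1 := by rw [← Units.val_mul]; simp
  have := congrArg (Rt ((g⁻¹ : GL (Fin n) k) : Mt n k)) h
  rwa [Rt_Rt, e, Rt_one, map_zero] at this

/-- the group acting by scalars on the weight spaces -/
def M1 (K : Subgroup (GL (Fin n) k)) : Subgroup (GL (Fin n) k) where
  carrier := {g | ∀ χ, ∃ c : k, ∀ f ∈ Aw K χ, Rt (g : Mt n k) f = c • f}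
  mul_mem' := by
    intro g h hg hh χ
    obtain ⟨c, hc⟩ := hg χ
    obtain ⟨d, hd⟩ := hh χ
    refine ⟨d * c, fun f hf => ?_⟩
    rw [Units.val_mul, ← Rt_Rt, hd f hf, map_smul, hc f hf, smul_smul]
  one_mem' := fun χ => ⟨1, fun f _ => by simp [Rt_one]⟩
  inv_mem' := by
    intro g hg χ
    obtain ⟨c, hc⟩ := hg χ
    refine ⟨c⁻¹, fun f hf => ?_⟩
    have e : ((g⁻¹ : GL (Fin n) k) : Mt n k) * (g : Mt n k) = 1 := by rw [← Units.val_mul]; simp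
    by_cases h0 : c = 0
    · have := hc f hf
      rw [h0, zero_smul] at this
      rw [Rt_inj g this]; simp
    · have h1 : Rt ((g⁻¹ : GL (Fin n) k) : Mt n k) (Rt (g : Mt n k) f) = f := by rw [Rt_Rt, e, Rt_one]
      rw [hc f hf, map_smul] at h1
      rw [← h1, smul_smul, inv_mul_cancel₀ h0, one_smul, h1]

lemma mem_M1 {g : GL (Fin n) k} : g ∈ M1 K ↔ ∀ χ, ∃ c : k, ∀ f ∈ Aw K χ, Rt (g : Mt n k) f = c • f := Iff.rfl

/-- the equations of `M1` -/
lemma M1_eqn {χ : Mt n k → k} {f f' : Pn n k} (hf : f ∈ Aw K χ) (hf' : f' ∈ Aw K χ) (p p' : Mt n k) :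
    (ev p' f') • Lt p f - (ev p f) • Lt p' f' ∈ IK (M1 K) := by
  intro g hg
  obtain ⟨c, hc⟩ := hg χ
  have h1 : ev (p * (g : Mt n k)) f = c * ev p f := by
    have := congrArg (ev p) (hc f hf)
    rwa [ev_Rt, map_smul, smul_eq_mul, cm_self] at this
  have h2 : ev (p' * (g : Mt n k)) f' = c * ev p' f' := by
    have := congrArg (ev p') (hc f' hf')
    rwa [ev_Rt, map_smul, smul_eq_mul, cm_self] at this
  rw [map_sub, map_smul, map_smul, ev_Lt, ev_Lt, cm_self, cm_self, h1, h2]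
  simp only [smul_eq_mul]; ring

lemma M1_clo : Clo (M1 K) := by
  intro g hg χ
  by_cases h : ∃ f' ∈ Aw K χ, ∃ p', ev (p' : Mt n k) f' ≠ 0
  · obtain ⟨f', hf', p', hp'⟩ := h
    refine ⟨ev (p' * (g : Mt n k)) f' / ev p' f', fun f hf => ?_⟩
    apply poly_ext
    intro p
    have := hg _ (M1_eqn hf hf' p p')
    rw [map_sub, map_smul, map_smul, ev_Lt, ev_Lt, cm_self, cm_self] at this
    simp only [smul_eq_mul] at this
    rw [ev_Rt, map_smul, cm_self, smul_eq_mul]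
    field_simp
    linear_combination this
  · push Not at h
    refine ⟨0, fun f hf => ?_⟩
    have : f = 0 := poly_ext fun p => by rw [h f hf p, map_zero]
    rw [this]; simp

lemma M1_Lie_scalar {x : Mt n k} (hx : x ∈ Lie (M1 K)) (χ : Mt n k → k) :
    ∃ c : k, ∀ f ∈ Aw K χ, D x f = c • f := by
  by_cases h : ∃ f' ∈ Aw K χ, ∃ p', ev (p' : Mt n k) f' ≠ 0
  · obtain ⟨f', hf', p', hp'⟩ := h
    refine ⟨ev p' (D x f') / ev p' f', fun f hf => ?_⟩
    apply poly_ext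
    intro p
    have := mem_Lie_iff.1 hx _ (M1_eqn hf hf' p p')
    rw [map_sub, map_sub, Derivation.map_smul, Derivation.map_smul, D_Lt, D_Lt, map_smul, map_smul,
      ev_Lt, ev_Lt, cm_self, cm_self, mul_one, mul_one] at this
    simp only [smul_eq_mul] at this
    rw [map_smul, smul_eq_mul]
    field_simp
    linear_combination this
  · push Not at h
    refine ⟨0, fun f hf => ?_⟩
    have : f = 0 := poly_ext fun p => by rw [h f hf p, map_zero]
    rw [this]; simp

/-- abstract span of torus and `uu` -/
lemma dec_of_parts (T : Tor K) (hK : Clo K) {x : Mt n k} (hx : x ∈ zz2 K)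
    (h : ∀ χ, ∃ c : k, ∀ f ∈ Aw K χ, D x f = c • f) :
    ∃ c : Fin (n+1) → k, ∃ u ∈ uu K, x = ∑ j, c j • T.y j + u := by
  obtain ⟨s, N, hxs, hs, hN, hc⟩ := jordan x
  have hsz := zz2_jordan hK hxs hs hN (hc x rfl) hx
  obtain ⟨c, u, hu, hsu⟩ := T.dec' (y := s) ⟨hsz.1, hs⟩
  have hNu : N ∈ uu K := by
    apply mem_uu_of_Aw T
    intro χ f hf
    obtain ⟨μ, hμ⟩ := h χ
    exact line_nil hxs hs hN (hc x rfl) (hμ f hf)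
  exact ⟨c, u + N, (uu K).add_mem hu hNu, by rw [hxs, hsu, add_assoc]⟩

lemma M1_Lie_dec (T : Tor K) (hK : Clo K) {x : Mt n k} (hx : x ∈ Lie (M1 K)) :
    ∃ c : Fin (n+1) → k, ∃ u ∈ uu K, x = ∑ j, c j • T.y j + u := by
  have hsc := M1_Lie_scalar hx
  refine dec_of_parts T hK ⟨?_, ?_⟩ hsc
  · apply mem_nn_of_Aw T
    intro χ f hf
    obtain ⟨c, hc⟩ := hsc χ
    rw [hc f hf]; exact (Ak K).smul_mem _ hf.1
  · intro z hz
    apply mem_uu_of_Aw T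
    intro χ f hf
    have hzf : D z f ∈ Aw K χ := by
      refine ⟨hz.1 f hf.1, fun y hy => ?_⟩
      have := hy.1.2 z hz f hf.1
      rw [D_comm_apply, hf.2 y hy, Derivation.map_smul, sub_eq_zero] at this
      exact this
    obtain ⟨c, hc⟩ := hsc χ
    rw [D_comm_apply, hc _ hzf, hc f hf, Derivation.map_smul, sub_self]

lemma Lie_dec (T : Tor K) (hK : Clo K) {x : Mt n k} (hx : x ∈ Lie K) :
    ∃ c : Fin (n+1) → k, ∃ u ∈ uu K, x = ∑ j, c j • T.y j + u := by
  obtain ⟨s, N, hxs, hs, hN, hc⟩ := jordan x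
  have hJ := Lie_jordan hxs hs hN (hc x rfl) hx
  obtain ⟨c, u, hu, hsu⟩ := T.dec' (y := s) ⟨Lie_zz2 hK hJ.1, hs⟩
  exact ⟨c, u + N, (uu K).add_mem hu (Sn_uu ⟨hJ.2, hN⟩), by rw [hxs, hsu, add_assoc]⟩

lemma M1_norm {h g : GL (Fin n) k} (hh : h ∈ K) (hg : g ∈ M1 K) : h * g * h⁻¹ ∈ M1 K := by
  intro χ
  let χ' : Mt n k → k := fun y => χ ((h : Mt n k) * y * ((h⁻¹ : GL (Fin n) k) : Mt n k))
  obtain ⟨c, hc⟩ := hg χ'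
  refine ⟨c, fun f hf => ?_⟩
  have e : ((h⁻¹ : GL (Fin n) k) : Mt n k) * (h : Mt n k) = 1 := by rw [← Units.val_mul]; simp
  have e' : (h : Mt n k) * ((h⁻¹ : GL (Fin n) k) : Mt n k) = 1 := by rw [← Units.val_mul]; simp
  have h1 : Rt ((h⁻¹ : GL (Fin n) k) : Mt n k) f ∈ Aw K χ' := by
    refine ⟨Ak_Rt (K.inv_mem hh) hf.1, fun y hy => ?_⟩
    rw [D_Rt y _ (h : Mt n k) e, hf.2 _ ⟨AdSt_zz2 h hh y hy.1, hy.2.conj h⟩, map_smul]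
  rw [Units.val_mul, Units.val_mul, ← Rt_Rt, ← Rt_Rt, hc _ h1, map_smul, Rt_Rt, e', Rt_one]

lemma exp_M1 {N : Mt n k} (hN : N ∈ Sn K) (r : k) : expG r N hN.2 ∈ M1 K := by
  intro χ
  refine ⟨1, fun f hf => ?_⟩
  apply poly_ext
  intro p
  rw [ev_Rt, one_smul, cm_self, expG_val, ev_exp_of_D_zero p hN.2 f (mem_Ak.1 hf.1 N hN)]
end m1
end EF

namespace EF
section par
variable {n : ℕ} {k : Type*} [Field k] [IsAlgClosed k] [CharZero k] {K : Subgroup (GL (Fin n) k)}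

/-- monomial torus point -/
noncomputable def tmon (Λ : Fin n → Fin (n+1) → ℕ) {S : Type*} [CommRing S] (τ : Fin (n+1) → S) : Fin n → S :=
  fun i => ∏ j, τ j ^ Λ i j

noncomputable def Tm (T : Tor K) {S : Type*} [CommRing S] [Algebra k S] (τ : Fin (n+1) → S) : Mt n S :=
  cm S (T.Q : Mt n k) * diagonal (tmon T.Λ τ) * cm S ((T.Q⁻¹ : GL (Fin n) k) : Mt n k)

lemma Tm_map (T : Tor K) {S S' : Type*} [CommRing S] [Algebra k S] [CommRing S'] [Algebra k S']
    (ψ : S →ₐ[k] S') (τ : Fin (n+1) → S) : (Tm T τ).map ψ = Tm T (fun j => ψ (τ j)) := by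
  rw [Tm, map_mul', map_mul', cm_map, cm_map, Matrix.diagonal_map (map_zero ψ)]
  congr 3
  funext i; simp [tmon]

noncomputable def Ph (T : Tor K) (ν : ℕ → Mt n k) (r : ℕ) {S : Type*} [CommRing S] [Algebra k S]
    (s : ℕ → S) (τ : Fin (n+1) → S) : Mt n S := upr s ν r * Tm T τ

lemma Ph_map (T : Tor K) (ν : ℕ → Mt n k) (r : ℕ) {S S' : Type*} [CommRing S] [Algebra k S] [CommRing S'] [Algebra k S']
    (ψ : S →ₐ[k] S') (s : ℕ → S) (τ : Fin (n+1) → S) :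
    (Ph T ν r s τ).map ψ = Ph T ν r (fun i => ψ (s i)) (fun j => ψ (τ j)) := by
  rw [Ph, map_mul', upr_map, Tm_map]; rfl

/-- generic parameters -/
noncomputable def gs (k : Type*) [Field k] (n r : ℕ) : ℕ → MvPolynomial (Fin r ⊕ Fin (n+1)) k :=
  fun i => if h : i < r then X (Sum.inl ⟨i, h⟩) else 0
noncomputable def gt (k : Type*) [Field k] (n r : ℕ) : Fin (n+1) → MvPolynomial (Fin r ⊕ Fin (n+1)) k :=
  fun j => X (Sum.inr j)

noncomputable def PhR (T : Tor K) (ν : ℕ → Mt n k) (r : ℕ) : Mt n (MvPolynomial (Fin r ⊕ Fin (n+1)) k) :=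
  Ph T ν r (gs k n r) (gt k n r)

noncomputable def pp (T : Tor K) (ν : ℕ → Mt n k) (r : ℕ) : Ideal (Pn n k) :=
  RingHom.ker (ev (k := k) (PhR T ν r))

lemma mem_pp_iff {T : Tor K} {ν : ℕ → Mt n k} {r : ℕ} {f : Pn n k} : f ∈ pp T ν r ↔ ev (PhR T ν r) f = 0 :=
  RingHom.mem_ker

lemma eval_PhR (T : Tor K) (ν : ℕ → Mt n k) (r : ℕ) (s : ℕ → k) (τ : Fin (n+1) → k) (f : Pn n k) :
    eval (Sum.elim (fun i : Fin r => s i) τ) (ev (PhR T ν r) f) = ev (Ph T ν r s τ) f := by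
  have := map_ev (aeval (R := k) (Sum.elim (fun i : Fin r => s i) τ)) (PhR T ν r) f
  rw [PhR, Ph_map] at this
  have e0 : ∀ p, aeval (R := k) (Sum.elim (fun i : Fin r => s i) τ) p = eval (Sum.elim (fun i : Fin r => s i) τ) p := fun p => by
    rw [aeval_eq_eval]
  simp only [e0] at this
  rw [PhR]
  refine this.trans ?_
  have e1 : upr (fun i => (eval (Sum.elim (fun i : Fin r => s i) τ)) (gs k n r i)) ν r = upr s ν r := by
    apply upr_congr
    · intro i hi; simp [gs, hi]
    · intros; rfl
  have e2 : (fun j => (eval (Sum.elim (fun i : Fin r => s i) τ)) (gt k n r j)) = τ := by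
    funext j; simp [gt]
  rw [Ph, Ph, e1, e2]

lemma mem_pp {T : Tor K} {ν : ℕ → Mt n k} {r : ℕ} {f : Pn n k} (hf : f ∈ pp T ν r) (s : ℕ → k)
    (τ : Fin (n+1) → k) : ev (Ph T ν r s τ) f = 0 := by
  rw [← eval_PhR, mem_pp_iff.1 hf, map_zero]

lemma mem_pp_of {T : Tor K} {ν : ℕ → Mt n k} {r : ℕ} {f : Pn n k}
    (h : ∀ (s : ℕ → k) (τ : Fin (n+1) → k), (∀ j, τ j ≠ 0) → ev (Ph T ν r s τ) f = 0) : f ∈ pp T ν r := by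
  rw [mem_pp_iff]
  have hz : (∏ j, gt k n r j) * ev (PhR T ν r) f = 0 := by
    apply MvPolynomial.funext
    intro v
    rw [map_mul, map_prod, map_zero]
    by_cases hv : ∀ j, v (Sum.inr j) ≠ 0
    · have := h (fun i => if h : i < r then v (Sum.inl ⟨i, h⟩) else 0) (fun j => v (Sum.inr j)) hv
      rw [← eval_PhR] at this
      have e : (Sum.elim (fun i : Fin r => if h : (i : ℕ) < r then v (Sum.inl ⟨i, h⟩) else 0) (fun j => v (Sum.inr j))) = v := by
        funext x; rcases x with x | x <;> simp
      rw [e] at this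
      rw [this, mul_zero]
    · push Not at hv
      obtain ⟨j, hj⟩ := hv
      rw [Finset.prod_eq_zero (Finset.mem_univ j), zero_mul]
      simp [gt, hj]
  rcases mul_eq_zero.1 hz with h | h
  · rw [Finset.prod_eq_zero_iff] at h
    obtain ⟨j, _, hj⟩ := h
    exact absurd hj (X_ne_zero _)
  · exact h

/-- Euler derivation on parameter rings -/
lemma euler_Tm (T : Tor K) {S : Type*} [CommRing S] [Algebra k S] (τ : Fin (n+1) → S)
    (δ : Derivation k S S) (j : Fin (n+1)) (hδ : ∀ l, δ (τ l) = if l = j then τ l else 0) (i i') :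
    δ (Tm T τ i i') = (Tm T τ * cm S (T.y j)) i i' := by
  have h1 : ∀ i, δ (tmon T.Λ τ i) = (T.Λ i j : S) * tmon T.Λ τ i := by
    intro i
    have hs : ∀ s : Finset (Fin (n+1)), δ (∏ l ∈ s, τ l ^ T.Λ i l) =
        ((if j ∈ s then T.Λ i j else 0 : ℕ) : S) * ∏ l ∈ s, τ l ^ T.Λ i l := by
      intro s
      induction s using Finset.induction_on with
      | empty => simp
      | insert a s ha ih =>
        rw [Finset.prod_insert ha, Derivation.leibniz, ih, Derivation.leibniz_pow, hδ a]
        by_cases h : a = j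
        · subst h
          simp only [ha, if_true, if_false, Finset.mem_insert_self, smul_eq_mul, nsmul_eq_mul, Nat.cast_zero]
          rcases Nat.eq_zero_or_pos (T.Λ i a) with h | h
          · simp [h]
          · obtain ⟨m, hm⟩ := Nat.exists_eq_succ_of_ne_zero h.ne'
            rw [hm]
            simp only [Nat.succ_eq_add_one, Nat.add_sub_cancel]
            ring
        · have : (j ∈ insert a s) ↔ j ∈ s := by simp [Ne.symm h]
          simp only [h, this, if_false, smul_eq_mul, mul_zero, smul_zero, add_zero]
          ring
    have := hs Finset.univ
    rw [if_pos (Finset.mem_univ j)] at this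
    exact this
  have h2 : Tm T τ * cm S (T.y j) = cm S (T.Q : Mt n k) * diagonal (fun i => (T.Λ i j : S) * tmon T.Λ τ i)
      * cm S ((T.Q⁻¹ : GL (Fin n) k) : Mt n k) := by
    have e : ((T.Q⁻¹ : GL (Fin n) k) : Mt n k) * (T.Q : Mt n k) = 1 := by rw [← Units.val_mul]; simp
    rw [Tm, Tor.y, qd, cm_mul, cm_mul]
    have e2 : cm S (diagonal (fun i => (T.Λ i j : k))) = diagonal (fun i => (T.Λ i j : S)) := by
      rw [cm, Matrix.diagonal_map (map_zero _)]; congr 1; funext i; simp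
    rw [e2]
    have e3 : cm S ((T.Q⁻¹ : GL (Fin n) k) : Mt n k) * cm S (T.Q : Mt n k) = 1 := by
      rw [← cm_mul, e, cm_one]
    have e4 : diagonal (fun i => (T.Λ i j : S) * tmon T.Λ τ i) = diagonal (tmon T.Λ τ) * diagonal (fun i => (T.Λ i j : S)) := by
      rw [diagonal_mul_diagonal]; congr 1; funext i; ring
    rw [e4]
    generalize cm S ((T.Q⁻¹ : GL (Fin n) k) : Mt n k) = Q' at *
    generalize cm S (T.Q : Mt n k) = Q at *
    generalize diagonal (tmon T.Λ τ) = A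
    generalize diagonal (fun i => (T.Λ i j : S)) = B
    calc _ = Q * A * (Q' * Q) * B * Q' := by noncomm_ring
      _ = _ := by rw [e3]; noncomm_ring
  rw [h2, Tm]
  simp only [Matrix.mul_apply, Finset.sum_mul, map_sum, cm, Matrix.map_apply, Matrix.diagonal_apply]
  refine Finset.sum_congr rfl fun l _ => Finset.sum_congr rfl fun m _ => ?_
  simp only [Derivation.leibniz, Derivation.map_algebraMap, smul_zero, add_zero, zero_add]
  split_ifs with h
  · rw [h1]; simp only [smul_eq_mul]; ring
  · simp

/-- Euler derivation -/
noncomputable def euD (k : Type*) [Field k] {σ : Type*} (j : σ) : Derivation k (MvPolynomial σ k) (MvPolynomial σ k) :=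
  (X j : MvPolynomial σ k) • pderiv j

lemma euD_X {σ : Type*} [DecidableEq σ] (j l : σ) : euD k j (X l) = if l = j then X l else 0 := by
  simp only [euD, Derivation.smul_apply, pderiv_X, smul_eq_mul]
  by_cases h : l = j
  · subst h; simp
  · simp [h, Pi.single_apply, Ne.symm h]

lemma euD_coeff {σ : Type*} [DecidableEq σ] (j : σ) (F : MvPolynomial σ k) (m : σ →₀ ℕ) :
    coeff m (euD k j F) = m j * coeff m F := by
  induction F using MvPolynomial.induction_on' with
  | monomial u a =>
    simp only [euD, Derivation.smul_apply, pderiv_monomial, smul_eq_mul]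
    rcases Nat.eq_zero_or_pos (u j) with h | h
    · simp only [h, Nat.cast_zero, mul_zero, monomial_zero, coeff_zero, coeff_monomial]
      split_ifs with h2
      · subst h2; simp [h]
      · simp
    · rw [X, monomial_mul, one_mul]
      have : Finsupp.single j 1 + (u - Finsupp.single j 1) = u := by
        apply add_tsub_cancel_of_le
        rw [Finsupp.single_le_iff]; exact h
      rw [this, coeff_monomial, coeff_monomial]
      split_ifs with h2
      · subst h2; ring
      · simp
  | add p q hp hq => rw [map_add, coeff_add, coeff_add, hp, hq]; ring

lemma Tm_one (T : Tor K) : Tm T (fun _ => (1 : k)) = 1 := by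
  have e : (T.Q : Mt n k) * ((T.Q⁻¹ : GL (Fin n) k) : Mt n k) = 1 := by rw [← Units.val_mul]; simp
  rw [Tm, cm_self, cm_self]
  have : tmon T.Λ (fun _ => (1:k)) = fun _ => 1 := by funext i; simp [tmon]
  rw [this, diagonal_one, mul_one, e]

lemma Tm_weight (T : Tor K) (χ : Mt n k → k) (τ : Fin (n+1) → k) :
    ∃ c : k, ∀ f ∈ Aw K χ, ∀ p : Mt n k, ev (p * Tm T τ) f = c * ev p f := by
  classical
  refine ⟨if h : ∃ m : Fin (n+1) →₀ ℕ, ∀ j, (m j : k) = χ (T.y j) then ∏ j, τ j ^ h.choose j else 1, ?_⟩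
  intro f hf p
  let F : MvPolynomial (Fin (n+1)) k := ev (cm _ p * Tm T (X : Fin (n+1) → MvPolynomial (Fin (n+1)) k)) f
  have hF : ∀ τ : Fin (n+1) → k, eval τ F = ev (p * Tm T τ) f := by
    intro τ
    have := map_ev (aeval (R := k) τ) (cm _ p * Tm T (X : Fin (n+1) → MvPolynomial (Fin (n+1)) k)) f
    rw [map_mul', Tm_map, cm_map, cm_self, aeval_eq_eval] at this
    simpa using this
  have hD : ∀ j, euD k j F = χ (T.y j) • F := by
    intro j
    have := chain (euD k j) (cm _ p * Tm T (X : Fin (n+1) → MvPolynomial (Fin (n+1)) k)) (T.y j) ?_ f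
    · rw [hf.2 _ (T.y_mm j), map_smul] at this; exact this
    · intro i i'
      rw [Matrix.mul_assoc, Matrix.mul_apply, Matrix.mul_apply, map_sum]
      refine Finset.sum_congr rfl fun l _ => ?_
      rw [Derivation.leibniz, euler_Tm T X (euD k j) j (fun l => euD_X j l)]
      simp [cm]
  have hsupp : ∀ m, coeff m F ≠ 0 → ∀ j, (m j : k) = χ (T.y j) := by
    intro m hm j
    have := congrArg (coeff m) (hD j)
    rw [euD_coeff, coeff_smul, smul_eq_mul] at this
    exact mul_right_cancel₀ hm this
  have h1 : ev p f = eval (fun _ => 1) F := by rw [hF, Tm_one, mul_one]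
  rw [h1, ← hF]
  by_cases h : ∃ m : Fin (n+1) →₀ ℕ, ∀ j, (m j : k) = χ (T.y j)
  · rw [dif_pos h]
    have hm : ∀ m, coeff m F ≠ 0 → m = h.choose := by
      intro m hm
      ext j
      have := (hsupp m hm j).trans (h.choose_spec j).symm
      exact_mod_cast this
    have hFm : F = monomial h.choose (coeff h.choose F) := by
      ext m
      rw [coeff_monomial]
      split_ifs with h2
      · rw [h2]
      · by_contra h3; exact h2 (hm m h3).symm
    rw [hFm, eval_monomial, eval_monomial]
    simp only [Finsupp.prod_fintype, pow_zero, one_pow, Finset.prod_const_one, implies_true]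
    ring
  · have : F = 0 := by
      ext m
      by_contra h3
      exact h ⟨m, hsupp m h3⟩
    rw [this]; simp

lemma Tm_M1 (T : Tor K) (τ : Fin (n+1) → k) (hτ : ∀ j, τ j ≠ 0) :
    ∃ t : GL (Fin n) k, (t : Mt n k) = Tm T τ ∧ t ∈ M1 K := by
  have hd : ∀ i, tmon T.Λ τ i ≠ 0 := fun i => Finset.prod_ne_zero_iff.2 fun j _ => pow_ne_zero _ (hτ j)
  let d : GL (Fin n) k := ⟨diagonal (tmon T.Λ τ), diagonal (fun i => (tmon T.Λ τ i)⁻¹),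
    by rw [diagonal_mul_diagonal]; simp [hd], by rw [diagonal_mul_diagonal]; simp [hd]⟩
  have e : ((T.Q * d * T.Q⁻¹ : GL (Fin n) k) : Mt n k) = Tm T τ := by
    rw [Tm, cm_self, cm_self, Units.val_mul, Units.val_mul]
  refine ⟨T.Q * d * T.Q⁻¹, e, fun χ => ?_⟩
  obtain ⟨c, hc⟩ := Tm_weight T χ τ
  refine ⟨c, fun f hf => poly_ext fun p => ?_⟩
  rw [e, ev_Rt, cm_self, hc f hf p, map_smul, smul_eq_mul]

lemma upr_mem {G : Subgroup (GL (Fin n) k)} {ν : ℕ → Mt n k} (hν : ∀ i, IsNilpotent (ν i))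
    (h : ∀ i r, expG r (ν i) (hν i) ∈ G) (s : ℕ → k) (r : ℕ) : ∃ u ∈ G, (u : Mt n k) = upr s ν r := by
  induction r with
  | zero => exact ⟨1, G.one_mem, rfl⟩
  | succ r ih =>
    obtain ⟨u, hu, he⟩ := ih
    exact ⟨u * expG (s r) (ν r) (hν r), G.mul_mem hu (h r _), by rw [Units.val_mul, he, expG_val]; rfl⟩

lemma IK_M1_pp (T : Tor K) {ν : ℕ → Mt n k} (hν : ∀ i, ν i ∈ Sn K) (r : ℕ) : IK (M1 K) ≤ pp T ν r := by
  intro f hf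
  apply mem_pp_of
  intro s τ hτ
  obtain ⟨t, ht, htM⟩ := Tm_M1 T τ hτ
  obtain ⟨u, hu, hue⟩ := upr_mem (G := M1 K) (fun i => (hν i).2) (fun i r => exp_M1 (hν i) r) s r
  have := hf _ ((M1 K).mul_mem hu htM)
  rwa [Units.val_mul, ht, hue] at this

lemma pp_le_m1 (T : Tor K) (ν : ℕ → Mt n k) (r : ℕ) : pp T ν r ≤ m1 n k := by
  intro f hf
  rw [mem_m1]
  have := mem_pp hf (fun _ => 0) (fun _ => 1)
  rwa [Ph, upr_zero, Tm_one, mul_one] at this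

lemma pp_uu (T : Tor K) {ν : ℕ → Mt n k} {r : ℕ}
    (hJ : ∀ N ∈ Sn K, ∀ f ∈ Ju ν r, D N f ∈ Ju ν r) {y : Mt n k} (hy : y ∈ uu K) :
    ∀ f ∈ pp T ν r, D y f ∈ pp T ν r := by
  intro f hf
  apply mem_pp_of
  intro s τ hτ
  obtain ⟨t, ht, htM⟩ := Tm_M1 T τ hτ
  have h1 : Rt (t : Mt n k) f ∈ Ju ν r := by
    rw [mem_Ju]
    intro s
    rw [ev_Rt, cm_self, ht]
    exact mem_pp hf s τ
  have e : ((t⁻¹ : GL (Fin n) k) : Mt n k) * (t : Mt n k) = 1 := by rw [← Units.val_mul]; simp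
  have h2 : (t : Mt n k) * y * ((t⁻¹ : GL (Fin n) k) : Mt n k) ∈ uu K := by
    apply mem_uu_of_Aw T
    intro χ f hf
    obtain ⟨c, hc⟩ := (M1 K).inv_mem htM χ
    rw [D_conj, hc f hf, Derivation.map_smul, hy f hf.1]; simp
  have h3 := separation (Sn K) (fun N hN => hN.2) ((Ju ν r).restrictScalars k) hJ _ h2 _ h1
  rw [D_conj, Rt_Rt, e, Rt_one] at h3
  have h4 := mem_Ju.1 h3 s
  rwa [ev_Rt, cm_self, ht] at h4

lemma pp_y (T : Tor K) {ν : ℕ → Mt n k} {r : ℕ} (j : Fin (n+1)) :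
    ∀ f ∈ pp T ν r, D (T.y j) f ∈ pp T ν r := by
  classical
  intro f hf
  rw [mem_pp_iff] at hf ⊢
  have hs : ∀ (l : ℕ) i i', euD k (Sum.inr j) (upr (gs k n r) ν l i i') = 0 := by
    have hg : ∀ l, gs k n r l ∈ (MvPolynomial.rename (Sum.inl : Fin r → Fin r ⊕ Fin (n+1)) : MvPolynomial (Fin r) k →ₐ[k] _).range := by
      intro l
      unfold gs
      split_ifs with h
      · exact ⟨X ⟨l, h⟩, by simp⟩
      · exact Subalgebra.zero_mem _
    choose w hw using hg
    intro l i i'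
    have e : upr (gs k n r) ν l = (upr w ν l).map (MvPolynomial.rename (Sum.inl : Fin r → Fin r ⊕ Fin (n+1)) : MvPolynomial (Fin r) k →ₐ[k] _) := by
      rw [upr_map]; congr 1; funext l; exact (hw l).symm
    rw [e, Matrix.map_apply]
    generalize upr w ν l i i' = g
    induction g using MvPolynomial.induction_on with
    | C a => simp [euD]
    | add p q hp hq => rw [map_add, map_add, hp, hq, add_zero]
    | mul_X p i hp =>
      rw [map_mul, Derivation.leibniz, hp, rename_X, euD_X]
      simp
  have := chain (euD k (Sum.inr j)) (PhR T ν r) (T.y j) ?_ f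
  · rw [← this, hf, map_zero]
  · intro i i'
    rw [PhR, Ph, Matrix.mul_assoc, Matrix.mul_apply, Matrix.mul_apply, map_sum]
    refine Finset.sum_congr rfl fun l _ => ?_
    rw [Derivation.leibniz, hs, euler_Tm T (gt k n r) (euD k (Sum.inr j)) j (fun l => by
      rw [gt, euD_X]; simp)]
    simp

lemma pp_dec (T : Tor K) {ν : ℕ → Mt n k} {r : ℕ}
    (hJ : ∀ N ∈ Sn K, ∀ f ∈ Ju ν r, D N f ∈ Ju ν r) {x : Mt n k}
    (hx : ∃ c : Fin (n+1) → k, ∃ u ∈ uu K, x = ∑ j, c j • T.y j + u) :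
    ∀ f ∈ pp T ν r, D x f ∈ pp T ν r := by
  have hu : uu K ≤ stab ((pp T ν r).restrictScalars k) := fun y hy => pp_uu T hJ hy
  have hy : ∀ j, T.y j ∈ stab ((pp T ν r).restrictScalars k) := fun j => pp_y T j
  obtain ⟨c, u, hu', rfl⟩ := hx
  exact Submodule.add_mem _ (Submodule.sum_mem _ fun j _ => Submodule.smul_mem _ _ (hy j)) (hu hu')

lemma matdeg {σ : Type*} (A B : Mt n (MvPolynomial σ k)) (a b : ℕ) (hA : ∀ i j, (A i j).totalDegree ≤ a)
    (hB : ∀ i j, (B i j).totalDegree ≤ b) (i j) : ((A * B) i j).totalDegree ≤ a + b := by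
  rw [Matrix.mul_apply]
  refine totalDegree_finsetSum_le fun l _ => ?_
  exact (totalDegree_mul _ _).trans (Nat.add_le_add (hA _ _) (hB _ _))

lemma cm_deg {σ : Type*} (x : Mt n k) (i j) : (cm (MvPolynomial σ k) x i j).totalDegree ≤ 0 := by
  simp [cm, algebraMap_eq]

lemma gs_deg (r l : ℕ) : (gs k n r l).totalDegree ≤ 1 := by
  unfold gs; split_ifs
  · rw [totalDegree_X]
  · simp

lemma expM_deg (N : Mt n k) {σ : Type*} (g : MvPolynomial σ k) (hg : g.totalDegree ≤ 1) (i j) :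
    (expM g N i j).totalDegree ≤ n := by
  rw [expM, Matrix.sum_apply]
  refine totalDegree_finsetSum_le fun m hm => ?_
  rw [Matrix.smul_apply, smul_eq_mul]
  refine (totalDegree_mul _ _).trans ?_
  have h1 := cm_deg (σ := σ) (N ^ m) i j
  have h2 : (g ^ m * algebraMap k _ ((m.factorial : k)⁻¹)).totalDegree ≤ m := by
    refine (totalDegree_mul _ _).trans ?_
    rw [algebraMap_eq, totalDegree_C, add_zero]
    refine (totalDegree_pow _ _).trans ?_
    nlinarith
  have := Finset.mem_range.1 hm
  omega

lemma upr_deg (ν : ℕ → Mt n k) (r l : ℕ) : ∀ i j, (upr (gs k n r) ν l i j).totalDegree ≤ l * n := by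
  induction l with
  | zero =>
    intro i j
    simp only [upr, Matrix.one_apply]
    split_ifs <;> simp
  | succ l ih =>
    intro i j
    rw [Nat.succ_mul]
    exact matdeg (upr (gs k n r) ν l) (expM (gs k n r l) (ν l)) _ _ ih (expM_deg _ _ (gs_deg r l)) i j

lemma dg_deg (T : Tor K) (r : ℕ) (i j) :
    ((diagonal (tmon T.Λ (gt k n r)) : Mt n (MvPolynomial (Fin r ⊕ Fin (n+1)) k)) i j).totalDegree ≤ (n+1) * pbd n := by
  rw [diagonal_apply]
  split_ifs
  · rw [tmon]
    refine (totalDegree_finsetProd _ _).trans ?_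
    have h : ∀ l ∈ (Finset.univ : Finset (Fin (n+1))), (gt k n r l ^ T.Λ i l).totalDegree ≤ pbd n := by
      intro l _
      refine (totalDegree_pow _ _).trans ?_
      rw [gt, totalDegree_X, mul_one]; exact T.bd _ _
    refine (Finset.sum_le_sum h).trans ?_
    rw [Finset.sum_const, Finset.card_univ, Fintype.card_fin, smul_eq_mul]
  · rw [totalDegree_zero]; exact Nat.zero_le _

lemma PhR_deg (T : Tor K) (ν : ℕ → Mt n k) (r : ℕ) (i j) :
    (PhR T ν r i j).totalDegree ≤ r * n + (n+1) * pbd n := by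
  rw [PhR, Ph]
  refine matdeg _ _ _ _ (upr_deg ν r r) ?_ i j
  intro i j
  rw [Tm]
  have := matdeg _ _ _ _ (matdeg _ _ _ _ (cm_deg (T.Q : Mt n k)) (dg_deg T r))
    (cm_deg ((T.Q⁻¹ : GL (Fin n) k) : Mt n k)) i j
  rwa [zero_add, add_zero] at this
end par
end EF

namespace EF
section grp
variable {n : ℕ} {k : Type*} [Field k] [IsAlgClosed k] [CharZero k] {K : Subgroup (GL (Fin n) k)}

lemma der_zero_of_shift (P : Polynomial k) (m : ℕ) (hm : 0 < m) (c : k)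
    (h : ∀ s : k, P.eval (s + (m : k)) = c * P.eval s) : Polynomial.derivative P = 0 := by
  by_cases hP : P = 0
  · rw [hP]; simp
  have h1 : P.comp (Polynomial.X + Polynomial.C (m : k)) = Polynomial.C c * P := by
    apply Polynomial.funext
    intro s
    simp [h s]
  have hc : c = 1 := by
    have := congrArg Polynomial.leadingCoeff h1
    rw [Polynomial.leadingCoeff_comp (by rw [Polynomial.natDegree_X_add_C]; exact one_ne_zero), Polynomial.leadingCoeff_mul, Polynomial.leadingCoeff_C] at this
    have h2 : P.leadingCoeff ≠ 0 := by simpa using hP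
    rw [Polynomial.leadingCoeff_X_add_C, one_pow, mul_one] at this
    exact (mul_right_cancel₀ h2 (by rw [one_mul]; exact this)).symm
  subst hc
  have h3 : ∀ i : ℕ, P.eval ((m : k) * i) = P.eval 0 := by
    intro i
    induction i with
    | zero => simp
    | succ i ih =>
      have := h ((m : k) * i)
      rw [one_mul, ih] at this
      rw [← this]; push_cast; ring_nf
  have h4 : P = Polynomial.C (P.eval 0) := by
    have : P.comp (Polynomial.C (m : k) * Polynomial.X) = (Polynomial.C (P.eval 0)) := by
      apply poly_eq_of_nat
      intro i; simp [h3]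
    have h5 := congrArg (fun q => Polynomial.comp q (Polynomial.C ((m : k)⁻¹) * Polynomial.X)) this
    simp only [Polynomial.comp_assoc] at h5
    have hm' : (m : k) ≠ 0 := Nat.cast_ne_zero.2 hm.ne'
    simp only [Polynomial.mul_comp, Polynomial.C_comp, Polynomial.X_comp, ← mul_assoc, ← Polynomial.C_mul,
      mul_inv_cancel₀ hm', Polynomial.C_1, one_mul, Polynomial.comp_X] at h5
    exact h5
  rw [h4, Polynomial.derivative_C]

lemma uu_of_pow (T : Tor K) {N : Mt n k} (hN : IsNilpotent N) (m : ℕ) (hm : 0 < m)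
    (h : expG (m : k) N hN ∈ M1 K) : N ∈ uu K := by
  apply mem_uu_of_Aw T
  intro χ f hf
  obtain ⟨c, hc⟩ := h χ
  apply D_zero_of_const hN
  intro p
  apply der_zero_of_shift _ m hm c
  intro s
  rw [cv_eval, cv_eval, expM_add _ _ hN, ← Matrix.mul_assoc]
  have := congrArg (ev (p * expM s N)) (hc f hf)
  rw [ev_Rt, cm_self, map_smul, expG_val, smul_eq_mul] at this
  exact this

theorem group_half (H' : Subgroup (GL (Fin n) k)) (hH : IsAlgebraicSubgroup H') :
    ∃ Hbar : Subgroup (GL (Fin n) k), H' ≤ Hbar ∧ (∀ g ∈ Hbar, IsUnipotent g → g ∈ idComponent H') ∧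
      ∃ r ≤ n ^ 2, ∃ Φ : Mt n (MvPolynomial (Fin r ⊕ Fin (n+1)) k),
        (∀ i j, (Φ i j).totalDegree ≤ r * n + (n+1) * pbd n) ∧
        ∃ E : Finset (GL (Fin n) k), ∀ g : GL (Fin n) k, g ∈ Hbar ↔
          ∃ e ∈ E, ∀ f : Pn n k, ev Φ f = 0 → ev ((e⁻¹ * g : GL (Fin n) k) : Mt n k) f = 0 := by
  classical
  have hK := clo_of_alg hH
  obtain ⟨T⟩ := exists_Tor hK
  obtain ⟨r, hr, ν, hν, hJ⟩ := exists_J (Sn H') (fun N hN => hN.2) ⟨Submodule.zero_mem _, IsNilpotent.zero⟩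
  obtain ⟨C, hC, hC'⟩ := finite_cosets H' (pp T ν r) (star H' _ (pp_le_m1 T ν r)
    (fun x hx => pp_dec T hJ (Lie_dec T hK hx)))
  obtain ⟨C2, hC2, hC2'⟩ := finite_cosets (M1 H') (pp T ν r) (star (M1 H') _ (pp_le_m1 T ν r)
    (fun x hx => pp_dec T hJ (M1_Lie_dec T hK hx)))
  have hZ : ∀ g : GL (Fin n) k, (∀ f ∈ pp T ν r, ev (g : Mt n k) f = 0) → g ∈ M1 H' :=
    fun g hg => M1_clo g fun f hf => hg f (IK_M1_pp T hν r hf)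
  let Hbar : Subgroup (GL (Fin n) k) :=
    { carrier := {g | ∃ h ∈ H', ∃ m ∈ M1 H', g = h * m}
      one_mem' := ⟨1, H'.one_mem, 1, (M1 H').one_mem, by simp⟩
      mul_mem' := by
        rintro _ _ ⟨h, hh, m, hm, rfl⟩ ⟨h2, hh2, m2, hm2, rfl⟩
        refine ⟨h * h2, H'.mul_mem hh hh2, (h2⁻¹ * m * h2⁻¹⁻¹) * m2,
          (M1 H').mul_mem (M1_norm (H'.inv_mem hh2) hm) hm2, by group⟩
      inv_mem' := by
        rintro _ ⟨h, hh, m, hm, rfl⟩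
        exact ⟨h⁻¹, H'.inv_mem hh, h * m⁻¹ * h⁻¹, M1_norm hh ((M1 H').inv_mem hm), by group⟩ }
  have hHb : ∀ g, g ∈ Hbar ↔ ∃ h ∈ H', ∃ m ∈ M1 H', g = h * m := fun g => Iff.rfl
  have hcos : ∀ g ∈ Hbar, ∃ c ∈ C, c⁻¹ * g ∈ M1 H' := by
    rintro g ⟨h, hh, m, hm, rfl⟩
    obtain ⟨c, hc, hcz⟩ := hC' h hh
    refine ⟨c, hc, ?_⟩
    rw [← mul_assoc]
    exact (M1 H').mul_mem (hZ _ hcz) hm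
  refine ⟨Hbar, fun g hg => ⟨g, hg, 1, (M1 H').one_mem, by simp⟩, ?_, r, hr, PhR T ν r, PhR_deg T ν r,
    C * C2, ?_⟩
  · intro g hg hgu
    obtain ⟨N, hN, rfl⟩ := exists_log g hgu
    choose! c hc hcM using hcos
    have : ∃ i j : ℕ, i < j ∧ c (expG 1 N hN ^ i) = c (expG 1 N hN ^ j) := by
      obtain ⟨i, j, hij, he⟩ := Finite.exists_ne_map_eq_of_infinite
        (fun i : ℕ => (⟨c (expG 1 N hN ^ i), hc _ (Hbar.pow_mem hg i)⟩ : C))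
      have he' := congrArg Subtype.val he
      rcases lt_or_gt_of_ne hij with h | h
      · exact ⟨i, j, h, he'⟩
      · exact ⟨j, i, h, he'.symm⟩
    obtain ⟨i, j, hij, he⟩ := this
    have h1 := hcM _ (Hbar.pow_mem hg i)
    have h2 := hcM _ (Hbar.pow_mem hg j)
    rw [← he] at h2
    have h3 := (M1 H').mul_mem ((M1 H').inv_mem h1) h2
    have h4 : ((c (expG 1 N hN ^ i))⁻¹ * expG 1 N hN ^ i)⁻¹ * ((c (expG 1 N hN ^ i))⁻¹ * expG 1 N hN ^ j)
        = expG ((j - i : ℕ) : k) N hN := by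
      obtain ⟨m, rfl⟩ := Nat.exists_eq_add_of_lt hij
      have : i + m + 1 - i = m + 1 := by omega
      rw [this, expG_nat, add_assoc, pow_add]; group
    rw [h4] at h3
    have hu := uu_of_pow T hN (j - i) (by omega) h3
    apply exp_idComponent
    intro s
    apply hK
    have hst := separation (Sn H') (fun N hN => hN.2) ((Ju ν r).restrictScalars k) hJ N hu
    have := ev_exp_of_stable 1 hN ((Ju ν r).restrictScalars k) hst
      (fun f hf => mem_m1.1 (Ju_le_m1 ν r hf)) s
    intro f hf
    have hfJ : f ∈ Ju ν r := by
      rw [mem_Ju]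
      intro s
      obtain ⟨u, hu, hue⟩ := upr_mem (G := H') (fun i => (hν i).2) (fun i r => exp_mem hK (hν i).2 (hν i).1 r) s r
      rw [← hue]; exact mem_IK.1 hf u hu
    have h5 := this f hfJ
    rwa [one_mul] at h5
  · intro g
    constructor
    · intro hg
      obtain ⟨c, hc, hcM⟩ := hcos g hg
      obtain ⟨c', hc', hz⟩ := hC2' _ hcM
      refine ⟨c * c', Finset.mul_mem_mul hc hc', fun f hf => ?_⟩
      have := hz f (mem_pp_iff.2 hf)
      rwa [show (c * c')⁻¹ * g = c'⁻¹ * (c⁻¹ * g) by group]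
    · rintro ⟨e, he, hz⟩
      obtain ⟨c, hc, c', hc', rfl⟩ := Finset.mem_mul.1 he
      have := hZ ((c * c')⁻¹ * g) fun f hf => hz f (mem_pp_iff.1 hf)
      refine ⟨c, hC c hc, c' * ((c * c')⁻¹ * g), (M1 H').mul_mem (hC2 c' hc') this, by group⟩
end grp
end EF

namespace EF
section elim
variable {k : Type*} [Field k] {U : Type*}

/-- elimination: bounded kernel vectors -/
lemma elim_bound {W : Type*} (N : ℕ) : ∀ (Δ : ℕ) (m : Fin N → W → MvPolynomial U k)
    (_ : ∀ i w, (m i w).totalDegree ≤ Δ) (a : Fin N → MvPolynomial U k) (_ : a ≠ 0)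
    (_ : ∀ w, ∑ i, a i * m i w = 0),
    ∃ b : Fin N → MvPolynomial U k, b ≠ 0 ∧ (∀ w, ∑ i, b i * m i w = 0) ∧
      ∀ i, (b i).totalDegree ≤ (2 ^ N - 1) * Δ := by
  induction N with
  | zero => intro Δ m _ a ha; exact absurd (Subsingleton.elim _ _) ha
  | succ N ih =>
    intro Δ m hm a ha h
    by_cases h0 : ∀ w, m 0 w = 0
    · refine ⟨Pi.single 0 1, by simp, fun w => ?_, fun i => ?_⟩
      · rw [Finset.sum_eq_single 0]
        · simp [h0]
        · intro i _ hi; simp [hi]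
        · simp
      · by_cases hi : i = 0
        · subst hi; simp
        · simp [hi]
    · push Not at h0
      obtain ⟨w, hw⟩ := h0
      have s1 : ∀ i w', (m 0 w * m (Fin.succ i) w' - m (Fin.succ i) w * m 0 w').totalDegree ≤ 2 * Δ := by
        intro i w'
        refine (totalDegree_sub _ _).trans (max_le ?_ ?_) <;>
        · refine (totalDegree_mul _ _).trans ?_
          have := hm 0 w; have := hm i.succ w'; have := hm i.succ w; have := hm 0 w'
          omega
      have s2 : (fun i : Fin N => a i.succ) ≠ 0 := by
        intro hc
        apply ha
        have h1 : ∀ i : Fin N, a i.succ = 0 := fun i => congrFun hc i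
        have h2 := h w
        rw [Fin.sum_univ_succ] at h2
        simp only [h1, zero_mul, Finset.sum_const_zero, add_zero] at h2
        funext i
        refine Fin.cases ?_ h1 i
        exact (mul_eq_zero.1 h2).resolve_right hw
      have s3 : ∀ w', ∑ i : Fin N, a i.succ * (m 0 w * m i.succ w' - m i.succ w * m 0 w') = 0 := by
        intro w'
        have h1 := h w
        have h2 := h w'
        rw [Fin.sum_univ_succ] at h1 h2
        have e : ∑ i : Fin N, a i.succ * (m 0 w * m i.succ w' - m i.succ w * m 0 w') =
            m 0 w * (∑ i : Fin N, a i.succ * m i.succ w') - m 0 w' * ∑ i : Fin N, a i.succ * m i.succ w := by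
          rw [Finset.mul_sum, Finset.mul_sum, ← Finset.sum_sub_distrib]
          refine Finset.sum_congr rfl fun i _ => by ring
        rw [e]
        linear_combination m 0 w * h2 - m 0 w' * h1
      obtain ⟨b, hb, hb1, hb2⟩ := ih (2 * Δ) (fun i w' => m 0 w * m i.succ w' - m i.succ w * m 0 w') s1
        (fun i => a i.succ) s2 s3
      · refine ⟨Fin.cons (-∑ i, b i * m i.succ w) (fun i => m 0 w * b i), ?_, ?_, ?_⟩
        · intro hc
          apply hb
          funext i
          have := congrFun hc i.succ
          simp only [Fin.cons_succ, Pi.zero_apply] at this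
          exact (mul_eq_zero.1 this).resolve_left hw
        · intro w'
          rw [Fin.sum_univ_succ]
          simp only [Fin.cons_zero, Fin.cons_succ]
          rw [← hb1 w', neg_mul, Finset.sum_mul, neg_add_eq_sub, ← Finset.sum_sub_distrib]
          refine Finset.sum_congr rfl fun i _ => ?_
          ring
        · have e : (2 ^ (N + 1) - 1) * Δ = (2 ^ N - 1) * (2 * Δ) + Δ := by
            have := Nat.one_le_two_pow (n := N)
            obtain ⟨z, hz⟩ := Nat.exists_eq_add_of_le this
            rw [pow_succ, hz]
            have : (1 + z) * 2 - 1 = 2 * z + 1 := by omega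
            rw [this, Nat.add_sub_cancel_left]; ring
          intro i
          rw [e]
          refine Fin.cases ?_ (fun i => ?_) i
          · rw [Fin.cons_zero, totalDegree_neg]
            refine totalDegree_finsetSum_le fun i _ => ?_
            exact (totalDegree_mul _ _).trans (Nat.add_le_add (hb2 i) (hm _ _))
          · rw [Fin.cons_succ]
            refine (totalDegree_mul _ _).trans ?_
            rw [add_comm]
            exact Nat.add_le_add (hb2 i) (hm _ _)

lemma elim_bound' {W V : Type*} [Fintype V] (Δ : ℕ) (m : V → W → MvPolynomial U k)
    (hm : ∀ i w, (m i w).totalDegree ≤ Δ) (a : V → MvPolynomial U k) (ha : a ≠ 0)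
    (h : ∀ w, ∑ i, a i * m i w = 0) :
    ∃ b : V → MvPolynomial U k, b ≠ 0 ∧ (∀ w, ∑ i, b i * m i w = 0) ∧
      ∀ i, (b i).totalDegree ≤ 2 ^ (Fintype.card V) * Δ := by
  let e := Fintype.equivFin V
  obtain ⟨b, hb, hb1, hb2⟩ := elim_bound (Fintype.card V) Δ (fun i => m (e.symm i)) (fun i w => hm _ _)
    (fun i => a (e.symm i)) (fun hc => ha (by funext i; simpa using congrFun hc (e i)))
    (fun w => by rw [← h w]; exact Equiv.sum_comp e.symm (fun i => a i * m i w))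
  refine ⟨fun i => b (e i), fun hc => hb (by funext i; simpa using congrFun hc (e.symm i)), fun w => ?_, fun i => ?_⟩
  · rw [← hb1 w, ← Equiv.sum_comp e]; simp
  · exact (hb2 _).trans (Nat.mul_le_mul_right _ (Nat.sub_le _ _))
end elim

section span
variable {E L ι : Type*} [Field E] [Field L] [Algebra E L] [Fintype ι]

/-- bounded monomials span the algebra -/
lemma span_mon (η : ι → L) (δ : ℕ) (q : ι → Polynomial E) (hq : ∀ i, (q i).Monic)
    (hδ : ∀ i, (q i).natDegree ≤ δ) (h0 : ∀ i, Polynomial.aeval (η i) (q i) = 0) (x : L)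
    (hx : x ∈ Algebra.adjoin E (Set.range η)) :
    x ∈ Submodule.span E (Set.range fun β : ι → Fin δ => ∏ i, η i ^ (β i : ℕ)) := by
  classical
  set M := Submodule.span E (Set.range fun β : ι → Fin δ => ∏ i, η i ^ (β i : ℕ)) with hM
  have hmem : ∀ β : ι → ℕ, (∀ i, β i < δ) → ∏ i, η i ^ β i ∈ M := fun β hβ =>
    Submodule.subset_span ⟨fun i => ⟨β i, hβ i⟩, rfl⟩
  have hdpos : ∀ i : ι, 0 < δ := by
    intro i
    rcases Nat.eq_zero_or_pos δ with h | h
    · exfalso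
      have h1 := (hq i).natDegree_eq_zero.1 (by have := hδ i; omega)
      have h2 := h0 i
      rw [h1] at h2; simp at h2
    · exact h
  have hred : ∀ i, η i ^ δ ∈ Submodule.span E (Set.range fun j : Fin δ => η i ^ (j : ℕ)) := by
    intro i
    let P := q i * Polynomial.X ^ (δ - (q i).natDegree)
    have hP : P.Monic := (hq i).mul (Polynomial.monic_X_pow _)
    have hPd : P.natDegree = δ := by
      rw [(hq i).natDegree_mul (Polynomial.monic_X_pow _), Polynomial.natDegree_X_pow]
      have := hδ i; omega
    have hP0 : Polynomial.aeval (η i) P = 0 := by rw [map_mul, h0, zero_mul]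
    rw [Polynomial.aeval_eq_sum_range, hPd, Finset.sum_range_succ, ← hPd, hP.coeff_natDegree, hPd, one_smul] at hP0
    rw [eq_neg_of_add_eq_zero_right hP0]
    refine Submodule.neg_mem _ (Submodule.sum_mem _ fun j hj => Submodule.smul_mem _ _ (Submodule.subset_span ⟨⟨j, Finset.mem_range.1 hj⟩, rfl⟩))
  have hmul : ∀ i, ∀ z ∈ M, z * η i ∈ M := by
    intro i z hz
    induction hz using Submodule.span_induction with
    | mem z hz =>
      obtain ⟨β, rfl⟩ := hz
      have e : ∀ j : ℕ, (∏ l ∈ Finset.univ.erase i, η l ^ (β l : ℕ)) * η i ^ j =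
          ∏ l, η l ^ (Function.update (fun l => (β l : ℕ)) i j l) := by
        intro j
        rw [← Finset.prod_erase_mul Finset.univ _ (Finset.mem_univ i)]
        congr 1
        · refine Finset.prod_congr rfl fun l hl => ?_
          rw [Function.update_of_ne (Finset.ne_of_mem_erase hl)]
        · simp
      have e2 : (∏ l, η l ^ (β l : ℕ)) * η i = (∏ l ∈ Finset.univ.erase i, η l ^ (β l : ℕ)) * η i ^ ((β i : ℕ) + 1) := by
        rw [← Finset.prod_erase_mul Finset.univ _ (Finset.mem_univ i)]; ring
      have hsm : ∀ j < δ, (∏ l ∈ Finset.univ.erase i, η l ^ (β l : ℕ)) * η i ^ j ∈ M := by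
        intro j hj
        rw [e]
        apply hmem
        intro l
        by_cases hl : l = i
        · subst hl; simpa using hj
        · rw [Function.update_of_ne hl]; exact (β l).2
      simp only
      rw [e2]
      by_cases hb : (β i : ℕ) + 1 < δ
      · exact hsm _ hb
      · have hb' : (β i : ℕ) + 1 = δ := by have := (β i).2; omega
        rw [hb']
        have h1 := hred i
        have h2 : Submodule.span E (Set.range fun j : Fin δ => η i ^ (j : ℕ)) ≤
            M.comap (LinearMap.mulLeft E (∏ l ∈ Finset.univ.erase i, η l ^ (β l : ℕ))) := by
          rw [Submodule.span_le]
          rintro _ ⟨j, rfl⟩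
          exact hsm j j.2
        exact h2 h1
    | zero => rw [zero_mul]; exact M.zero_mem
    | add a b _ _ ha hb => rw [add_mul]; exact M.add_mem ha hb
    | smul c a _ ha => rw [smul_mul_assoc]; exact M.smul_mem c ha
  rw [Algebra.adjoin_range_eq_range_aeval] at hx
  obtain ⟨p, rfl⟩ := hx
  change aeval η p ∈ M
  induction p using MvPolynomial.induction_on with
  | C a =>
    rw [aeval_C, Algebra.algebraMap_eq_smul_one]
    refine M.smul_mem _ ?_
    have := hmem (fun _ => 0) hdpos
    simpa using this
  | add p q hp hq => rw [map_add]; exact M.add_mem hp hq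
  | mul_X p i hp => rw [map_mul, aeval_X]; exact hmul i _ hp
end span

section tr
variable {k : Type*} [Field k] {U : Type*}
  {E F : Type*} [Field E] [Field F] [Algebra (MvPolynomial U k) E] [IsFractionRing (MvPolynomial U k) E]
  [Algebra (MvPolynomial U k) F] [Algebra E F] [IsScalarTower (MvPolynomial U k) E F]

lemma deg_of_dvd (p : MvPolynomial (Option U) k) (hp : p ≠ 0) (q : Polynomial (MvPolynomial U k))
    (hq : q ∣ optionEquivLeft k U p) (j : ℕ) :
    (q.coeff j).totalDegree ≤ p.totalDegree ∧ q.natDegree ≤ p.totalDegree := by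
  obtain ⟨h, hh⟩ := hq
  have e : p = (optionEquivLeft k U).symm q * (optionEquivLeft k U).symm h := by
    rw [← map_mul, ← hh]; simp
  have hq0 : (optionEquivLeft k U).symm q ≠ 0 := by rintro h0; rw [h0, zero_mul] at e; exact hp e
  have hh0 : (optionEquivLeft k U).symm h ≠ 0 := by rintro h0; rw [h0, mul_zero] at e; exact hp e
  have hd : ((optionEquivLeft k U).symm q).totalDegree ≤ p.totalDegree := by
    rw [e, totalDegree_mul_of_isDomain hq0 hh0]; omega
  have e2 : optionEquivLeft k U ((optionEquivLeft k U).symm q) = q := by simp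
  constructor
  · refine le_trans ?_ hd
    conv_lhs => rw [← e2]
    exact totalDegree_coeff_optionEquivLeft_le k U _ _
  · refine le_trans ?_ hd
    conv_lhs => rw [← e2]
    rw [natDegree_optionEquivLeft]
    exact degreeOf_le_totalDegree _ _

lemma trace_bound [FiniteDimensional E F] (p : MvPolynomial (Option U) k) (hp : p ≠ 0) (y : F)
    (hy : IsIntegral (MvPolynomial U k) y) (h0 : Polynomial.aeval y (optionEquivLeft k U p) = 0) :
    ∃ a : MvPolynomial U k, a.totalDegree ≤ p.totalDegree ∧ Algebra.trace E F y = algebraMap _ E a := by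
  have : FaithfulSMul (MvPolynomial U k) F := by
    rw [faithfulSMul_iff_algebraMap_injective, IsScalarTower.algebraMap_eq (MvPolynomial U k) E F]
    exact (algebraMap E F).injective.comp (IsFractionRing.injective _ E)
  have hd := minpoly.isIntegrallyClosed_dvd hy h0
  have he := minpoly.isIntegrallyClosed_eq_field_fractions' (R := MvPolynomial U k) E hy
  have hnc : (minpoly E y).nextCoeff = algebraMap _ E (minpoly (MvPolynomial U k) y).nextCoeff := by
    rw [he, Polynomial.nextCoeff_map (IsFractionRing.injective _ E)]
  refine ⟨(Module.finrank (IntermediateField.adjoin E {y}) F : MvPolynomial U k) * -(minpoly (MvPolynomial U k) y).nextCoeff, ?_, ?_⟩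
  · refine (totalDegree_mul _ _).trans ?_
    have h1 : ((Module.finrank (IntermediateField.adjoin E {y}) F : ℕ) : MvPolynomial U k).totalDegree = 0 := by
      rw [← map_natCast (C : k →+* MvPolynomial U k), totalDegree_C]
    rw [h1, zero_add, totalDegree_neg, Polynomial.nextCoeff]
    split_ifs
    · simp
    · exact (deg_of_dvd p hp _ hd _).1
  · rw [trace_eq_finrank_mul_minpoly_nextCoeff, hnc]; simp
end tr
end EF

namespace EF
section perron
variable {k : Type*} [Field k] {τ U : Type*} [Fintype τ] [Fintype U]

lemma dep_count {W : Type*} [Fintype W] (v : W → MvPolynomial τ k) (M : ℕ)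
    (hv : ∀ w, (v w).totalDegree < M) (hM : M ^ Fintype.card τ < Fintype.card W) :
    ∃ c : W → k, c ≠ 0 ∧ ∑ w, c w • v w = 0 := by
  classical
  let φ : (W → k) →ₗ[k] ((τ → Fin M) → k) :=
    { toFun := fun c d => ∑ w, c w * (v w).coeff (Finsupp.equivFunOnFinite.symm fun i => (d i : ℕ))
      map_add' := by
        intro a b; funext d; simp [add_mul, Finset.sum_add_distrib]
      map_smul' := by
        intro a b; funext d; simp [Finset.mul_sum, mul_assoc] }
  have h := LinearMap.ker_ne_bot_of_finrank_lt (f := φ) (by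
    rw [Module.finrank_fintype_fun_eq_card, Module.finrank_fintype_fun_eq_card]
    simpa using hM)
  obtain ⟨c, hc, hc0⟩ := (Submodule.ne_bot_iff _).1 h
  refine ⟨c, hc0, ?_⟩
  ext d
  rw [coeff_sum, coeff_zero]
  simp only [coeff_smul, smul_eq_mul]
  by_cases hd : ∀ i, d i < M
  · have := congrFun (LinearMap.mem_ker.1 hc) (fun i => ⟨d i, hd i⟩)
    simp only [φ, LinearMap.coe_mk, AddHom.coe_mk, Pi.zero_apply] at this
    convert this using 4
    ext i; simp
  · push Not at hd
    obtain ⟨i, hi⟩ := hd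
    refine Finset.sum_eq_zero fun w _ => ?_
    rw [coeff_eq_zero_of_totalDegree_lt, mul_zero]
    refine lt_of_lt_of_le (hv w) (hi.trans ?_)
    by_cases h0 : d i = 0
    · rw [h0]; exact Nat.zero_le _
    · exact Finset.single_le_sum (f := fun i => d i) (fun _ _ => Nat.zero_le _) (Finsupp.mem_support_iff.2 h0)

lemma ext_basis (u : U → MvPolynomial τ k) (hu : AlgebraicIndependent k u) :
    ∃ J : Set (MvPolynomial τ k), J.Finite ∧ (∀ j ∈ J, j.totalDegree ≤ 1) ∧
      AlgebraicIndependent (Algebra.adjoin k (Set.range u)) (fun j : J => (j : MvPolynomial τ k)) ∧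
      Fintype.card U + Nat.card J = Fintype.card τ := by
  classical
  have hal : Algebra.IsAlgebraic (Algebra.adjoin k (Set.range u ∪ Set.range (X : τ → MvPolynomial τ k))) (MvPolynomial τ k) := by
    have : Algebra.adjoin k (Set.range u ∪ Set.range (X : τ → MvPolynomial τ k)) = ⊤ := by
      rw [eq_top_iff, ← adjoin_range_X]
      exact Algebra.adjoin_mono Set.subset_union_right
    rw [this]
    constructor
    intro a
    exact isAlgebraic_algebraMap (⟨a, trivial⟩ : (⊤ : Subalgebra k (MvPolynomial τ k)))
  obtain ⟨B, hB1, hB2, hB⟩ := exists_isTranscendenceBasis_between (R := k) (Set.range u)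
    (Set.range u ∪ Set.range (X : τ → MvPolynomial τ k)) Set.subset_union_left hu.coe_range
  have hcard := hB.lift_cardinalMk_eq (IsTranscendenceBasis.mvPolynomial τ k)
  have hfin : Finite B := by
    have h1 : Cardinal.lift (Cardinal.mk B) < Cardinal.aleph0 := by
      rw [hcard]; simp
    rw [Cardinal.lift_lt_aleph0] at h1
    exact Cardinal.lt_aleph0_iff_finite.1 h1
  have hcard2 : Nat.card B = Fintype.card τ := by
    have := congrArg Cardinal.toNat hcard
    simpa [Nat.card] using this
  refine ⟨B \ Set.range u, Set.Finite.subset (Set.toFinite B) Set.sdiff_subset, ?_, ?_, ?_⟩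
  · rintro j ⟨hj, hj2⟩
    rcases hB2 hj with h | ⟨i, rfl⟩
    · exact absurd h hj2
    · exact (totalDegree_X _).le
  · have h1 := hB.1.adjoin_of_disjoint (s := {b | (b : MvPolynomial τ k) ∈ Set.range u}) (t := {b | (b : MvPolynomial τ k) ∉ Set.range u})
      (by rw [Set.disjoint_left]; intro a ha hb; exact hb ha)
    have e : (Subtype.val '' {b : B | (b : MvPolynomial τ k) ∈ Set.range u}) = Set.range u := by
      ext z; constructor
      · rintro ⟨b, hb, rfl⟩; exact hb
      · intro hz; exact ⟨⟨z, hB1 hz⟩, hz, rfl⟩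
    rw [e] at h1
    exact h1.comp (fun j : ↥(B \ Set.range u) => ⟨⟨j.1, j.2.1⟩, j.2.2⟩) (by
      intro a b hab
      simp only [Subtype.mk.injEq] at hab
      exact Subtype.ext hab)
  · have h1 := Set.ncard_sdiff_add_ncard_of_subset hB1 (Set.toFinite B)
    have h2 : (Set.range u).ncard = Fintype.card U := by
      rw [← Nat.card_coe_set_eq, Nat.card_range_of_injective hu.injective, Nat.card_eq_fintype_card]
    rw [h2, ← Nat.card_coe_set_eq, ← Nat.card_coe_set_eq, hcard2] at h1
    omega

def pD (m δ : ℕ) : ℕ := ((m + 1) * δ) ^ m + 1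

lemma perron (u : U → MvPolynomial τ k) (hu : AlgebraicIndependent k u) (y : MvPolynomial τ k)
    (hy : IsAlgebraic (Algebra.adjoin k (Set.range u)) y) (δ : ℕ) (hδ : 1 ≤ δ)
    (hud : ∀ i, (u i).totalDegree ≤ δ) (hyd : y.totalDegree ≤ δ) :
    ∃ p : MvPolynomial (Option U) k, p ≠ 0 ∧ aeval (fun o : Option U => o.elim y u) p = 0 ∧
      p.totalDegree ≤ (Fintype.card τ + 1) * pD (Fintype.card τ) δ := by
  classical
  obtain ⟨J, hJf, hJd, hJi, hJc⟩ := ext_basis u hu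
  have : Fintype J := hJf.fintype
  set m := Fintype.card τ with hm
  rw [Nat.card_eq_fintype_card] at hJc
  set D := pD m δ with hD
  have hD1 : 1 ≤ D := Nat.succ_le_succ (Nat.zero_le _)
  let w : Option U → MvPolynomial τ k := fun o => o.elim y u
  have hw : ∀ o, (w o).totalDegree ≤ δ := by
    intro o; cases o
    · exact hyd
    · exact hud _
  let v : (Option U → Fin D) × (J → Fin D) → MvPolynomial τ k := fun a =>
    (∏ o, w o ^ (a.1 o : ℕ)) * ∏ j : J, (j : MvPolynomial τ k) ^ (a.2 j : ℕ)
  obtain ⟨c, hc0, hc⟩ := dep_count v ((m + 1) * ((D - 1) * δ) + 1) (by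
    intro a
    rw [Nat.lt_succ_iff]
    refine (totalDegree_mul _ _).trans ?_
    have h1 : (∏ o, w o ^ (a.1 o : ℕ)).totalDegree ≤ (Fintype.card U + 1) * ((D - 1) * δ) := by
      refine (totalDegree_finsetProd _ _).trans ?_
      refine (Finset.sum_le_card_nsmul _ _ ((D - 1) * δ) ?_).trans (by simp)
      intro o _
      refine (totalDegree_pow _ _).trans (Nat.mul_le_mul ?_ (hw o))
      have := (a.1 o).2; omega
    have h2 : (∏ j : J, (j : MvPolynomial τ k) ^ (a.2 j : ℕ)).totalDegree ≤ (Fintype.card J) * ((D - 1) * δ) := by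
      refine (totalDegree_finsetProd _ _).trans ?_
      refine (Finset.sum_le_card_nsmul _ _ ((D - 1) * δ) ?_).trans (by simp)
      intro j _
      refine (totalDegree_pow _ _).trans (Nat.mul_le_mul ?_ ((hJd _ j.2).trans hδ))
      have := (a.2 j).2; omega
    refine (Nat.add_le_add h1 h2).trans (le_of_eq ?_)
    rw [← hJc]; ring) (by
    rw [Fintype.card_prod, Fintype.card_fun, Fintype.card_fun, Fintype.card_fin, Fintype.card_option,
      ← pow_add, show Fintype.card U + 1 + Fintype.card J = m + 1 by omega, ← hm]
    have h1 : (m + 1) * ((D - 1) * δ) + 1 ≤ (m + 1) * δ * D := by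
      obtain ⟨z, hz⟩ := Nat.exists_eq_add_of_le hD1
      rw [hz, Nat.add_sub_cancel_left]
      have : 1 ≤ (m + 1) * δ := Nat.mul_pos (Nat.succ_pos _) hδ
      nlinarith
    calc _ ≤ ((m + 1) * δ * D) ^ m := Nat.pow_le_pow_left h1 _
      _ = ((m + 1) * δ) ^ m * D ^ m := mul_pow _ _ _
      _ < D * D ^ m := Nat.mul_lt_mul_of_pos_right (Nat.lt_succ_self _) (Nat.pow_pos hD1)
      _ = D ^ (m + 1) := by rw [pow_succ, mul_comm])
  have hex : ∃ γ : J → Fin D, ∃ a, c (a, γ) ≠ 0 := by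
    by_contra hcon
    push Not at hcon
    exact hc0 (funext fun a => hcon a.2 a.1)
  obtain ⟨γ, a0, ha0⟩ := hex
  let mon : (Option U → Fin D) → (Option U →₀ ℕ) := fun a => Finsupp.equivFunOnFinite.symm fun o => (a o : ℕ)
  let q : (J → Fin D) → MvPolynomial (Option U) k := fun γ => ∑ a, monomial (mon a) (c (a, γ))
  have hmoninj : Function.Injective mon := by
    intro a b hab
    funext o
    have := DFunLike.congr_fun hab o
    simp only [mon, Finsupp.equivFunOnFinite_symm_apply_apply] at this
    exact Fin.ext this
  have hqev : ∀ γ, aeval w (q γ) = ∑ a, c (a, γ) • ∏ o, w o ^ (a o : ℕ) := by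
    intro γ
    simp only [q, map_sum]
    refine Finset.sum_congr rfl fun a _ => ?_
    rw [aeval_monomial, Algebra.smul_def, Finsupp.prod_fintype _ _ (fun _ => pow_zero _)]
    simp [mon]
  refine ⟨q γ, ?_, ?_, ?_⟩
  · intro h0
    apply ha0
    have := congrArg (coeff (mon a0)) h0
    rw [coeff_sum, Finset.sum_eq_single a0, coeff_monomial, if_pos rfl] at this
    · simpa using this
    · intro b _ hb
      rw [coeff_monomial, if_neg (fun h => hb (hmoninj h))]
    · simp
  · have hcl := hJi.subalgebraAlgebraicClosure
    set Sc := Subalgebra.algebraicClosure (Algebra.adjoin k (Set.range u)) (MvPolynomial τ k) with hSc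
    have hwS : ∀ o, w o ∈ Sc := by
      intro o
      rw [hSc, Subalgebra.mem_algebraicClosure]
      cases o with
      | none => exact hy
      | some i => exact isAlgebraic_algebraMap (⟨u i, Algebra.subset_adjoin ⟨i, rfl⟩⟩ : Algebra.adjoin k (Set.range u))
    have hqS : ∀ γ, aeval w (q γ) ∈ Sc := by
      intro γ
      rw [hqev]
      refine Subalgebra.sum_mem _ fun a _ => ?_
      rw [← algebraMap_smul (Algebra.adjoin k (Set.range u)) (c (a, γ))]
      exact Subalgebra.smul_mem _ (Subalgebra.prod_mem _ fun o _ => Subalgebra.pow_mem _ (hwS o) _) _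
    let monJ : (J → Fin D) → (J →₀ ℕ) := fun a => Finsupp.equivFunOnFinite.symm fun o => (a o : ℕ)
    have hmonJinj : Function.Injective monJ := by
      intro a b hab
      funext o
      have := DFunLike.congr_fun hab o
      simp only [monJ, Finsupp.equivFunOnFinite_symm_apply_apply] at this
      exact Fin.ext this
    let Q : MvPolynomial J Sc := ∑ γ, monomial (monJ γ) (⟨aeval w (q γ), hqS γ⟩ : Sc)
    have hQ : Q = 0 := by
      apply hcl
      rw [map_zero]
      simp only [Q, map_sum]
      rw [← hc, Fintype.sum_prod_type_right]
      refine Finset.sum_congr rfl fun γ _ => ?_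
      rw [aeval_monomial, Finsupp.prod_fintype _ _ (fun _ => pow_zero _)]
      change aeval w (q γ) * _ = _
      rw [hqev, Finset.sum_mul]
      refine Finset.sum_congr rfl fun a _ => ?_
      rw [smul_mul_assoc]
      simp [monJ, v]
    have := congrArg (coeff (monJ γ)) hQ
    rw [coeff_sum, Finset.sum_eq_single γ, coeff_monomial, if_pos rfl] at this
    · simpa using congrArg Subtype.val this
    · intro b _ hb
      rw [coeff_monomial, if_neg (fun h => hb (hmonJinj h))]
    · simp
  · refine totalDegree_finsetSum_le fun a _ => ?_
    refine (totalDegree_monomial_le _ _).trans ?_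
    rw [Finsupp.sum_fintype _ _ (fun _ => rfl)]
    refine (Finset.sum_le_card_nsmul _ _ D ?_).trans ?_
    · intro o _
      simpa [mon] using (a o).2.le
    · simp only [Finset.card_univ, Fintype.card_option, smul_eq_mul]
      exact Nat.mul_le_mul_right _ (by omega)
end perron
end EF

namespace EF
section t7
variable {k : Type*} [Field k] [CharZero k] {U : Type*}
  {E F : Type*} [Field E] [Field F] [Algebra (MvPolynomial U k) E] [IsFractionRing (MvPolynomial U k) E]
  [Algebra (MvPolynomial U k) F] [Algebra E F] [IsScalarTower (MvPolynomial U k) E F]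
  {ι : Type*} [Fintype ι] [DecidableEq ι]

lemma t7a [FiniteDimensional E F] (η : ι → F) (y : F) (δ Δ : ℕ)
    (hη : ∀ i, IsIntegral (MvPolynomial U k) (η i)) (hy : IsIntegral (MvPolynomial U k) y)
    (hgen : Algebra.adjoin E (Set.range fun o : Option ι => o.elim y η) = ⊤)
    (hq : ∀ o : Option ι, (minpoly E (o.elim y η)).natDegree ≤ δ)
    (hp : ∀ β : Option ι → ℕ, (∀ o, β o ≤ 2 * δ) → ∃ p : MvPolynomial (Option U) k, p ≠ 0 ∧
      p.totalDegree ≤ Δ ∧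
      Polynomial.aeval (∏ o : Option ι, (o.elim y η) ^ β o) (optionEquivLeft k U p) = 0) :
    ∃ e, e = (minpoly (IntermediateField.adjoin E (Set.range η)) y).natDegree ∧ e ≤ δ ∧
    ∃ a : (ι → Fin δ) → Fin (e + 1) → MvPolynomial U k,
      (∀ β j, (a β j).totalDegree ≤ 2 ^ (δ ^ Fintype.card ι * (δ + 1)) * Δ) ∧
      ∑ j : Fin (e + 1), (∑ β : ι → Fin δ, algebraMap _ F (a β j) * ∏ i, η i ^ (β i : ℕ)) * y ^ (j : ℕ) = 0 ∧
      ∑ β : ι → Fin δ, algebraMap _ F (a β (Fin.last e)) * ∏ i, η i ^ (β i : ℕ) ≠ 0 := by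
  classical
  have hAE : Function.Injective (algebraMap (MvPolynomial U k) E) := IsFractionRing.injective _ E
  have hchar : CharZero E := charZero_of_injective_ringHom (f := (algebraMap (MvPolynomial U k) E)) hAE
  set K0 := IntermediateField.adjoin E (Set.range η) with hK0
  set e := (minpoly K0 y).natDegree with he
  have halg : ∀ z : F, IsIntegral E z := fun z => Algebra.IsIntegral.isIntegral z
  have hyK : IsIntegral K0 y := (halg y).tower_top
  have hde : e ≤ δ := by
    refine le_trans ?_ (hq none)
    have h1 := Polynomial.natDegree_le_of_dvd (minpoly.dvd_map_of_isScalarTower E K0 y) (by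
      rw [Ne, Polynomial.map_eq_zero]; exact minpoly.ne_zero (halg y))
    rwa [Polynomial.natDegree_map] at h1
  refine ⟨e, rfl, hde, ?_⟩
  let v : (ι → Fin δ) → F := fun β => ∏ i, η i ^ (β i : ℕ)
  obtain ⟨κ, ac, hai, hspan, hli⟩ := exists_linearIndependent' E v
  have : Finite κ := Finite.of_injective ac hai
  have : Fintype κ := Fintype.ofFinite κ
  have hK0mem : ∀ z ∈ K0, z ∈ Submodule.span E (Set.range (v ∘ ac)) := by
    intro z hz
    rw [hspan]
    refine span_mon η δ (fun i => minpoly E (η i)) (fun i => minpoly.monic (halg _)) (fun i => hq (some i))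
      (fun i => minpoly.aeval _ _) z ?_
    rw [← IntermediateField.adjoin_toSubalgebra_of_isAlgebraic (fun x _ => (halg x).isAlgebraic)]
    exact hz
  have hvK : ∀ β, v β ∈ K0 := fun β => prod_mem fun i _ => pow_mem (IntermediateField.subset_adjoin E (Set.range η) (Set.mem_range_self i)) _
  -- relation over E
  have h1 : ∀ j : Fin (e + 1), ∃ c : κ → E, ∑ b, c b • v (ac b) = ((minpoly K0 y).coeff j : K0) := by
    intro j
    exact (Submodule.mem_span_range_iff_exists_fun E).1 (hK0mem _ ((minpoly K0 y).coeff j).2)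
  choose c hc using h1
  have hcrel : ∑ j : Fin (e + 1), ∑ b, c j b • v (ac b) * y ^ (j : ℕ) = 0 := by
    have h2 := minpoly.aeval K0 y
    rw [Polynomial.aeval_eq_sum_range, ← Fin.sum_univ_eq_sum_range (fun i => (minpoly K0 y).coeff i • y ^ i)] at h2
    rw [← h2]
    refine Finset.sum_congr rfl fun j _ => ?_
    rw [← Finset.sum_mul, hc]
    rfl
  have hc0 : ∃ b, c (Fin.last e) b ≠ 0 := by
    by_contra hcon
    push Not at hcon
    have h2 := hc (Fin.last e)
    have h3 : (minpoly K0 y).coeff ((Fin.last e : Fin (e + 1)) : ℕ) = 1 := minpoly.monic hyK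
    rw [h3] at h2
    simp [hcon] at h2
  -- clear denominators
  obtain ⟨s, hs⟩ := IsLocalization.exist_integer_multiples_of_finite (nonZeroDivisors (MvPolynomial U k))
    (fun x : Fin (e + 1) × κ => c x.1 x.2)
  choose a1 ha1 using hs
  have hs0 : algebraMap (MvPolynomial U k) E (s : MvPolynomial U k) ≠ 0 :=
    fun h => nonZeroDivisors.ne_zero s.2 (hAE (by rw [h, map_zero]))
  -- traces
  have h3 : ∀ (x : Fin (e + 1) × κ) (w : Option ι → Fin δ), ∃ m : MvPolynomial U k, m.totalDegree ≤ Δ ∧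
      Algebra.trace E F ((v (ac x.2) * y ^ (x.1 : ℕ)) * ∏ o : Option ι, (o.elim y η) ^ (w o : ℕ)) = algebraMap _ E m := by
    intro x w
    obtain ⟨p, hp0, hpd, hpe⟩ := hp (fun o => (o.elim (x.1 : ℕ) (fun i => (ac x.2 i : ℕ))) + (w o : ℕ)) (by
      intro o
      have := (w o).2
      cases o with
      | none =>
        have := x.1.2
        simp only [Option.elim_none]; omega
      | some i =>
        have := (ac x.2 i).2
        simp only [Option.elim_some]; omega)
    have e1 : (v (ac x.2) * y ^ (x.1 : ℕ)) * ∏ o : Option ι, (o.elim y η) ^ (w o : ℕ) =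
        ∏ o : Option ι, (o.elim y η) ^ ((o.elim (x.1 : ℕ) (fun i => (ac x.2 i : ℕ))) + (w o : ℕ)) := by
      simp only [pow_add, Finset.prod_mul_distrib]
      congr 1
      rw [Fintype.prod_option]
      simp only [Option.elim_none, Option.elim_some, v]
      ring
    rw [← e1] at hpe
    obtain ⟨m, hm1, hm2⟩ := trace_bound (E := E) p hp0 _ (by
      refine IsIntegral.mul (IsIntegral.mul (IsIntegral.prod _ fun i _ => (hη i).pow _) (hy.pow _))
        (IsIntegral.prod _ fun o _ => ?_)
      cases o with
      | none => exact hy.pow _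
      | some i => exact (hη i).pow _) hpe
    exact ⟨m, hm1.trans hpd, hm2⟩
  choose m hmd hmt using h3
  have hsmul : ∀ (a : MvPolynomial U k) (z : F), algebraMap (MvPolynomial U k) E a • z = algebraMap _ F a * z := by
    intro a z
    rw [Algebra.smul_def, ← IsScalarTower.algebraMap_apply]
  obtain ⟨b, hb0, hb1, hb2⟩ := elim_bound' Δ m hmd a1 (by
    intro h0
    obtain ⟨b, hb⟩ := hc0
    have := ha1 (Fin.last e, b)
    rw [h0, Pi.zero_apply, map_zero, Algebra.smul_def] at this
    exact hb ((mul_eq_zero.1 this.symm).resolve_left hs0)) (by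
    intro w
    apply hAE
    rw [map_sum, map_zero]
    have h4 : ∀ x, algebraMap (MvPolynomial U k) E (a1 x * m x w) =
        algebraMap _ E (s : MvPolynomial U k) * Algebra.trace E F ((c x.1 x.2 • v (ac x.2) * y ^ (x.1 : ℕ)) * ∏ o : Option ι, (o.elim y η) ^ (w o : ℕ)) := by
      intro x
      rw [map_mul, ha1, ← hmt, Algebra.smul_def, smul_mul_assoc, smul_mul_assoc, map_smul, smul_eq_mul, mul_assoc]
    simp only [h4]
    rw [← Finset.mul_sum, ← map_sum, ← Finset.sum_mul, Fintype.sum_prod_type, hcrel]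
    simp)
  have hz : ∑ x : Fin (e + 1) × κ, algebraMap _ F (b x) * (v (ac x.2) * y ^ (x.1 : ℕ)) = 0 := by
    set z := ∑ x : Fin (e + 1) × κ, algebraMap _ F (b x) * (v (ac x.2) * y ^ (x.1 : ℕ)) with hz
    have h5 : ∀ w : Option ι → Fin δ, Algebra.trace E F (z * ∏ o : Option ι, (o.elim y η) ^ (w o : ℕ)) = 0 := by
      intro w
      rw [hz, Finset.sum_mul, map_sum, ← map_zero (algebraMap (MvPolynomial U k) E), ← hb1 w, map_sum]
      refine Finset.sum_congr rfl fun x _ => ?_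
      rw [mul_assoc, ← hsmul, map_smul, hmt, map_mul, smul_eq_mul]
    refine (traceForm_nondegenerate E F).1 z fun t => ?_
    rw [Algebra.traceForm_apply]
    have h6 : t ∈ Submodule.span E (Set.range fun β : Option ι → Fin δ => ∏ o : Option ι, (o.elim y η) ^ (β o : ℕ)) :=
      span_mon (fun o : Option ι => o.elim y η) δ (fun i => minpoly E _) (fun i => minpoly.monic (halg _)) hq
      (fun i => minpoly.aeval _ _) t (by rw [hgen]; trivial)
    induction h6 using Submodule.span_induction with
    | mem t ht => obtain ⟨w, rfl⟩ := ht; exact h5 w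
    | zero => simp
    | add t t' _ _ ht ht' => rw [mul_add, map_add, ht, ht', add_zero]
    | smul r t _ ht => rw [mul_smul_comm, map_smul, ht, smul_zero]
  -- the polynomial
  let cf : Fin (e + 1) → F := fun j => ∑ b', algebraMap _ F (b (j, b')) * v (ac b')
  have hmapK : ∀ a : MvPolynomial U k, algebraMap _ F a ∈ K0 := by
    intro a
    rw [IsScalarTower.algebraMap_apply (MvPolynomial U k) E F]
    exact K0.algebraMap_mem _
  have hcfK : ∀ j, cf j ∈ K0 := fun j => sum_mem fun b' _ => mul_mem (hmapK _) (hvK _)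
  have hcfrel : ∑ j, cf j * y ^ (j : ℕ) = 0 := by
    rw [← hz, Fintype.sum_prod_type]
    refine Finset.sum_congr rfl fun j _ => ?_
    rw [Finset.sum_mul]
    refine Finset.sum_congr rfl fun j _ => by ring
  have hcf0 : ∃ j, cf j ≠ 0 := by
    by_contra hcon
    push Not at hcon
    apply hb0
    funext x
    have h7 := hcon x.1
    simp only [cf, ← hsmul] at h7
    have := Fintype.linearIndependent_iff.1 hli (fun b' => algebraMap _ E (b (x.1, b'))) h7 x.2
    exact hAE (by rw [Pi.zero_apply, map_zero]; exact this)
  have hlast : cf (Fin.last e) ≠ 0 := by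
    intro h0
    let Q : Polynomial K0 := ∑ j : Fin (e + 1), Polynomial.monomial (j : ℕ) (⟨cf j, hcfK j⟩ : K0)
    have hQc : ∀ j : Fin (e + 1), Q.coeff j = ⟨cf j, hcfK j⟩ := by
      intro j
      simp only [Q, Polynomial.finsetSum_coeff, Polynomial.coeff_monomial]
      rw [Finset.sum_eq_single j]
      · simp
      · intro i _ hi
        rw [if_neg (fun h => hi (Fin.ext h))]
      · simp
    have hQ0 : Q ≠ 0 := by
      obtain ⟨j, hj⟩ := hcf0
      intro h
      apply hj
      have := hQc j
      rw [h, Polynomial.coeff_zero] at this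
      simpa using (congrArg Subtype.val this).symm
    have hQy : Polynomial.aeval y Q = 0 := by
      rw [← hcfrel]
      simp only [Q, map_sum, Polynomial.aeval_monomial]
      rfl
    have h8 := Polynomial.natDegree_le_natDegree (minpoly.degree_le_of_ne_zero K0 y hQ0 hQy)
    rw [← he] at h8
    have h9 : Q.natDegree ≤ e := Polynomial.natDegree_sum_le_of_forall_le _ _ fun j _ =>
      (Polynomial.natDegree_monomial_le _).trans (Nat.lt_succ_iff.1 j.2)
    have h10 : Q.natDegree = e := le_antisymm h9 h8
    have h11 : Q.coeff e ≠ 0 := by rw [← h10]; exact Polynomial.leadingCoeff_ne_zero.2 hQ0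
    apply h11
    have := hQc (Fin.last e)
    rw [Fin.val_last] at this
    rw [this]
    exact Subtype.ext h0
  -- extend by zero
  let a : (ι → Fin δ) → Fin (e + 1) → MvPolynomial U k := fun β j => ∑ b' : κ, if ac b' = β then b (j, b') else 0
  have ha : ∀ j, ∑ β : ι → Fin δ, algebraMap _ F (a β j) * ∏ i, η i ^ (β i : ℕ) = cf j := by
    intro j
    simp only [a, map_sum, Finset.sum_mul]
    rw [Finset.sum_comm]
    refine Finset.sum_congr rfl fun b' _ => ?_
    rw [Finset.sum_eq_single (ac b')]
    · simp [v]
    · intro β _ hβ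
      rw [if_neg (Ne.symm hβ), map_zero, zero_mul]
    · simp
  refine ⟨a, ?_, ?_, ?_⟩
  · intro β j
    refine totalDegree_finsetSum_le fun b' _ => ?_
    split_ifs
    · refine (hb2 _).trans (Nat.mul_le_mul_right _ (Nat.pow_le_pow_right two_pos ?_))
      rw [Fintype.card_prod, Fintype.card_fin, mul_comm]
      have hk : Fintype.card κ ≤ δ ^ Fintype.card ι := by
        have := Fintype.card_le_of_injective ac hai
        simpa using this
      exact Nat.mul_le_mul hk (by omega)
    · simp
  · simp only [ha]; exact hcfrel
  · rw [ha]; exact hlast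
end t7
end EF

namespace EF
section cf
variable {k : Type*} [Field k] {σ : Type*} [DecidableEq σ]

noncomputable def cf (c : σ) (j : ℕ) (p : MvPolynomial σ k) : MvPolynomial σ k :=
  (p.support.filter (fun m => m c = j)).sum fun m => monomial (Finsupp.erase c m) (p.coeff m)

lemma coeff_cf (c : σ) (j : ℕ) (p : MvPolynomial σ k) (m : σ →₀ ℕ) :
    coeff m (cf c j p) = if m c = 0 then coeff (m + Finsupp.single c j) p else 0 := by
  classical
  rw [cf, coeff_sum]
  simp only [coeff_monomial]
  split_ifs with h
  · rw [Finset.sum_eq_single (m + Finsupp.single c j)]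
    · rw [if_pos]
      ext i
      by_cases hi : i = c
      · subst hi; simp [h]
      · simp [Finsupp.erase_ne hi, Ne.symm hi]
    · intro m' hm' hne
      rw [if_neg]
      intro he
      apply hne
      rw [← he, ← (Finset.mem_filter.1 hm').2, Finsupp.erase_add_single]
    · intro hn
      rw [Finset.mem_filter, not_and_or] at hn
      rcases hn with hn | hn
      · rw [notMem_support_iff.1 hn]; simp
      · exact absurd (by simp [h]) hn
  · refine Finset.sum_eq_zero fun m' _ => ?_
    rw [if_neg]
    rintro rfl
    simp at h

lemma coeff_zero_of_notMem_vars {p : MvPolynomial σ k} {c : σ} (hc : c ∉ p.vars) {m : σ →₀ ℕ} (hm : m c ≠ 0) :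
    coeff m p = 0 := by
  by_contra h
  exact hc (by
    rw [mem_vars]
    exact ⟨m, mem_support_iff.2 h, Finsupp.mem_support_iff.2 hm⟩)

lemma notMem_vars_of_coeff {p : MvPolynomial σ k} {c : σ} (h : ∀ m : σ →₀ ℕ, m c ≠ 0 → coeff m p = 0) :
    c ∉ p.vars := by
  rw [mem_vars]
  rintro ⟨m, hm, hc⟩
  exact mem_support_iff.1 hm (h m (Finsupp.mem_support_iff.1 hc))

lemma vars_cf (c : σ) (j : ℕ) (p : MvPolynomial σ k) : (cf c j p).vars ⊆ p.vars.erase c := by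
  intro i hi
  rw [mem_vars] at hi
  obtain ⟨m, hm, hmi⟩ := hi
  rw [mem_support_iff, coeff_cf] at hm
  split_ifs at hm with h
  · have hic : i ≠ c := by
      rintro rfl
      exact Finsupp.mem_support_iff.1 hmi h
    rw [Finset.mem_erase]
    refine ⟨hic, ?_⟩
    rw [mem_vars]
    refine ⟨_, mem_support_iff.2 hm, ?_⟩
    rw [Finsupp.mem_support_iff] at hmi ⊢
    simp [hmi]
  · exact absurd rfl hm

lemma sum_cf (c : σ) (p : MvPolynomial σ k) :
    ∑ j ∈ Finset.range (degreeOf c p + 1), cf c j p * X c ^ j = p := by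
  classical
  have h : ∀ j, cf c j p * X c ^ j = (p.support.filter (fun m => m c = j)).sum fun m => monomial m (p.coeff m) := by
    intro j
    rw [cf, Finset.sum_mul]
    refine Finset.sum_congr rfl fun m hm => ?_
    rw [X_pow_eq_monomial, monomial_mul, mul_one, ← (Finset.mem_filter.1 hm).2, Finsupp.erase_add_single]
  simp only [h]
  rw [Finset.sum_fiberwise_of_maps_to]
  · exact (as_sum p).symm
  · intro m hm
    rw [Finset.mem_range, Nat.lt_succ_iff]
    exact monomial_le_degreeOf c hm

lemma coeff_sum_X (c : σ) (J : ℕ) (G : ℕ → MvPolynomial σ k) (hG : ∀ j ≤ J, c ∉ (G j).vars) (m : σ →₀ ℕ) :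
    coeff m (∑ j ∈ Finset.range (J + 1), G j * X c ^ j) =
      if m c ≤ J then coeff (Finsupp.erase c m) (G (m c)) else 0 := by
  classical
  rw [coeff_sum]
  have h1 : ∀ j ≤ J, coeff m (G j * X c ^ j) = if m c = j then coeff (Finsupp.erase c m) (G j) else 0 := by
    intro j hj
    rw [X_pow_eq_monomial, coeff_mul_monomial']
    split_ifs with h h' h'
    · rw [mul_one]
      congr 1
      ext i
      by_cases hi : i = c
      · subst hi; simp [h']
      · simp [Finsupp.erase_ne hi, Finsupp.single_apply, Ne.symm hi]
    · rw [coeff_zero_of_notMem_vars (hG j hj), zero_mul]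
      have := h c
      simp only [Finsupp.single_eq_same] at this
      simp only [Finsupp.coe_tsub, Pi.sub_apply, Finsupp.single_eq_same]
      omega
    · exfalso
      apply h
      intro i
      by_cases hi : i = c
      · subst hi; simp [h']
      · simp [Finsupp.single_apply, Ne.symm hi]
    · rfl
  rw [Finset.sum_congr rfl fun j hj => h1 j (Nat.lt_succ_iff.1 (Finset.mem_range.1 hj))]
  rw [Finset.sum_ite_eq]
  simp [Nat.lt_succ_iff]

lemma degreeOf_sum_X_le (c : σ) (J : ℕ) (G : ℕ → MvPolynomial σ k) (hG : ∀ j ≤ J, c ∉ (G j).vars) :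
    degreeOf c (∑ j ∈ Finset.range (J + 1), G j * X c ^ j) ≤ J := by
  rw [degreeOf_le_iff]
  intro m hm
  rw [mem_support_iff, coeff_sum_X c J G hG] at hm
  by_contra h
  rw [if_neg h] at hm
  exact hm rfl

lemma degreeOf_sum_X (c : σ) (J : ℕ) (G : ℕ → MvPolynomial σ k) (hG : ∀ j ≤ J, c ∉ (G j).vars) (h0 : G J ≠ 0) :
    degreeOf c (∑ j ∈ Finset.range (J + 1), G j * X c ^ j) = J := by
  refine le_antisymm (degreeOf_sum_X_le c J G hG) ?_
  obtain ⟨m, hm⟩ := exists_coeff_ne_zero h0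
  have hmc : m c = 0 := by
    by_contra h
    exact hm (coeff_zero_of_notMem_vars (hG J le_rfl) h)
  have : m + Finsupp.single c J ∈ (∑ j ∈ Finset.range (J + 1), G j * X c ^ j).support := by
    rw [mem_support_iff, coeff_sum_X c J G hG]
    have e : Finsupp.erase c (m + Finsupp.single c J) = m := by
      ext i
      by_cases hi : i = c
      · subst hi; simp [hmc]
      · simp [Finsupp.erase_ne hi, Finsupp.single_apply, Ne.symm hi]
    simpa [hmc, e] using hm
  have := monomial_le_degreeOf c this
  simpa [hmc] using this

lemma cf_sum_X (c : σ) (J : ℕ) (G : ℕ → MvPolynomial σ k) (hG : ∀ j ≤ J, c ∉ (G j).vars) (i : ℕ) (hi : i ≤ J) :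
    cf c i (∑ j ∈ Finset.range (J + 1), G j * X c ^ j) = G i := by
  ext m
  rw [coeff_cf]
  split_ifs with h
  · rw [coeff_sum_X c J G hG]
    have e : Finsupp.erase c (m + Finsupp.single c i) = m := by
      ext i
      by_cases hi : i = c
      · subst hi; simp [h]
      · simp [Finsupp.erase_ne hi, Finsupp.single_apply, Ne.symm hi]
    simp [h, e, hi]
  · exact (coeff_zero_of_notMem_vars (hG i hi) h).symm

end cf

section lc
variable {k : Type*} [Field k] {σ : Type*} [LinearOrder σ]
lemma leadCoeff_eq (c : σ) (p : MvPolynomial σ k) : leadCoeff c p = cf c (degreeOf c p) p := by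
  rw [cf]
  unfold leadCoeff
  refine Finset.sum_congr ?_ fun _ _ => rfl
  ext m; simp

/-- relation with class at c -/
def Rel {R : Type*} [CommRing R] [Algebra k R] (ξ : σ → R) (c : σ) (g : MvPolynomial σ k) : Prop :=
  (∀ i ∈ g.vars, i ≤ c) ∧ aeval ξ g = 0 ∧ 0 < degreeOf c g ∧ aeval ξ (leadCoeff c g) ≠ 0

end lc
end EF

namespace EF
section t7
variable {k : Type*} [Field k] [CharZero k] {U : Type*}
  {E F : Type*} [Field E] [Field F] [Algebra (MvPolynomial U k) E] [IsFractionRing (MvPolynomial U k) E]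
  [Algebra (MvPolynomial U k) F] [Algebra E F] [IsScalarTower (MvPolynomial U k) E F]
  [Algebra k F] [IsScalarTower k (MvPolynomial U k) F]
  {σ : Type*} [LinearOrder σ] [Fintype σ]

lemma aeval_Rel_min (c : σ) (x : σ → F) (K : Subfield F) (hk : ∀ a : k, algebraMap k F a ∈ K)
    (hx : ∀ i < c, x i ∈ K) (g : MvPolynomial σ k) (hg : Rel x c g) :
    (minpoly K (x c)).natDegree ≤ degreeOf c g := by
  classical
  obtain ⟨h1, h2, h3, h4⟩ := hg
  set e := degreeOf c g with he
  have hmem : ∀ j, aeval x (cf c j g) ∈ K := by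
    intro j
    rw [aeval_def, eval₂_eq]
    refine sum_mem fun m hm => mul_mem (hk _) (prod_mem fun i hi => pow_mem (hx i ?_) _)
    have hi' : i ∈ (cf c j g).vars := by
      rw [mem_vars_iff_mem_support]; exact ⟨m, hm, hi⟩
    have := Finset.mem_erase.1 (vars_cf c j g hi')
    exact lt_of_le_of_ne (h1 i this.2) this.1
  let Q : Polynomial K := ∑ j ∈ Finset.range (e + 1), Polynomial.monomial j (⟨aeval x (cf c j g), hmem j⟩ : K)
  have hQe : Q.coeff e = ⟨aeval x (cf c e g), hmem e⟩ := by
    simp only [Q, Polynomial.finsetSum_coeff, Polynomial.coeff_monomial]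
    rw [Finset.sum_ite_eq']
    simp
  have hQ0 : Q ≠ 0 := by
    intro h
    rw [h, Polynomial.coeff_zero] at hQe
    apply h4
    rw [leadCoeff_eq]
    exact (congrArg Subtype.val hQe).symm
  have hQx : Polynomial.aeval (x c) Q = 0 := by
    rw [← h2]
    conv_rhs => rw [← sum_cf c g]
    simp only [Q, map_sum, Polynomial.aeval_monomial, map_mul, map_pow, aeval_X]
    rfl
  have h8 := Polynomial.natDegree_le_natDegree (minpoly.degree_le_of_ne_zero K (x c) hQ0 hQx)
  refine h8.trans ?_
  refine Polynomial.natDegree_sum_le_of_forall_le _ _ fun j hj => ?_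
  exact (Polynomial.natDegree_monomial_le _).trans (Nat.lt_succ_iff.1 (Finset.mem_range.1 hj))

lemma t7b [FiniteDimensional E F] (c : σ) (x : σ → F) (em : U → σ) (hem : ∀ i, em i < c)
    (hxU : ∀ i, x (em i) = algebraMap _ F (X i : MvPolynomial U k))
    (l : σ → MvPolynomial U k) (hl : ∀ i, l i ≠ 0) (δ Δ : ℕ) (hld : ∀ i, (l i).totalDegree ≤ δ)
    (hintg : ∀ i ≤ c, IsIntegral (MvPolynomial U k) (algebraMap _ F (l i) * x i))
    (hgen : Algebra.adjoin E (Set.range fun o : Option {i // i < c} =>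
      o.elim (algebraMap _ F (l c) * x c) (fun i => algebraMap _ F (l i) * x i)) = ⊤)
    (hq : ∀ i ≤ c, (minpoly E (algebraMap _ F (l i) * x i)).natDegree ≤ δ)
    (hp : ∀ β : Option {i // i < c} → ℕ, (∀ o, β o ≤ 2 * δ) → ∃ p : MvPolynomial (Option U) k, p ≠ 0 ∧
      p.totalDegree ≤ Δ ∧
      Polynomial.aeval (∏ o : Option {i // i < c}, (o.elim (algebraMap _ F (l c) * x c) (fun i => algebraMap _ F (l i) * x i)) ^ β o)
        (optionEquivLeft k U p) = 0) :
    ∃ g : MvPolynomial σ k, Rel x c g ∧ (∀ g' : MvPolynomial σ k, Rel x c g' → degreeOf c g ≤ degreeOf c g') ∧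
      g.totalDegree ≤ 2 ^ (δ ^ Fintype.card {i // i < c} * (δ + 1)) * Δ + (Fintype.card {i // i < c} + 1) * (δ * (δ + 1)) := by
  classical
  have hAE : Function.Injective (algebraMap (MvPolynomial U k) E) := IsFractionRing.injective _ E
  have hAF : Function.Injective (algebraMap (MvPolynomial U k) F) := by
    rw [IsScalarTower.algebraMap_eq (MvPolynomial U k) E F]
    exact (algebraMap E F).injective.comp hAE
  have hlF : ∀ i, algebraMap (MvPolynomial U k) F (l i) ≠ 0 := fun i h => hl i (hAF (by rw [h, map_zero]))
  set η : {i // i < c} → F := fun i => algebraMap _ F (l i) * x i with hη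
  obtain ⟨e, he, heδ, a, had, ha0, ha1⟩ := t7a (E := E) η (algebraMap _ F (l c) * x c) δ Δ
    (fun i => hintg i i.2.le) (hintg c le_rfl) hgen (by
      intro o
      cases o with
      | none => exact hq c le_rfl
      | some i => exact hq i i.2.le) hp
  have hren : ∀ f : MvPolynomial U k, aeval x (rename em f) = algebraMap _ F f := by
    intro f
    rw [aeval_rename]
    have : x ∘ em = fun i => algebraMap _ F (X i : MvPolynomial U k) := funext hxU
    rw [this]
    have h2 : aeval (fun i => algebraMap _ F (X i : MvPolynomial U k)) = IsScalarTower.toAlgHom k (MvPolynomial U k) F := by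
      ext i; simp
    rw [h2]; rfl
  -- coefficients
  let G : ℕ → MvPolynomial σ k := fun j => if hj : j < e + 1 then
    (∑ β : {i // i < c} → Fin δ, rename em (a β ⟨j, hj⟩) * ∏ i : {i // i < c}, (rename em (l i) * X (i : σ)) ^ (β i : ℕ)) *
      rename em (l c) ^ j else 0
  have hvar : ∀ f : MvPolynomial U k, rename em f ∈ supported k (Set.Iio c) := by
    intro f
    have := vars_rename em f
    rw [mem_supported]
    intro i hi
    have h3 := this hi
    obtain ⟨u, _, rfl⟩ := Finset.mem_image.1 h3
    exact hem u
  have hGs : ∀ j, G j ∈ supported k (Set.Iio c) := by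
    intro j
    simp only [G]
    split_ifs with hj
    · refine mul_mem (sum_mem fun β _ => mul_mem (hvar _) (prod_mem fun i _ => pow_mem (mul_mem (hvar _) ?_) _)) (pow_mem (hvar _) _)
      exact Algebra.subset_adjoin ⟨i, i.2, rfl⟩
    · exact zero_mem _
  have hGv : ∀ j, ∀ i ∈ (G j).vars, i < c := fun j i hi => (mem_supported.1 (hGs j)) hi
  have hGc : ∀ j, c ∉ (G j).vars := fun j hj => lt_irrefl _ (hGv j c hj)
  have hGev : ∀ j (hj : j < e + 1), aeval x (G j) = (∑ β : {i // i < c} → Fin δ, algebraMap _ F (a β ⟨j, hj⟩) * ∏ i, η i ^ (β i : ℕ)) *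
      algebraMap _ F (l c) ^ j := by
    intro j hj
    simp only [G, dif_pos hj, map_mul, map_sum, map_prod, map_pow, hren, aeval_X, hη]
  have hGe : aeval x (G e) ≠ 0 := by
    rw [hGev e (Nat.lt_succ_self _)]
    exact mul_ne_zero ha1 (pow_ne_zero _ (hlF c))
  have hGe0 : G e ≠ 0 := fun h => hGe (by rw [h, map_zero])
  let g : MvPolynomial σ k := ∑ j ∈ Finset.range (e + 1), G j * X c ^ j
  have hgd : degreeOf c g = e := degreeOf_sum_X c e G (fun j _ => hGc j) hGe0
  have hge : aeval x g = 0 := by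
    have hg2 : g = ∑ j : Fin (e + 1), G j * X c ^ (j : ℕ) :=
      (Fin.sum_univ_eq_sum_range (fun j => G j * X c ^ j) (e + 1)).symm
    rw [hg2, ← ha0]
    simp only [map_sum, map_mul, map_pow, aeval_X]
    refine Finset.sum_congr rfl fun j _ => ?_
    rw [hGev j j.2]
    ring
  have hrel : Rel x c g := by
    refine ⟨?_, hge, ?_, ?_⟩
    · intro i hi
      have hs : g ∈ supported k (Set.Iic c) := by
        refine sum_mem fun j _ => mul_mem (supported_mono Set.Iio_subset_Iic_self (hGs j)) (pow_mem ?_ _)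
        exact Algebra.subset_adjoin ⟨c, Set.mem_Iic.2 le_rfl, rfl⟩
      exact (mem_supported.1 hs) hi
    · rw [hgd]
      rcases Nat.eq_zero_or_pos e with h | h
      · exfalso
        apply hGe
        have : g = G e := by
          simp only [g]; rw [h]; simp
        rw [← this]; exact hge
      · exact h
    · rw [leadCoeff_eq, hgd, cf_sum_X c e G (fun j _ => hGc j) e le_rfl]
      exact hGe
  refine ⟨g, hrel, ?_, ?_⟩
  · intro g' hg'
    rw [hgd]
    have hK : ∀ a : MvPolynomial U k, algebraMap _ F a ∈ IntermediateField.adjoin E (Set.range η) := by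
      intro a
      rw [IsScalarTower.algebraMap_apply (MvPolynomial U k) E F]
      exact IntermediateField.algebraMap_mem _ _
    have h5 := aeval_Rel_min c x (IntermediateField.adjoin E (Set.range η)).toSubfield
      (fun a => by
        rw [IsScalarTower.algebraMap_apply k (MvPolynomial U k) F]; exact hK _)
      (fun i hi => by
        have h6 : η ⟨i, hi⟩ ∈ IntermediateField.adjoin E (Set.range η) :=
          IntermediateField.subset_adjoin E _ (Set.mem_range_self _)
        have h7 : x i = (algebraMap _ F (l i))⁻¹ * η ⟨i, hi⟩ := by
          simp only [hη]; rw [inv_mul_cancel_left₀ (hlF i)]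
        rw [h7]
        exact mul_mem (inv_mem (hK _)) h6) g' hg'
    refine le_trans ?_ h5
    rw [he]
    set K0 := IntermediateField.adjoin E (Set.range η) with hK0
    have hintg' : IsIntegral K0 (x c) := by
      have : IsIntegral E (x c) := Algebra.IsIntegral.isIntegral _
      exact this.tower_top
    change _ ≤ (minpoly K0 (x c)).natDegree
    have h8 := Polynomial.scaleRoots_aeval_eq_zero (p := minpoly K0 (x c)) (r := (⟨_, hK (l c)⟩ : K0)) (minpoly.aeval K0 (x c))
    have h9 := Polynomial.natDegree_le_natDegree (minpoly.degree_le_of_ne_zero K0 _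
      (Polynomial.scaleRoots_ne_zero (minpoly.ne_zero hintg') _) h8)
    rw [Polynomial.natDegree_scaleRoots] at h9
    exact h9
  · refine totalDegree_finsetSum_le fun j hj => ?_
    have hj' := Finset.mem_range.1 hj
    refine (totalDegree_mul _ _).trans ?_
    have hX : (X c ^ j : MvPolynomial σ k).totalDegree ≤ δ * 1 := by
      refine (totalDegree_pow _ _).trans (Nat.mul_le_mul (by omega) (totalDegree_X _).le)
    have hr : ∀ f : MvPolynomial U k, (rename em f).totalDegree ≤ f.totalDegree := totalDegree_rename_le em
    have hlc : (rename em (l c) ^ j).totalDegree ≤ δ * δ :=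
      (totalDegree_pow _ _).trans (Nat.mul_le_mul (by omega) ((hr _).trans (hld c)))
    have hmain : (∑ β : {i // i < c} → Fin δ, rename em (a β ⟨j, hj'⟩) * ∏ i : {i // i < c}, (rename em (l i) * X (i : σ)) ^ (β i : ℕ)).totalDegree ≤
        2 ^ (δ ^ Fintype.card {i // i < c} * (δ + 1)) * Δ + Fintype.card {i // i < c} * (δ * (δ + 1)) := by
      refine totalDegree_finsetSum_le fun β _ => ?_
      refine (totalDegree_mul _ _).trans (Nat.add_le_add ((hr _).trans (had _ _)) ?_)
      refine (totalDegree_finsetProd _ _).trans ?_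
      refine (Finset.sum_le_card_nsmul _ _ (δ * (δ + 1)) ?_).trans (by simp)
      intro i _
      refine (totalDegree_pow _ _).trans (Nat.mul_le_mul (β i).2.le ?_)
      exact (totalDegree_mul _ _).trans (Nat.add_le_add ((hr _).trans (hld _)) (totalDegree_X _).le)
    have hGj : (G j).totalDegree ≤ 2 ^ (δ ^ Fintype.card {i // i < c} * (δ + 1)) * Δ + Fintype.card {i // i < c} * (δ * (δ + 1)) + δ * δ := by
      simp only [G, dif_pos hj']
      exact (totalDegree_mul _ _).trans (Nat.add_le_add hmain hlc)
    refine (Nat.add_le_add hGj hX).trans (le_of_eq (by ring))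
end t7
end EF

namespace EF
section tr
variable {k : Type*} [Field k] {σ : Type*} [LinearOrder σ]

lemma aeval_congr_vars {R : Type*} [CommRing R] [Algebra k R] (x y : σ → R) (g : MvPolynomial σ k)
    (h : ∀ i ∈ g.vars, x i = y i) : aeval x g = aeval y g := by
  refine eval₂Hom_congr' rfl ?_ rfl
  intro i hi _
  exact h i hi

lemma vars_leadCoeff (c : σ) (g : MvPolynomial σ k) : (leadCoeff c g).vars ⊆ g.vars.erase c := by
  classical
  rw [leadCoeff_eq]
  convert vars_cf c (degreeOf c g) g

lemma rel_iff {R S : Type*} [CommRing R] [Algebra k R] [CommRing S] [Algebra k S] (φ : R →ₐ[k] S)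
    (hφ : Function.Injective φ) (x : σ → R) (y : σ → S) (c : σ) (hxy : ∀ i ≤ c, φ (x i) = y i) (g : MvPolynomial σ k) :
    Rel x c g ↔ Rel y c g := by
  have key : ∀ f : MvPolynomial σ k, (∀ i ∈ f.vars, i ≤ c) → aeval y f = φ (aeval x f) := by
    intro f hf
    rw [← AlgHom.comp_apply, comp_aeval]
    exact aeval_congr_vars _ _ _ fun i hi => (hxy i (hf i hi)).symm
  unfold Rel
  refine and_congr_right fun h1 => ?_
  rw [key g h1, key (leadCoeff c g) (fun i hi => h1 i (Finset.mem_of_mem_erase (vars_leadCoeff c g hi))),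
    map_eq_zero_iff φ hφ, Ne, Ne, map_eq_zero_iff φ hφ]
end tr

section t7
variable {k : Type*} [Field k] [CharZero k] {U : Type*}
  {L : Type*} [Field L] [Algebra (MvPolynomial U k) L]
  [Algebra k L] [IsScalarTower k (MvPolynomial U k) L]
  {σ : Type*} [LinearOrder σ] [Fintype σ]

lemma t7c (E : Type*) [Field E] [Algebra (MvPolynomial U k) E] [IsFractionRing (MvPolynomial U k) E]
    [Algebra E L] [IsScalarTower (MvPolynomial U k) E L]
    [Algebra k E] [IsScalarTower k (MvPolynomial U k) E] [IsScalarTower k E L] (c : σ) (x : σ → L) (em : U → σ) (hem : ∀ i, em i < c)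
    (hxU : ∀ i, x (em i) = algebraMap _ L (X i : MvPolynomial U k))
    (l : σ → MvPolynomial U k) (hl : ∀ i, l i ≠ 0) (δ Δ : ℕ) (hld : ∀ i, (l i).totalDegree ≤ δ)
    (hintg : ∀ i ≤ c, IsIntegral (MvPolynomial U k) (algebraMap _ L (l i) * x i))
    (hq : ∀ i ≤ c, ∃ q : Polynomial (MvPolynomial U k), q ≠ 0 ∧ q.natDegree ≤ δ ∧ Polynomial.aeval (algebraMap _ L (l i) * x i) q = 0)
    (hp : ∀ β : Option {i // i < c} → ℕ, (∀ o, β o ≤ 2 * δ) → ∃ p : MvPolynomial (Option U) k, p ≠ 0 ∧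
      p.totalDegree ≤ Δ ∧
      Polynomial.aeval (∏ o : Option {i // i < c}, (o.elim (algebraMap _ L (l c) * x c) (fun i => algebraMap _ L (l i) * x i)) ^ β o)
        (optionEquivLeft k U p) = 0) :
    ∃ g : MvPolynomial σ k, Rel x c g ∧ (∀ g' : MvPolynomial σ k, Rel x c g' → degreeOf c g ≤ degreeOf c g') ∧
      g.totalDegree ≤ 2 ^ (δ ^ Fintype.card {i // i < c} * (δ + 1)) * Δ + (Fintype.card {i // i < c} + 1) * (δ * (δ + 1)) := by
  classical
  have hAE : Function.Injective (algebraMap (MvPolynomial U k) E) := IsFractionRing.injective _ E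
  have hAL : Function.Injective (algebraMap (MvPolynomial U k) L) := by
    rw [IsScalarTower.algebraMap_eq (MvPolynomial U k) E L]
    exact (algebraMap E L).injective.comp hAE
  have hlL : ∀ i, algebraMap (MvPolynomial U k) L (l i) ≠ 0 := fun i h => hl i (hAL (by rw [h, map_zero]))
  let θ : Option {i // i < c} → L := fun o => o.elim (algebraMap _ L (l c) * x c) (fun i => algebraMap _ L (l i) * x i)
  have hθint : ∀ o, IsIntegral E (θ o) := by
    intro o
    cases o with
    | none => exact (hintg c le_rfl).tower_top
    | some i => exact (hintg i i.2.le).tower_top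
  let F := IntermediateField.adjoin E (Set.range θ)
  have hfd : FiniteDimensional E F := IntermediateField.finiteDimensional_adjoin (by
    rintro _ ⟨o, rfl⟩; exact hθint o)
  have hAF : ∀ a : MvPolynomial U k, algebraMap _ L a ∈ F := by
    intro a
    rw [IsScalarTower.algebraMap_apply (MvPolynomial U k) E L]
    exact IntermediateField.algebraMap_mem _ _
  have hθF : ∀ i ≤ c, algebraMap _ L (l i) * x i ∈ F := by
    intro i hi
    rcases hi.lt_or_eq with h | rfl
    · exact IntermediateField.subset_adjoin E (Set.range θ) ⟨some ⟨i, h⟩, rfl⟩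
    · exact IntermediateField.subset_adjoin E (Set.range θ) ⟨none, rfl⟩
  have hxF : ∀ i ≤ c, x i ∈ F := by
    intro i hi
    have h7 : x i = (algebraMap _ L (l i))⁻¹ * (algebraMap _ L (l i) * x i) := by
      rw [inv_mul_cancel_left₀ (hlL i)]
    rw [h7]
    exact mul_mem (inv_mem (hAF _)) (hθF i hi)
  let xF : σ → F := fun i => if h : i ≤ c then ⟨x i, hxF i h⟩ else 0
  have hxF' : ∀ i ≤ c, ((xF i : F) : L) = x i := fun i hi => by simp only [xF, dif_pos hi]
  have hval : ∀ i ≤ c, ((algebraMap (MvPolynomial U k) F (l i) * xF i : F) : L) = algebraMap _ L (l i) * x i := by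
    intro i hi
    rw [MulMemClass.coe_mul, hxF' i hi]; rfl
  have hiF : Function.Injective (algebraMap F L) := (algebraMap F L).injective
  have hvals : ∀ o : Option {i // i < c}, ((o.elim (algebraMap _ F (l c) * xF c) (fun i => algebraMap _ F (l i) * xF i) : F) : L) = θ o := by
    intro o
    cases o with
    | none => exact hval c le_rfl
    | some i => exact hval i i.2.le
  have hT1 : IsScalarTower (MvPolynomial U k) F L := IsScalarTower.of_algebraMap_eq fun a => rfl
  have hT2 : IsScalarTower k F L := IsScalarTower.of_algebraMap_eq fun a => rfl
  have haev : ∀ (z : F) (q : Polynomial (MvPolynomial U k)), Polynomial.aeval z q = 0 ↔ Polynomial.aeval (z : L) q = 0 := by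
    intro z q
    rw [← map_eq_zero_iff (algebraMap F L) hiF, ← Polynomial.aeval_algebraMap_apply]
    rfl
  have hkF : IsScalarTower k (MvPolynomial U k) F := by
    refine IsScalarTower.of_algebraMap_eq fun a => ?_
    apply Subtype.ext
    change algebraMap k L a = algebraMap (MvPolynomial U k) L (algebraMap k _ a)
    rw [← IsScalarTower.algebraMap_apply]
  obtain ⟨g, hg1, hg2, hg3⟩ := t7b (E := E) (F := F) c xF em hem (by
      intro i
      apply Subtype.ext
      rw [hxF' _ (hem i).le, hxU]; rfl) l hl δ Δ hld (by
      intro i hi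
      have h1 := hintg i hi
      rw [← hval i hi] at h1
      exact (isIntegral_algebraMap_iff (A := F) hiF).1 h1) (by
      have h1 : (⊤ : IntermediateField E F) = IntermediateField.adjoin E (Set.range fun o : Option {i // i < c} =>
          o.elim (algebraMap _ F (l c) * xF c) (fun i => algebraMap _ F (l i) * xF i)) := by
        apply IntermediateField.map_injective F.val
        rw [IntermediateField.adjoin_map, ← Set.range_comp, ← AlgHom.fieldRange_eq_map, IntermediateField.fieldRange_val]
        change IntermediateField.adjoin E (Set.range θ) = _
        congr 2
        funext o
        exact (hvals o).symm
      rw [← IntermediateField.adjoin_toSubalgebra_of_isAlgebraic (fun z _ => Algebra.IsAlgebraic.isAlgebraic z), ← h1]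
      rfl) (by
      intro i hi
      obtain ⟨q, hq0, hqd, hqe⟩ := hq i hi
      rw [← hval i hi, ← haev] at hqe
      have h2 := minpoly.degree_le_of_ne_zero E (algebraMap _ F (l i) * xF i) (p := q.map (algebraMap _ E))
        (by rw [Ne, Polynomial.map_eq_zero_iff hAE]; exact hq0) (by rw [Polynomial.aeval_map_algebraMap]; exact hqe)
      refine (Polynomial.natDegree_le_natDegree h2).trans (Polynomial.natDegree_map_le.trans hqd)) (by
      intro β hβ
      obtain ⟨p, h0, h1, h2⟩ := hp β hβ
      refine ⟨p, h0, h1, ?_⟩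
      rw [haev]
      convert h2 using 3
      rw [← IntermediateField.algebraMap_apply, map_prod]
      refine Finset.prod_congr rfl fun o _ => ?_
      rw [map_pow, IntermediateField.algebraMap_apply, hvals])
  have hiff : ∀ f : MvPolynomial σ k, Rel xF c f ↔ Rel x c f := by
    intro f
    refine rel_iff (IsScalarTower.toAlgHom k F L) hiF xF x c ?_ f
    intro i hi
    exact hxF' i hi
  exact ⟨g, (hiff g).1 hg1, fun g' hg' => hg2 g' ((hiff g').2 hg'), hg3⟩
end t7
end EF

namespace EF
section ind
variable {k : Type*} [Field k] {σ : Type*} [LinearOrder σ] [Fintype σ] {R : Type*} [CommRing R] [IsDomain R] [Algebra k R]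

lemma exists_indep (ξ : σ → R) (c : σ) (hex : ∃ g : MvPolynomial σ k, Rel ξ c g) :
    ∃ U0 : Finset σ, (∀ i ∈ U0, i < c) ∧ AlgebraicIndependent k (fun i : U0 => ξ i) ∧
      ∀ i ≤ c, IsAlgebraic (Algebra.adjoin k (Set.range (fun i : U0 => ξ i))) (ξ i) := by
  classical
  have hinj : Function.Injective (algebraMap k R) := (algebraMap k R).injective
  let P : Finset (Finset σ) := Finset.univ.filter fun U => (∀ i ∈ U, i < c) ∧ AlgebraicIndepOn k ξ (U : Set σ)
  have hP : P.Nonempty := ⟨∅, by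
    simp only [P, Finset.mem_filter, Finset.mem_univ, true_and]
    refine ⟨by simp, ?_⟩
    rw [Finset.coe_empty]
    exact (algebraicIndependent_empty_type_iff (R := k)).2 hinj⟩
  obtain ⟨U0, hU0, hmax⟩ := P.exists_max_image Finset.card hP
  simp only [P, Finset.mem_filter, Finset.mem_univ, true_and] at hU0 hmax
  have hrange : Set.range (fun i : U0 => ξ i) = ξ '' (U0 : Set σ) := by
    ext z; simp
  have hlt : ∀ i < c, IsAlgebraic (Algebra.adjoin k (Set.range (fun i : U0 => ξ i))) (ξ i) := by
    intro i hi
    by_cases hiU : i ∈ U0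
    · exact isAlgebraic_algebraMap (⟨ξ i, Algebra.subset_adjoin ⟨⟨i, hiU⟩, rfl⟩⟩ : Algebra.adjoin k (Set.range (fun i : U0 => ξ i)))
    · by_contra hcon
      rw [hrange] at hcon
      have h1 := (AlgebraicIndepOn.insert_iff (R := k) (x := ξ) (s := (U0 : Set σ)) (i := i) (by simpa using hiU)).2 ⟨hU0.2, hcon⟩
      have h2 := hmax (insert i U0) ⟨by
        intro j hj
        rcases Finset.mem_insert.1 hj with rfl | hj
        · exact hi
        · exact hU0.1 j hj, by rw [Finset.coe_insert]; exact h1⟩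
      rw [Finset.card_insert_of_notMem hiU] at h2
      omega
  refine ⟨U0, hU0.1, hU0.2, ?_⟩
  intro i hi
  rcases hi.lt_or_eq with h | rfl
  · exact hlt i h
  obtain ⟨g, h1, h2, h3, h4⟩ := hex
  set R0 := Algebra.adjoin k (Set.range (fun i : U0 => ξ i))
  let Sc := Subalgebra.algebraicClosure R0 R
  have hmem : ∀ j, aeval ξ (cf i j g) ∈ Sc := by
    intro j
    rw [aeval_def, eval₂_eq]
    refine sum_mem fun m hm => mul_mem ?_ (prod_mem fun i' hi' => pow_mem (hlt i' ?_) _)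
    · exact isAlgebraic_algebraMap (algebraMap k R0 (coeff m (cf i j g)))
    have hi'' : i' ∈ (cf i j g).vars := by
      rw [mem_vars_iff_mem_support]; exact ⟨m, hm, hi'⟩
    have := Finset.mem_erase.1 (vars_cf i j g hi'')
    exact lt_of_le_of_ne (h1 i' this.2) this.1
  set e := degreeOf i g with he
  let Q : Polynomial Sc := ∑ j ∈ Finset.range (e + 1), Polynomial.monomial j (⟨aeval ξ (cf i j g), hmem j⟩ : Sc)
  have hQe : Q.coeff e = ⟨aeval ξ (cf i e g), hmem e⟩ := by
    simp only [Q, Polynomial.finsetSum_coeff, Polynomial.coeff_monomial]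
    rw [Finset.sum_ite_eq']
    simp
  have hQ0 : Q ≠ 0 := by
    intro h
    rw [h, Polynomial.coeff_zero] at hQe
    apply h4
    rw [leadCoeff_eq]
    exact (congrArg Subtype.val hQe).symm
  have hQx : Polynomial.aeval (ξ i) Q = 0 := by
    rw [← h2]
    conv_rhs => rw [← sum_cf i g]
    simp only [Q, map_sum, Polynomial.aeval_monomial, map_mul, map_pow, aeval_X]
    rfl
  have h9 : IsAlgebraic Sc (ξ i) := ⟨Q, hQ0, hQx⟩
  exact h9.restrictScalars R0

lemma aeval_oel {U S : Type*} [CommRing S] [Algebra k S] [Algebra (MvPolynomial U k) S]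
    [IsScalarTower k (MvPolynomial U k) S] (z : S) (p : MvPolynomial (Option U) k) :
    Polynomial.aeval z (optionEquivLeft k U p) =
      aeval (fun o : Option U => o.elim z (fun i => algebraMap (MvPolynomial U k) S (X i))) p := by
  have h : ((Polynomial.aeval z).restrictScalars k).comp (optionEquivLeft k U).toAlgHom =
      aeval (R := k) (fun o : Option U => o.elim z (fun i => algebraMap (MvPolynomial U k) S (X i))) := by
    apply MvPolynomial.algHom_ext
    intro o
    cases o <;> simp [optionEquivLeft_X_none, optionEquivLeft_X_some]
  exact DFunLike.congr_fun h p

lemma totalDegree_aeval_le' {τ U : Type*} (u : U → MvPolynomial τ k) (d : ℕ) (hu : ∀ i, (u i).totalDegree ≤ d)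
    (p : MvPolynomial U k) : (aeval u p).totalDegree ≤ p.totalDegree * d := by
  rw [aeval_def, eval₂_eq]
  refine totalDegree_finsetSum_le fun m hm => ?_
  refine (totalDegree_mul _ _).trans ?_
  have h1 : (algebraMap k (MvPolynomial τ k) (coeff m p)).totalDegree = 0 := totalDegree_C _
  rw [h1, zero_add]
  refine (totalDegree_finsetProd _ _).trans ?_
  calc ∑ i ∈ m.support, (u i ^ m i).totalDegree ≤ ∑ i ∈ m.support, m i * d :=
        Finset.sum_le_sum fun i _ => (totalDegree_pow _ _).trans (Nat.mul_le_mul_left _ (hu i))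
    _ = (m.sum fun _ e => e) * d := by rw [← Finset.sum_mul]; rfl
    _ ≤ _ := Nat.mul_le_mul_right _ (le_totalDegree hm)
end ind

def dl (m d : ℕ) : ℕ := (m + 1) * pD m d
def d2 (s m d : ℕ) : ℕ := (s + 1) * (2 * dl m d * ((dl m d + 1) * d))
def tB (s m d : ℕ) : ℕ := 2 ^ (dl m d ^ s * (dl m d + 1)) * dl m (d2 s m d) + (s + 1) * (dl m d * (dl m d + 1))

lemma dl_pos (m d : ℕ) : 1 ≤ dl m d := by
  unfold dl pD; exact Nat.succ_le_of_lt (by positivity)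

section t7
variable {k : Type*} [Field k] [CharZero k] {σ : Type*} [LinearOrder σ] [Fintype σ] {τ : Type*} [Fintype τ]

theorem t7 (ξ : σ → MvPolynomial τ k) (d : ℕ) (hd : 1 ≤ d) (hξ : ∀ i, (ξ i).totalDegree ≤ d) (c : σ)
    (hex : ∃ g : MvPolynomial σ k, Rel ξ c g) :
    ∃ g : MvPolynomial σ k, Rel ξ c g ∧ (∀ g' : MvPolynomial σ k, Rel ξ c g' → degreeOf c g ≤ degreeOf c g') ∧
      g.totalDegree ≤ tB (Fintype.card σ) (Fintype.card τ) d := by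
  classical
  obtain ⟨U0, hU0c, hind, halg⟩ := exists_indep ξ c hex
  set m := Fintype.card τ with hm
  set δ := dl m d with hδ
  let u : U0 → MvPolynomial τ k := fun i => ξ i
  have hP : ∀ i ≤ c, ∃ p : MvPolynomial (Option U0) k, p ≠ 0 ∧ aeval (fun o => o.elim (ξ i) u) p = 0 ∧ p.totalDegree ≤ δ :=
    fun i hi => perron u hind (ξ i) (halg i hi) d hd (fun j => hξ j) (hξ i)
  choose! P hP0 hPe hPd using hP
  let l : σ → MvPolynomial U0 k := fun i => if i ≤ c then (optionEquivLeft k U0 (P i)).leadingCoeff else 1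
  have hl : ∀ i, l i ≠ 0 := by
    intro i
    by_cases hi : i ≤ c
    · simp only [l, if_pos hi, ne_eq, Polynomial.leadingCoeff_eq_zero]
      intro h
      exact hP0 i hi ((map_eq_zero_iff _ (optionEquivLeft k U0).injective).1 h)
    · simp [l, if_neg hi]
  have hld : ∀ i, (l i).totalDegree ≤ δ := by
    intro i
    by_cases hi : i ≤ c
    · simp only [l, if_pos hi]
      refine le_trans ?_ (hPd i hi)
      exact totalDegree_coeff_optionEquivLeft_le k U0 _ _
    · simp [l, if_neg hi]
  let algAR : Algebra (MvPolynomial U0 k) (MvPolynomial τ k) := (aeval u).toRingHom.toAlgebra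
  have hAR : ∀ a : MvPolynomial U0 k, algebraMap _ (MvPolynomial τ k) a = aeval u a := fun a => rfl
  have tkAR : IsScalarTower k (MvPolynomial U0 k) (MvPolynomial τ k) :=
    IsScalarTower.of_algebraMap_eq fun a => ((aeval u).commutes a).symm
  let L := FractionRing (MvPolynomial τ k)
  have hRL : Function.Injective (algebraMap (MvPolynomial τ k) L) := IsFractionRing.injective _ _
  have tkAL : IsScalarTower k (MvPolynomial U0 k) L := by
    refine IsScalarTower.of_algebraMap_eq fun a => ?_
    rw [IsScalarTower.algebraMap_apply k (MvPolynomial τ k) L, IsScalarTower.algebraMap_apply (MvPolynomial U0 k) (MvPolynomial τ k) L,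
      ← IsScalarTower.algebraMap_apply k (MvPolynomial U0 k) (MvPolynomial τ k)]
  have hARinj : Function.Injective (algebraMap (MvPolynomial U0 k) (MvPolynomial τ k)) := hind
  have hALinj : Function.Injective (algebraMap (MvPolynomial U0 k) L) := by
    rw [IsScalarTower.algebraMap_eq (MvPolynomial U0 k) (MvPolynomial τ k) L]
    exact hRL.comp hARinj
  have : FaithfulSMul (MvPolynomial U0 k) L := (faithfulSMul_iff_algebraMap_injective _ _).2 hALinj
  let := FractionRing.liftAlgebra (MvPolynomial U0 k) L
  have := FractionRing.isScalarTower_liftAlgebra (MvPolynomial U0 k) L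
  have : IsScalarTower k (FractionRing (MvPolynomial U0 k)) L := by
    refine IsScalarTower.of_algebraMap_eq fun a => ?_
    rw [IsScalarTower.algebraMap_apply k (MvPolynomial U0 k) (FractionRing (MvPolynomial U0 k)),
      ← IsScalarTower.algebraMap_apply (MvPolynomial U0 k) (FractionRing (MvPolynomial U0 k)) L,
      ← IsScalarTower.algebraMap_apply]
  have hpoly : ∀ (y : MvPolynomial τ k) (p : MvPolynomial (Option U0) k), aeval (fun o => o.elim y u) p = 0 →
      Polynomial.aeval (algebraMap (MvPolynomial τ k) L y) (optionEquivLeft k U0 p) = 0 := by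
    intro y p h
    rw [Polynomial.aeval_algebraMap_apply, aeval_oel]
    have h1 : (fun o : Option U0 => o.elim y (fun i => algebraMap (MvPolynomial U0 k) (MvPolynomial τ k) (X i))) =
        fun o => o.elim y u := by
      funext o
      cases o with
      | none => rfl
      | some i => simp [hAR]
    rw [h1, h, map_zero]
  let x : σ → L := fun i => algebraMap _ L (ξ i)
  have hxi : ∀ i, algebraMap (MvPolynomial U0 k) L (l i) * x i = algebraMap (MvPolynomial τ k) L (aeval u (l i) * ξ i) := by
    intro i
    rw [map_mul, IsScalarTower.algebraMap_apply (MvPolynomial U0 k) (MvPolynomial τ k) L]; rfl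
  set R0 := Algebra.adjoin k (Set.range (fun i : U0 => ξ i))
  have hlalg : ∀ i ≤ c, aeval u (l i) * ξ i ∈ Subalgebra.algebraicClosure R0 (MvPolynomial τ k) := by
    intro i hi
    refine mul_mem ?_ (halg i hi)
    have h1 : aeval u (l i) ∈ R0 := by
      change _ ∈ Algebra.adjoin k (Set.range u)
      rw [Algebra.adjoin_range_eq_range_aeval]
      exact ⟨l i, rfl⟩
    exact isAlgebraic_algebraMap (⟨_, h1⟩ : R0)
  have hldeg : ∀ i, (aeval u (l i) * ξ i).totalDegree ≤ (δ + 1) * d := by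
    intro i
    refine (totalDegree_mul _ _).trans ?_
    rw [add_mul, one_mul]
    exact add_le_add ((totalDegree_aeval_le' u d (fun j => hξ j) (l i)).trans (Nat.mul_le_mul_right _ (hld i))) (hξ i)
  have hcard : Fintype.card {i // i < c} ≤ Fintype.card σ := Fintype.card_subtype_le _
  obtain ⟨g, hg1, hg2, hg3⟩ := t7c (FractionRing (MvPolynomial U0 k)) c x (fun i : U0 => (i : σ)) (fun i => hU0c i i.2)
    (by
      intro i
      rw [IsScalarTower.algebraMap_apply (MvPolynomial U0 k) (MvPolynomial τ k) L, hAR, aeval_X]) l hl δ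
    (dl m (d2 (Fintype.card σ) m d)) hld
    (by
      intro i hi
      have h1 := isIntegral_leadingCoeff_smul (optionEquivLeft k U0 (P i)) (x i) (hpoly _ _ (hPe i hi))
      rw [Algebra.smul_def] at h1
      simpa only [l, if_pos hi] using h1)
    (by
      intro i hi
      refine ⟨(optionEquivLeft k U0 (P i)).scaleRoots (l i), ?_, ?_, Polynomial.scaleRoots_aeval_eq_zero (hpoly _ _ (hPe i hi))⟩
      · apply Polynomial.scaleRoots_ne_zero
        intro h
        exact hP0 i hi ((map_eq_zero_iff _ (optionEquivLeft k U0).injective).1 h)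
      · rw [Polynomial.natDegree_scaleRoots, natDegree_optionEquivLeft]
        exact (degreeOf_le_totalDegree _ _).trans (hPd i hi))
    (by
      intro β hβ
      let y : MvPolynomial τ k := ∏ o : Option {i // i < c}, (o.elim (aeval u (l c) * ξ c) (fun i => aeval u (l i) * ξ i)) ^ β o
      have hy1 : y ∈ Subalgebra.algebraicClosure R0 (MvPolynomial τ k) := by
        refine prod_mem fun o _ => pow_mem ?_ _
        cases o with
        | none => exact hlalg c le_rfl
        | some i => exact hlalg i i.2.le
      have hyd : y.totalDegree ≤ d2 (Fintype.card σ) m d := by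
        refine (totalDegree_finsetProd _ _).trans ?_
        calc _ ≤ ∑ o : Option {i // i < c}, (2 * δ) * ((δ + 1) * d) := by
              refine Finset.sum_le_sum fun o _ => (totalDegree_pow _ _).trans (Nat.mul_le_mul (hβ o) ?_)
              cases o with
              | none => exact hldeg c
              | some i => exact hldeg i
          _ = (Fintype.card {i // i < c} + 1) * (2 * δ * ((δ + 1) * d)) := by
              rw [Finset.sum_const, Finset.card_univ, Fintype.card_option, smul_eq_mul]
          _ ≤ _ := Nat.mul_le_mul_right _ (Nat.succ_le_succ hcard)
      have hd2 : d ≤ d2 (Fintype.card σ) m d := by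
        unfold d2
        have := dl_pos m d
        calc d = 1 * (1 * (1 * d)) := by ring
          _ ≤ _ := Nat.mul_le_mul (by omega) (Nat.mul_le_mul (by omega) (Nat.mul_le_mul_right _ (by omega)))
      obtain ⟨p, hp0, hpe, hpd⟩ := perron u hind y hy1 (d2 (Fintype.card σ) m d) (hd.trans hd2) (fun j => (hξ j).trans hd2) hyd
      refine ⟨p, hp0, hpd, ?_⟩
      have h2 := hpoly y p hpe
      have h3 : algebraMap (MvPolynomial τ k) L y = ∏ o : Option {i // i < c}, (o.elim (algebraMap _ L (l c) * x c) (fun i => algebraMap _ L (l i) * x i)) ^ β o := by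
        rw [map_prod]
        refine Finset.prod_congr rfl fun o _ => ?_
        rw [map_pow]
        cases o with
        | none => exact congrArg (· ^ _) (hxi c).symm
        | some i => exact congrArg (· ^ _) (hxi i).symm
      rw [h3] at h2
      exact h2)
  have hiff : ∀ f : MvPolynomial σ k, Rel ξ c f ↔ Rel x c f := by
    intro f
    exact rel_iff (IsScalarTower.toAlgHom k (MvPolynomial τ k) L) hRL ξ x c (fun i hi => rfl) f
  refine ⟨g, (hiff g).2 hg1, fun g' hg' => hg2 g' ((hiff g').1 hg'), hg3.trans ?_⟩
  unfold tB
  rw [← hδ]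
  refine add_le_add (Nat.mul_le_mul_right _ (Nat.pow_le_pow_right (by norm_num) (Nat.mul_le_mul_right _ (Nat.pow_le_pow_right (dl_pos m d) hcard)))) (Nat.mul_le_mul_right _ (Nat.succ_le_succ hcard))
end t7
end EF

namespace EF
section tri
variable {k : Type*} [Field k] {σ : Type*} [LinearOrder σ]

lemma degreeOf_eq_zero_iff_notMem_vars {c : σ} {f : MvPolynomial σ k} : degreeOf c f = 0 ↔ c ∉ f.vars := by
  rw [mem_vars_iff_degreeOf_ne_zero, not_not]

lemma mem_supp_le (c : σ) (f : MvPolynomial σ k) : f ∈ supported k (Set.Iic c) ↔ ∀ i ∈ f.vars, i ≤ c := by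
  rw [mem_supported]
  exact ⟨fun h i hi => h hi, fun h i hi => h i hi⟩

lemma degreeOf_leadCoeff (c : σ) (f : MvPolynomial σ k) : degreeOf c (leadCoeff c f) = 0 := by
  classical
  by_contra h
  have h1 : c ∈ (leadCoeff c f).vars := by
    by_contra h2
    exact h (degreeOf_eq_zero_iff_notMem_vars.2 h2)
  have := vars_leadCoeff c f h1
  simp at this

/-- splitting off the leading term -/
lemma split_lead (c : σ) (f : MvPolynomial σ k) (hf : 0 < degreeOf c f) :
    ∃ f0 : MvPolynomial σ k, f = leadCoeff c f * X c ^ degreeOf c f + f0 ∧ degreeOf c f0 < degreeOf c f := by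
  classical
  obtain ⟨e, he⟩ : ∃ e, degreeOf c f = e + 1 := ⟨degreeOf c f - 1, by omega⟩
  refine ⟨∑ j ∈ Finset.range (e + 1), cf c j f * X c ^ j, ?_, ?_⟩
  · conv_lhs => rw [← sum_cf c f]
    rw [Finset.sum_range_succ, leadCoeff_eq, he, add_comm]
  · rw [he, Nat.lt_succ_iff]
    refine degreeOf_sum_X_le c e (fun j => cf c j f) fun j _ h => ?_
    have := vars_cf c j f h
    simp at this

lemma sat_main [Finite σ] {R : Type*} [CommRing R] [IsDomain R] [Algebra k R] (ξ : σ → R)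
    (γ : σ → MvPolynomial σ k) (h : MvPolynomial σ k) (J : Ideal (MvPolynomial σ k))
    (hγ : ∀ c, (∃ g : MvPolynomial σ k, Rel ξ c g) → Rel ξ c (γ c) ∧
      (∀ g' : MvPolynomial σ k, Rel ξ c g' → degreeOf c (γ c) ≤ degreeOf c g') ∧ leadCoeff c (γ c) ∣ h ∧ γ c ∈ J) :
    ∀ c : σ, ∀ f : MvPolynomial σ k, (∀ i ∈ f.vars, i ≤ c) → aeval ξ f = 0 → ∃ N : ℕ, h ^ N * f ∈ J := by
  classical
  have hinj : Function.Injective (algebraMap k R) := (algebraMap k R).injective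
  intro c
  induction c using WellFoundedLT.induction with
  | ind c ihc =>
  have main : ∀ e : ℕ, ∀ f : MvPolynomial σ k, degreeOf c f = e → (∀ i ∈ f.vars, i ≤ c) → aeval ξ f = 0 →
      ∃ N : ℕ, h ^ N * f ∈ J := by
    intro e
    induction e using Nat.strong_induction_on with
    | _ e ihe =>
    intro f hfe hfv hf0
    rcases Nat.eq_zero_or_pos e with he | he
    · have hc : c ∉ f.vars := degreeOf_eq_zero_iff_notMem_vars.1 (by omega)
      by_cases hv : f.vars.Nonempty
      · have hm := Finset.max'_mem f.vars hv
        have hlt : f.vars.max' hv < c := lt_of_le_of_ne (hfv _ hm) (fun h => hc (h ▸ hm))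
        exact ihc _ hlt f (fun i hi => Finset.le_max' _ _ hi) hf0
      · rw [Finset.not_nonempty_iff_eq_empty, vars_eq_empty_iff_eq_C] at hv
        refine ⟨0, ?_⟩
        rw [hv, aeval_C, map_eq_zero_iff _ hinj] at hf0
        rw [hv, hf0, map_zero, mul_zero]
        exact J.zero_mem
    · obtain ⟨f0, hf1, hf2⟩ := split_lead c f (by omega)
      have hlcv : ∀ i ∈ (leadCoeff c f).vars, i ≤ c := fun i hi => hfv i (Finset.mem_of_mem_erase (vars_leadCoeff c f hi))
      have hfs := (mem_supp_le c f).2 hfv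
      have hls := (mem_supp_le c _).2 hlcv
      have hXs : (X c : MvPolynomial σ k) ∈ supported k (Set.Iic c) := X_mem_supported.2 (Set.mem_Iic.2 le_rfl)
      by_cases hlc : aeval ξ (leadCoeff c f) = 0
      · obtain ⟨N1, h1⟩ := ihe 0 he (leadCoeff c f) (degreeOf_leadCoeff c f) hlcv hlc
        have hf0' : f0 = f - leadCoeff c f * X c ^ degreeOf c f := by
          linear_combination -hf1
        obtain ⟨N2, h2⟩ := ihe (degreeOf c f0) (by omega) f0 rfl ((mem_supp_le c f0).1 (by
          rw [hf0']
          exact sub_mem hfs (mul_mem hls (pow_mem hXs _)))) (by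
          rw [hf0', map_sub, map_mul, hf0, hlc]; simp)
        refine ⟨N1 + N2, ?_⟩
        have : h ^ (N1 + N2) * f = (h ^ N2 * X c ^ degreeOf c f) * (h ^ N1 * leadCoeff c f) + h ^ N1 * (h ^ N2 * f0) := by
          rw [pow_add]
          linear_combination (h ^ N1 * h ^ N2) * hf1
        rw [this]
        exact J.add_mem (J.mul_mem_left _ h1) (J.mul_mem_left _ h2)
      · have hR : Rel ξ c f := ⟨hfv, hf0, by omega, hlc⟩
        obtain ⟨hγ1, hγ2, ⟨t, ht⟩, hγ4⟩ := hγ c ⟨f, hR⟩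
        obtain ⟨hg1, hg2, hg3, hg4⟩ := hγ1
        have hle := hγ2 f hR
        obtain ⟨g0, hgg, hgd⟩ := split_lead c (γ c) hg3
        set e' := degreeOf c (γ c) with he'
        set f' := leadCoeff c (γ c) * f - leadCoeff c f * X c ^ (e - e') * γ c with hf'
        have hf'2 : f' = leadCoeff c (γ c) * f0 - leadCoeff c f * X c ^ (e - e') * g0 := by
          have hX : (X c : MvPolynomial σ k) ^ (e - e') * X c ^ e' = X c ^ degreeOf c f := by
            rw [← pow_add]; congr 1; omega
          rw [hf']
          linear_combination leadCoeff c (γ c) * hf1 - leadCoeff c f * X c ^ (e - e') * hgg - leadCoeff c f * leadCoeff c (γ c) * hX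
        have hXd : degreeOf c ((X c : MvPolynomial σ k) ^ (e - e')) ≤ e - e' := by
          refine (degreeOf_pow_le c _ _).trans ?_
          rw [degreeOf_X, if_pos rfl, mul_one]
        have hf'd : degreeOf c f' < e := by
          rw [hf'2]
          refine (degreeOf_sub_le c _ _).trans_lt (max_lt ?_ ?_)
          · refine (degreeOf_mul_le c _ _).trans_lt ?_
            rw [degreeOf_leadCoeff]; omega
          · refine (degreeOf_mul_le c _ _).trans_lt ?_
            have h3 := degreeOf_mul_le c (leadCoeff c f) (X c ^ (e - e'))
            rw [degreeOf_leadCoeff] at h3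
            omega
        have hgs := (mem_supp_le c _).2 hg1
        have hlgs : leadCoeff c (γ c) ∈ supported k (Set.Iic c) := (mem_supp_le c _).2
          fun i hi => hg1 i (Finset.mem_of_mem_erase (vars_leadCoeff c _ hi))
        obtain ⟨N, hN⟩ := ihe (degreeOf c f') hf'd f' rfl ((mem_supp_le c f').1
          (sub_mem (mul_mem hlgs hfs) (mul_mem (mul_mem hls (pow_mem hXs _)) hgs))) (by
          rw [hf', map_sub, map_mul, map_mul, hf0, hg2]; simp)
        refine ⟨N + 1, ?_⟩
        have : h ^ (N + 1) * f = t * (h ^ N * f') + (t * h ^ N * (leadCoeff c f * X c ^ (e - e'))) * γ c := by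
          rw [hf', pow_succ]
          linear_combination (h ^ N * f) * ht
        rw [this]
        exact J.add_mem (J.mul_mem_left _ hN) (J.mul_mem_left _ hγ4)
  exact fun f => main _ f rfl

lemma rel_max {R : Type*} [CommRing R] [Algebra k R] (ξ : σ → R) (c : σ) (g : MvPolynomial σ k) (hg : Rel ξ c g) :
    g.vars.max = (c : WithBot σ) := by
  obtain ⟨h1, h2, h3, h4⟩ := hg
  have hc : c ∈ g.vars := by
    by_contra h
    rw [degreeOf_eq_zero_iff_notMem_vars.2 h] at h3
    omega
  refine le_antisymm (Finset.max_le fun i hi => WithBot.coe_le_coe.2 (h1 i hi)) (Finset.le_max hc)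

theorem tri_exists [Fintype σ] {R : Type*} [CommRing R] [IsDomain R] [Algebra k R] (ξ : σ → R) (B : ℕ)
    (hB : ∀ c, (∃ g : MvPolynomial σ k, Rel ξ c g) → ∃ g : MvPolynomial σ k, Rel ξ c g ∧
      (∀ g' : MvPolynomial σ k, Rel ξ c g' → degreeOf c g ≤ degreeOf c g') ∧ g.totalDegree ≤ B) :
    ∃ G : List (MvPolynomial σ k), IsTriangularSet G ∧ (∀ g ∈ G, g.totalDegree ≤ B) ∧
      trep G = {f | aeval ξ f = 0} := by
  classical
  choose! γ hγ1 hγ2 hγ3 using hB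
  let C : Finset σ := Finset.univ.filter fun c => ∃ g : MvPolynomial σ k, Rel ξ c g
  let L : List σ := C.sort (· ≤ ·)
  have hLC : ∀ c, c ∈ L ↔ ∃ g : MvPolynomial σ k, Rel ξ c g := by
    intro c
    simp [L, C]
  let G := L.map γ
  have hlen : G.length = L.length := List.length_map _
  let cc : Fin G.length → σ := fun i => L.get (i.cast hlen)
  have hcc : ∀ i, G.get i = γ (cc i) := by
    intro i
    simp [G, cc]
  have hccR : ∀ i, ∃ g : MvPolynomial σ k, Rel ξ (cc i) g := fun i => (hLC _).1 (List.get_mem _ _)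
  have hsurj : ∀ c, (∃ g : MvPolynomial σ k, Rel ξ c g) → ∃ i, cc i = c := by
    intro c hc
    obtain ⟨i, hi⟩ := List.get_of_mem ((hLC c).2 hc)
    exact ⟨i.cast hlen.symm, hi⟩
  refine ⟨G, ⟨?_, ?_⟩, ?_, ?_⟩
  · intro g hg
    obtain ⟨c, hc, rfl⟩ := List.mem_map.1 hg
    exact ⟨c, Finset.mem_of_max (rel_max ξ c _ (hγ1 c ((hLC c).1 hc)))⟩
  · apply List.Pairwise.isChain
    rw [List.pairwise_map]
    have hp : L.Pairwise (· < ·) := (Finset.sortedLT_sort C).pairwise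
    refine hp.imp_of_mem fun {a b} ha hb hab => ?_
    rw [rel_max ξ a _ (hγ1 a ((hLC a).1 ha)), rel_max ξ b _ (hγ1 b ((hLC b).1 hb))]
    exact WithBot.coe_lt_coe.2 hab
  · intro g hg
    obtain ⟨c, hc, rfl⟩ := List.mem_map.1 hg
    exact hγ3 c ((hLC c).1 hc)
  · ext f
    constructor
    · rintro ⟨c, α, q, h1, h2, h3⟩
      have hce : ∀ i, c i = cc i := by
        intro i
        have := h1 i
        rw [hcc, rel_max ξ _ _ (hγ1 _ (hccR i))] at this
        exact (WithBot.coe_injective this).symm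
      have h4 := congrArg (aeval ξ) h2
      rw [map_mul, map_prod, add_zero, map_sum, Finset.sum_eq_zero] at h4
      · rcases mul_eq_zero.1 h4 with h5 | h5
        · exfalso
          obtain ⟨i, _, h6⟩ := Finset.prod_eq_zero_iff.1 h5
          rw [map_pow, hce, hcc] at h6
          exact (hγ1 _ (hccR i)).2.2.2 (eq_zero_of_pow_eq_zero h6)
        · exact h5
      · intro i _
        rw [map_mul, hcc, (hγ1 _ (hccR i)).2.1, mul_zero]
    · intro hf
      let h : MvPolynomial σ k := ∏ i, leadCoeff (cc i) (G.get i)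
      let J : Ideal (MvPolynomial σ k) := Ideal.span (Set.range G.get)
      have key : ∃ N : ℕ, h ^ N * f ∈ J := by
        by_cases hv : f.vars.Nonempty
        · refine sat_main ξ γ h J ?_ (f.vars.max' hv) f (fun i hi => Finset.le_max' _ _ hi) hf
          intro c hc
          obtain ⟨i, rfl⟩ := hsurj c hc
          refine ⟨hγ1 _ hc, hγ2 _ hc, ?_, ?_⟩
          · rw [← hcc i]
            exact Finset.dvd_prod_of_mem (fun i => leadCoeff (cc i) (G.get i)) (Finset.mem_univ i)
          · rw [← hcc i]
            exact Ideal.subset_span ⟨i, rfl⟩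
        · rw [Finset.not_nonempty_iff_eq_empty, vars_eq_empty_iff_eq_C] at hv
          refine ⟨0, ?_⟩
          have hf' : aeval ξ f = 0 := hf
          rw [hv, aeval_C, map_eq_zero_iff _ (algebraMap k R).injective] at hf'
          rw [hv, hf', map_zero, mul_zero]
          exact J.zero_mem
      obtain ⟨N, hN⟩ := key
      obtain ⟨q, hq⟩ := (Ideal.mem_span_range_iff_exists_fun).1 hN
      refine ⟨cc, fun _ => N, q, ?_, ?_, ?_⟩
      · intro i
        rw [hcc]
        exact rel_max ξ _ _ (hγ1 _ (hccR i))
      · rw [Finset.prod_pow, add_zero, hq]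
      · intro i
        rw [degreeOf_zero, hcc]
        exact (hγ1 _ (hccR i)).2.2.1
end tri
end EF

namespace EF
section fin
variable {n : ℕ} {k : Type*} [Field k] [CharZero k]

lemma cm_self_fin (x : Mt n k) : cm k x = x := by
  ext i j; rfl

lemma struct (Hbar : Subgroup (GL (Fin n) k)) {τ : Type*} [Fintype τ] (Φ : Mt n (MvPolynomial τ k)) (d : ℕ) (hd : 1 ≤ d)
    (hΦ : ∀ i j, (Φ i j).totalDegree ≤ d) (E : Finset (GL (Fin n) k))
    (hE : ∀ g, g ∈ Hbar ↔ ∃ e ∈ E, ∀ f : Pn n k, ev Φ f = 0 → ev ((e⁻¹ * g : GL (Fin n) k) : Mt n k) f = 0)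
    (D : ℝ) (hD : (tB (n * n) (Fintype.card τ) d : ℝ) ≤ D) : SubgroupTriRepBoundedBy Hbar D := by
  classical
  obtain ⟨e0, he0, _⟩ := (hE 1).1 Hbar.one_mem
  obtain ⟨N, hN⟩ : ∃ N, E.card = N + 1 := ⟨E.card - 1, by have := Finset.card_pos.2 ⟨e0, he0⟩; omega⟩
  let es : Fin (N + 1) ≃ E := (E.equivFinOfCardEq hN).symm
  let Ψ : Fin (N + 1) → Mt n (MvPolynomial τ k) := fun i => cm _ ((es i : GL (Fin n) k) : Mt n k) * Φ
  have hΨd : ∀ i a b, (Ψ i a b).totalDegree ≤ d := by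
    intro i a b
    simp only [Ψ, Matrix.mul_apply]
    refine totalDegree_finsetSum_le fun j _ => (totalDegree_mul _ _).trans ?_
    have h1 : (cm (MvPolynomial τ k) ((es i : GL (Fin n) k) : Mt n k) a j).totalDegree = 0 := totalDegree_C _
    rw [h1, zero_add]
    exact hΦ _ _
  have hG : ∀ i, ∃ G : List (Pn n k), IsTriangularSet G ∧ (∀ g ∈ G, g.totalDegree ≤ tB (n * n) (Fintype.card τ) d) ∧
      trep G = {f | ev (Ψ i) f = 0} := by
    intro i
    have hc : Fintype.card (Fin n ×ₗ Fin n) = n * n := by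
      rw [Fintype.card_congr (ofLex : (Fin n ×ₗ Fin n) ≃ Fin n × Fin n), Fintype.card_prod, Fintype.card_fin]
    rw [← hc]
    exact tri_exists (fun p : Fin n ×ₗ Fin n => Ψ i (ofLex p).1 (ofLex p).2) _ fun c hex =>
      t7 _ d hd (fun p => hΨd i _ _) c hex
  choose G hG1 hG2 hG3 using hG
  let I : Ideal (Pn n k) := ⨅ i, RingHom.ker (ev (Ψ i)).toRingHom
  have hI : ∀ f, f ∈ I ↔ ∀ i, ev (Ψ i) f = 0 := by
    intro f
    simp only [I, Ideal.mem_iInf]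
    rfl
  obtain ⟨S, hS⟩ : I.FG := IsNoetherian.noetherian I
  have hIrad : I.IsRadical := by
    rintro f ⟨m, hm⟩
    rw [hI] at hm ⊢
    intro i
    have := hm i
    rw [map_pow] at this
    exact eq_zero_of_pow_eq_zero this
  refine ⟨S, ?_, N, G, hG1, ?_, ?_, ?_⟩
  · intro g
    simp only [eval_evalMat]
    constructor
    · intro hg p hp
      obtain ⟨e, he, h1⟩ := (hE g).1 hg
      have hpI : p ∈ I := by rw [← hS]; exact Ideal.subset_span hp
      have h2 := (hI p).1 hpI (es.symm ⟨e, he⟩)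
      simp only [Ψ, Equiv.apply_symm_apply] at h2
      rw [← ev_Lt] at h2
      have h3 := h1 _ h2
      rw [ev_Lt, cm_self_fin, ← Units.val_mul, mul_inv_cancel_left] at h3
      exact h3
    · intro hp
      by_contra hg
      rw [hE] at hg
      push Not at hg
      choose! f hf1 hf2 using hg
      let p : Pn n k := ∏ e ∈ E, Lt ((e⁻¹ : GL (Fin n) k) : Mt n k) (f e)
      have hpI : p ∈ I := by
        rw [hI]
        intro i
        rw [map_prod]
        refine Finset.prod_eq_zero (es i).2 ?_
        rw [ev_Lt]
        have : cm (MvPolynomial τ k) (((es i : GL (Fin n) k)⁻¹ : GL (Fin n) k) : Mt n k) * Ψ i = Φ := by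
          simp only [Ψ]
          rw [← mul_assoc, ← cm_mul, ← Units.val_mul, inv_mul_cancel, Units.val_one, cm, Matrix.map_one _ (map_zero _) (map_one _), one_mul]
        rw [this]
        exact hf1 _ (es i).2
      have hker : I ≤ RingHom.ker (ev (g : Mt n k)).toRingHom := by
        rw [← hS, Submodule.span_le]
        intro q hq
        exact hp q hq
      have h0 : ev (g : Mt n k) p = 0 := hker hpI
      rw [map_prod] at h0
      obtain ⟨e, he, h1⟩ := Finset.prod_eq_zero_iff.1 h0
      rw [ev_Lt, cm_self_fin, ← Units.val_mul] at h1
      exact hf2 e he h1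
  · intro i g hg
    exact (Nat.cast_le.2 (hG2 i g hg)).trans hD
  · intro i
    refine ⟨RingHom.ker (ev (Ψ i)).toRingHom, (RingHom.ker_isPrime _).isRadical, ?_⟩
    rw [hG3]; rfl
  · have hs : Ideal.span (S : Set (Pn n k)) = I := hS
    rw [hs, hIrad.radical]
    ext f
    simp only [SetLike.mem_coe, hI, Set.mem_iInter, hG3]
    rfl
end fin
end EF

namespace EF
lemma dl_le (m d b a mm : ℕ) (hm : m + 1 ≤ 2 ^ b) (hmm : m ≤ mm) (hd : d ≤ 2 ^ a) : dl m d ≤ 2 ^ (b + (b + a) * mm + 1) := by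
  unfold dl pD
  have h1 : ((m + 1) * d) ^ m ≤ 2 ^ ((b + a) * mm) := by
    calc ((m + 1) * d) ^ m ≤ (2 ^ b * 2 ^ a) ^ m := Nat.pow_le_pow_left (Nat.mul_le_mul hm hd) _
      _ ≤ (2 ^ b * 2 ^ a) ^ mm := Nat.pow_le_pow_right (by positivity) hmm
      _ = _ := by rw [← pow_add, ← pow_mul]
  have h2 : 1 ≤ 2 ^ ((b + a) * mm) := Nat.one_le_two_pow
  calc (m + 1) * (((m + 1) * d) ^ m + 1) ≤ 2 ^ b * (2 * 2 ^ ((b + a) * mm)) := Nat.mul_le_mul hm (by omega)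
    _ = _ := by ring

lemma tB_le (n r : ℕ) (hn : 1 < n) (hr : r ≤ n ^ 2) :
    tB (n * n) (r + (n + 1)) (r * n + (n + 1) * pbd n) ≤ 2 ^ 2 ^ ((2 ^ n) ^ 10) := by
  obtain ⟨T, hT⟩ : ∃ T, T = 2 ^ n := ⟨_, rfl⟩
  rw [← hT]
  have hnT : n + 1 ≤ T := by rw [hT]; exact Nat.lt_two_pow_self
  have h2n : 2 * n ≤ T := by
    rw [hT]
    obtain ⟨j, rfl⟩ : ∃ j, n = j + 1 := ⟨n - 1, by omega⟩
    have := Nat.lt_two_pow_self (n := j)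
    rw [pow_succ]; omega
  have hT4 : 4 ≤ T := by omega
  have hpw : ∀ i j : ℕ, i ≤ j → T ^ i ≤ T ^ j := fun i j h => Nat.pow_le_pow_right (by omega) h
  have hps' : ∀ i j : ℕ, j = i + 1 → 4 * T ^ i ≤ T ^ j := by
    rintro i j rfl
    rw [pow_succ, mul_comm]; exact Nat.mul_le_mul_left _ hT4
  have hT1 : T ^ 1 = T := pow_one T
  have hp1 : ∀ i : ℕ, 1 ≤ T ^ i := fun i => Nat.one_le_pow _ _ (by omega)
  have hTT : T ^ 2 ≤ 2 ^ T := by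
    calc T ^ 2 = 2 ^ (n * 2) := by rw [hT, ← pow_mul]
      _ ≤ _ := Nat.pow_le_pow_right (by norm_num) (by omega)
  have hn2 : n ^ 2 + n + 2 ≤ T ^ 2 := by nlinarith
  set m := r + (n + 1) with hm
  have hm1 : m + 1 ≤ 2 ^ T := by omega
  have hm2 : m ≤ T ^ 2 := by omega
  have hs1 : n * n + 1 ≤ 2 ^ T := by nlinarith
  have hs2 : n * n ≤ T ^ 2 := by nlinarith
  set d := r * n + (n + 1) * pbd n with hd
  have hdd : d ≤ 2 ^ (T ^ 3) := by
    have h1 : r * n ≤ 2 ^ (2 * T) := by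
      calc r * n ≤ 2 ^ T * 2 ^ T := Nat.mul_le_mul (by omega) (by
            have := Nat.lt_two_pow_self (n := T); omega)
        _ = _ := by ring
    have h8 : 8 * n ≤ 2 ^ (2 * T) := by
      calc 8 * n ≤ 2 ^ 3 * 2 ^ n := Nat.mul_le_mul (by norm_num) Nat.lt_two_pow_self.le
        _ = 2 ^ (3 + n) := by rw [pow_add]
        _ ≤ _ := Nat.pow_le_pow_right (by norm_num) (by omega)
    have h2 : pbd n ≤ 2 * 2 ^ (2 * T ^ 2) := by
      unfold pbd
      refine Nat.mul_le_mul_left _ ?_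
      rw [← hT]
      calc (8 * n) ^ T ≤ (2 ^ (2 * T)) ^ T := Nat.pow_le_pow_left h8 _
        _ = _ := by rw [← pow_mul]; congr 1; ring
    have h3 : (n + 1) * pbd n ≤ 2 ^ (T + 1 + 2 * T ^ 2) := by
      calc (n + 1) * pbd n ≤ 2 ^ T * (2 * 2 ^ (2 * T ^ 2)) := Nat.mul_le_mul (by omega) h2
        _ = _ := by rw [pow_add, pow_add]; ring
    have h4 : 2 ^ (2 * T) ≤ 2 ^ (T + 1 + 2 * T ^ 2) := Nat.pow_le_pow_right (by norm_num) (by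
      have := hpw 1 2 (by norm_num); omega)
    calc d ≤ 2 * 2 ^ (T + 1 + 2 * T ^ 2) := by omega
      _ = 2 ^ (T + 1 + 2 * T ^ 2 + 1) := by rw [pow_succ _ (T + 1 + 2 * T ^ 2)]; ring
      _ ≤ _ := Nat.pow_le_pow_right (by norm_num) (by
        have := hps' 2 3 rfl; have := hps' 1 2 rfl; have := hp1 1; omega)
  set δ := dl m d with hδ
  have hδd : δ ≤ 2 ^ (T ^ 6) := by
    refine (dl_le m d T (T ^ 3) (T ^ 2) hm1 hm2 hdd).trans (Nat.pow_le_pow_right (by norm_num) ?_)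
    have e1 : T + (T + T ^ 3) * T ^ 2 + 1 = T ^ 1 + T ^ 3 + T ^ 5 + 1 := by ring
    rw [e1]
    have := hps' 5 6 rfl; have := hpw 1 5 (by norm_num); have := hpw 3 5 (by norm_num); have := hp1 5
    omega
  have hδ1 : δ + 1 ≤ 2 ^ (T ^ 6 + 1) := by
    have : 1 ≤ 2 ^ (T ^ 6) := Nat.one_le_two_pow
    rw [pow_succ]; omega
  have hδ0 : 1 ≤ δ := dl_pos _ _
  have hd2 : d2 (n * n) m d ≤ 2 ^ (T ^ 7) := by
    unfold d2
    rw [← hδ]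
    calc (n * n + 1) * (2 * δ * ((δ + 1) * d)) ≤ 2 ^ T * (2 * 2 ^ (T ^ 6) * (2 ^ (T ^ 6 + 1) * 2 ^ (T ^ 3))) := by gcongr
      _ = 2 ^ (T + 2 + 2 * T ^ 6 + T ^ 3) := by simp only [pow_add, two_mul]; ring
      _ ≤ _ := Nat.pow_le_pow_right (by norm_num) (by
        have := hps' 6 7 rfl; have := hpw 3 5 (by norm_num); have := hpw 1 5 (by norm_num); have := hps' 5 6 rfl; have := hp1 5
        omega)
  have hΔ : dl m (d2 (n * n) m d) ≤ 2 ^ (T ^ 10 - 1) := by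
    refine (dl_le m _ T (T ^ 7) (T ^ 2) hm1 hm2 hd2).trans (Nat.pow_le_pow_right (by norm_num) ?_)
    have e1 : T + (T + T ^ 7) * T ^ 2 + 1 = T ^ 1 + T ^ 3 + T ^ 9 + 1 := by ring
    rw [e1]
    have := hps' 9 10 rfl; have := hps' 8 9 rfl; have := hpw 1 8 (by norm_num); have := hpw 3 8 (by norm_num); have := hp1 8
    omega
  have hex : δ ^ (n * n) * (δ + 1) ≤ 2 ^ (T ^ 9) := by
    calc δ ^ (n * n) * (δ + 1) ≤ (2 ^ (T ^ 6)) ^ (T ^ 2) * 2 ^ (T ^ 6 + 1) := by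
          refine Nat.mul_le_mul ?_ hδ1
          exact (Nat.pow_le_pow_right hδ0 hs2).trans (Nat.pow_le_pow_left hδd _)
      _ = 2 ^ (T ^ 8 + T ^ 6 + 1) := by rw [← pow_mul, ← pow_add, ← pow_add]; ring_nf
      _ ≤ _ := Nat.pow_le_pow_right (by norm_num) (by
        have := hps' 8 9 rfl; have := hpw 6 8 (by norm_num); have := hp1 8
        omega)
  have hlast : (n * n + 1) * (δ * (δ + 1)) ≤ 2 ^ (T ^ 10 - 1) := by
    calc (n * n + 1) * (δ * (δ + 1)) ≤ 2 ^ T * (2 ^ (T ^ 6) * 2 ^ (T ^ 6 + 1)) := by gcongr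
      _ = 2 ^ (T + 2 * T ^ 6 + 1) := by simp only [pow_add, two_mul]; ring
      _ ≤ _ := Nat.pow_le_pow_right (by norm_num) (by
        have := hps' 6 7 rfl; have := hps' 7 8 rfl; have := hpw 8 10 (by norm_num); have := hpw 1 6 (by norm_num); have := hp1 6
        omega)
  unfold tB
  rw [← hδ]
  have hb : 2 ^ (δ ^ (n * n) * (δ + 1)) ≤ 2 ^ (2 ^ (T ^ 9)) := Nat.pow_le_pow_right (by norm_num) hex
  have h1 : 1 ≤ 2 ^ (2 ^ (T ^ 9)) := Nat.one_le_two_pow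
  calc 2 ^ (δ ^ (n * n) * (δ + 1)) * dl m (d2 (n * n) m d) + (n * n + 1) * (δ * (δ + 1))
      ≤ 2 ^ (2 ^ (T ^ 9)) * 2 ^ (T ^ 10 - 1) + 2 ^ (2 ^ (T ^ 9)) * 2 ^ (T ^ 10 - 1) := by
        refine add_le_add (Nat.mul_le_mul hb hΔ) (hlast.trans ?_)
        exact Nat.le_mul_of_pos_left _ (by omega)
    _ = 2 ^ (2 ^ (T ^ 9) + T ^ 10) := by
        rw [← two_mul, ← pow_add, ← pow_succ']
        congr 1
        have := hp1 10
        omega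
    _ ≤ _ := by
        refine Nat.pow_le_pow_right (by norm_num) ?_
        have e1 : T ^ 10 ≤ 2 ^ (T ^ 9) := by
          calc T ^ 10 = 2 ^ (n * 10) := by rw [hT, ← pow_mul]
            _ ≤ _ := Nat.pow_le_pow_right (by norm_num) (by
              have := hps' 1 2 rfl; have := hps' 2 3 rfl; have := hpw 3 9 (by norm_num); omega)
        calc 2 ^ (T ^ 9) + T ^ 10 ≤ 2 ^ (T ^ 9 + 1) := by rw [pow_succ _ (T ^ 9)]; omega
          _ ≤ _ := Nat.pow_le_pow_right (by norm_num) (by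
            have := hps' 9 10 rfl; have := hp1 9; omega)

lemma d3_ge (n : ℕ) (hn : 1 < n) : ((2 ^ 2 ^ ((2 ^ n) ^ 10) : ℕ) : ℝ) ≤ d3Bound n := by
  have hn1 : (2 : ℝ) ≤ n := by exact_mod_cast hn
  have hn3 : (1 : ℝ) ≤ (n : ℝ) ^ 3 := one_le_pow₀ (by linarith)
  have hn8 : (n : ℝ) ≤ (n : ℝ) ^ 8 := le_self_pow₀ (by linarith) (by norm_num)
  have hM : (((2 ^ n) ^ 10 : ℕ) : ℝ) ≤ (2 * (n : ℝ) ^ 3) ^ (149 * (n : ℝ) ^ 8) := by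
    have e : (((2 ^ n) ^ 10 : ℕ) : ℝ) = (2 : ℝ) ^ ((n * 10 : ℕ) : ℝ) := by
      rw [Real.rpow_natCast, pow_mul]; push_cast; rfl
    rw [e]
    calc (2 : ℝ) ^ ((n * 10 : ℕ) : ℝ) ≤ (2 : ℝ) ^ (149 * (n : ℝ) ^ 8) :=
          Real.rpow_le_rpow_of_exponent_le (by norm_num) (by push_cast; linarith)
      _ ≤ _ := Real.rpow_le_rpow (by norm_num) (by linarith) (by positivity)
  have h16 : ((2 ^ ((2 ^ n) ^ 10) : ℕ) : ℝ) ≤ (16 : ℝ) ^ ((2 * (n : ℝ) ^ 3) ^ (149 * (n : ℝ) ^ 8)) := by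
    have e : ((2 ^ ((2 ^ n) ^ 10) : ℕ) : ℝ) = (2 : ℝ) ^ (((2 ^ n) ^ 10 : ℕ) : ℝ) := by
      rw [Real.rpow_natCast]; push_cast; rfl
    rw [e]
    calc _ ≤ (16 : ℝ) ^ (((2 ^ n) ^ 10 : ℕ) : ℝ) := Real.rpow_le_rpow (by norm_num) (by norm_num) (by positivity)
      _ ≤ _ := Real.rpow_le_rpow_of_exponent_le (by norm_num) hM
  have e : ((2 ^ 2 ^ ((2 ^ n) ^ 10) : ℕ) : ℝ) = (2 : ℝ) ^ ((2 ^ ((2 ^ n) ^ 10) : ℕ) : ℝ) := by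
    rw [Real.rpow_natCast]; push_cast; rfl
  rw [e]
  unfold d3Bound
  have hpos : (0 : ℝ) ≤ (16 : ℝ) ^ ((2 * (n : ℝ) ^ 3) ^ (149 * (n : ℝ) ^ 8)) := by positivity
  calc (2 : ℝ) ^ ((2 ^ ((2 ^ n) ^ 10) : ℕ) : ℝ) ≤ (8 : ℝ) ^ ((2 ^ ((2 ^ n) ^ 10) : ℕ) : ℝ) :=
        Real.rpow_le_rpow (by norm_num) (by norm_num) (by positivity)
    _ ≤ (8 : ℝ) ^ (5.5 * (n : ℝ) ^ 3 * (16 : ℝ) ^ ((2 * (n : ℝ) ^ 3) ^ (149 * (n : ℝ) ^ 8))) := by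
        refine Real.rpow_le_rpow_of_exponent_le (by norm_num) (h16.trans ?_)
        exact le_mul_of_one_le_left hpos (by linarith)
    _ ≤ _ := le_mul_of_one_le_left (by positivity) (by linarith)
end EF

/-- For `n > 1` there is a family `𝓕̄` of algebraic subgroups of `GL_n(k)`,
each with a triangular representation bounded by `n·8^(5.5n³·16^((2n³)^(149n⁸)))`, such that
every algebraic subgroup `H' ⊆ GL_n(k)` admits `H̄ ∈ 𝓕̄` with `H' ⊆ H̄` and every unipotent
element of `H̄` lying in `(H')°`. -/
theorem enlarged_family {k : Type*} [Field k] [IsAlgClosed k] [CharZero k]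
    (n : ℕ) (hn : 1 < n) :
    ∃ F : Set (Subgroup (GL (Fin n) k)),
      (∀ H ∈ F, SubgroupTriRepBoundedBy H (d3Bound n)) ∧
      ∀ H' : Subgroup (GL (Fin n) k), IsAlgebraicSubgroup H' →
        ∃ Hbar ∈ F, H' ≤ Hbar ∧
          ∀ g ∈ Hbar, IsUnipotent g → g ∈ idComponent H' := by
  refine ⟨{H | SubgroupTriRepBoundedBy H (d3Bound n)}, fun H hH => hH, fun H' hH' => ?_⟩
  obtain ⟨Hbar, h1, h2, r, hr, Φ, hΦ, E, hE⟩ := EF.group_half H' hH'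
  refine ⟨Hbar, ?_, h1, h2⟩
  have hp : 1 ≤ EF.pbd n := by
    unfold EF.pbd
    exact Nat.succ_le_of_lt (by positivity)
  have hd : 1 ≤ r * n + (n + 1) * EF.pbd n :=
    le_trans (Nat.succ_le_of_lt (Nat.mul_pos (Nat.succ_pos n) hp)) (Nat.le_add_left _ _)
  refine EF.struct Hbar Φ _ hd hΦ E hE _ ?_
  have hc : Fintype.card (Fin r ⊕ Fin (n + 1)) = r + (n + 1) := by simp
  rw [hc]
  exact (Nat.cast_le.2 (EF.tB_le n r hn hr)).trans (EF.d3_ge n hn)
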